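/- Assume the Riemann Hypothesis and let 0 < B₁ ≤ B₂ ≤ 1. If F(X,T) ~ (T/(2π)) log T as X → ∞, uniformly for X^{B₁}(log X)^{−3} ≤ T ≤ X^{B₂}(log X)³, then I(X,δ) := ∫₁^X (ψ((1+δ)x) − ψ(x) − δx)² dx ~ (1/2) δ X² log(1/δ) as X → ∞, uniformly for X^{−B₂} ≤ δ ≤ X^{−B₁}. -/

import Mathlib

open Complex Filter MeasureTheory Real Set

noncomputable section

/-- A non-trivial zero of the Riemann zeta function. -/
def ZetaNontrivZero (ρ : ℂ) : Prop := riemannZeta ρ = 0 ∧ 0 < ρ.re ∧ ρ.re < 1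

/-- The multiplicity of `ρ` as a zero of `ζ`. -/
def zetaMult (ρ : ℂ) : ℕ := sInf {n : ℕ | iteratedDeriv n riemannZeta ρ ≠ 0}

/-- The set of non-trivial zeros with ordinate in `(0, T]`. -/
def zerosUpTo (T : ℝ) : Set ℂ := {ρ | ZetaNontrivZero ρ ∧ 0 < ρ.im ∧ ρ.im ≤ T}

/-- Montgomery's pair correlation function `F(x,T)`, zeros counted with multiplicity. -/
def Fxt (x T : ℝ) : ℂ :=
  ∑' p : zerosUpTo T × zerosUpTo T,
    (zetaMult p.1 * zetaMult p.2 : ℂ) *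
      Complex.exp (Complex.I * (((p.1 : ℂ).im - (p.2 : ℂ).im : ℝ) : ℂ) * (Real.log x : ℂ)) *
      ((4 / (4 + ((p.1 : ℂ).im - (p.2 : ℂ).im) ^ 2) : ℝ) : ℂ)

/-- The Chebyshev function `ψ(x) = ∑_{n ≤ x} Λ(n)`. -/
def chebyshevPsi (x : ℝ) : ℝ := ∑ n ∈ Finset.Iic ⌊x⌋₊, ArithmeticFunction.vonMangoldt n

/-- The second moment of primes in short intervals
`I(X,δ) = ∫₁^X (ψ((1+δ)x) - ψ(x) - δx)² dx`. -/
def Imoment (X δ : ℝ) : ℝ :=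
  ∫ x in (1 : ℝ)..X, (chebyshevPsi ((1 + δ) * x) - chebyshevPsi x - δ * x) ^ 2

section ModPl
open Complex Filter MeasureTheory Real Set
open scoped FourierTransform SchwartzMap
theorem fourier_L2_ae_eq (f : ℝ → ℂ) (h1 : Integrable f) (h2 : MemLp f 2) :
    ((𝓕 (h2.toLp f) : Lp (α := ℝ) ℂ 2) : ℝ → ℂ) =ᵐ[volume] 𝓕 f := by
  have hcont : Continuous (𝓕 f) :=
    VectorFourier.fourierIntegral_continuous Real.continuous_fourierChar (by fun_prop) h1
  refine ae_eq_of_integral_contDiff_smul_eq ?_ ?_ ?_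
  · exact (Lp.memLp _).locallyIntegrable (by norm_num)
  · exact hcont.locallyIntegrable
  intro g hg hgc
  have hgc' : HasCompactSupport (fun x => (g x : ℂ)) := by
    simpa [Function.comp_def] using hgc.comp_left (g := fun x : ℝ => (x : ℂ)) (by simp)
  let φ : 𝓢(ℝ, ℂ) := hgc'.toSchwartzMap (Complex.ofRealCLM.contDiff.comp hg)
  have e := congrArg (fun T : 𝓢'(ℝ, ℂ) => T φ) (Lp.fourier_toTemperedDistribution_eq (h2.toLp f))
  simp only [TemperedDistribution.fourier_apply, Lp.toTemperedDistribution_apply] at e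
  have e1 : ∀ x, φ x = (g x : ℂ) := fun x => rfl
  have e2 : ∫ x, (𝓕 φ) x • (h2.toLp f) x = ∫ x, (𝓕 φ) x • f x := by
    refine integral_congr_ae ?_
    filter_upwards [h2.coeFn_toLp] with x hx
    rw [hx]
  have e3 : ∫ x, (𝓕 φ) x • f x = ∫ x, φ x • 𝓕 f x := by
    rw [SchwartzMap.fourier_coe]
    have := VectorFourier.integral_fourierIntegral_smul_eq_flip (μ := volume) (ν := volume)
      (L := innerₗ ℝ) (f := φ) (g := f) Real.continuous_fourierChar (by fun_prop) φ.integrable h1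
    rw [flip_innerₗ] at this
    exact this
  rw [e2, e3] at e
  simp only [e1] at e
  simpa using e.symm

/-- Fourier transform with angular frequency. -/
def FT (f : ℝ → ℂ) (t : ℝ) : ℂ := ∫ y : ℝ, Complex.exp (-(Complex.I * t * y)) * f y

lemma FT_eq (f : ℝ → ℂ) (t : ℝ) : FT f t = 𝓕 f (t / (2 * π)) := by
  rw [Real.fourier_real_eq_integral_exp_smul, FT]
  congr 1
  ext y
  rw [smul_eq_mul]
  congr 2
  push_cast
  have : (π : ℂ) ≠ 0 := by exact_mod_cast Real.pi_ne_zero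
  field_simp

theorem FT_cont (f : ℝ → ℂ) (h1 : Integrable f) : Continuous (FT f) := by
  have hcont : Continuous (𝓕 f) :=
    VectorFourier.fourierIntegral_continuous Real.continuous_fourierChar (by fun_prop) h1
  have : FT f = fun t => 𝓕 f (t / (2 * π)) := funext (FT_eq f)
  rw [this]; fun_prop

theorem plancherel_FT (f : ℝ → ℂ) (h1 : Integrable f) (h2 : MemLp f 2) :
    Integrable (fun t => ‖FT f t‖ ^ 2) ∧ ∫ y, ‖f y‖ ^ 2 = (1 / (2 * π)) * ∫ t, ‖FT f t‖ ^ 2 := by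
  have hae := fourier_L2_ae_eq f h1 h2
  have hm : MemLp (𝓕 f) 2 := (memLp_congr_ae hae).1 (Lp.memLp _)
  have hi : Integrable (fun t => ‖𝓕 f t‖ ^ 2) := (memLp_two_iff_integrable_sq_norm hm.1).1 hm
  have e : ∫ y, ‖f y‖ ^ 2 = ∫ t, ‖𝓕 f t‖ ^ 2 := by
    have a1 : ∀ (g : Lp (α := ℝ) ℂ 2), ‖g‖ ^ 2 = ∫ x, ‖g x‖ ^ 2 := by
      intro g
      have := L2.inner_def (𝕜 := ℂ) g g
      rw [inner_self_eq_norm_sq_to_K] at this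
      have h3 : (∫ a, inner ℂ (g a) (g a)) = ((∫ x, ‖g x‖ ^ 2 : ℝ) : ℂ) := by
        rw [← integral_complex_ofReal]
        congr 1; ext a
        rw [inner_self_eq_norm_sq_to_K]; push_cast; rfl
      rw [h3] at this
      rw [← RCLike.ofReal_pow] at this
      exact Complex.ofReal_injective this
    have a2 := a1 (h2.toLp f)
    have a3 := a1 (𝓕 (h2.toLp f))
    rw [Lp.norm_fourier_eq, a2] at a3
    have a4 : ∫ x, ‖(h2.toLp f) x‖ ^ 2 = ∫ y, ‖f y‖ ^ 2 := by
      refine integral_congr_ae ?_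
      filter_upwards [h2.coeFn_toLp] with x hx
      rw [hx]
    have a5 : ∫ x, ‖(𝓕 (h2.toLp f) : Lp (α := ℝ) ℂ 2 volume) x‖ ^ 2 = ∫ y, ‖𝓕 f y‖ ^ 2 := by
      refine integral_congr_ae ?_
      filter_upwards [hae] with x hx
      rw [hx]
    rw [← a4, a3, a5]
  have hpi : (2 * π) ≠ 0 := by positivity
  simp only [FT_eq]
  constructor
  · exact hi.comp_div hpi
  · rw [e, Measure.integral_comp_div (fun t => ‖𝓕 f t‖ ^ 2) (2 * π), abs_of_pos (by positivity),
      smul_eq_mul, ← mul_assoc, one_div, inv_mul_cancel₀ hpi, one_mul]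

end ModPl

section ModA
open Complex Filter MeasureTheory Real Set
open scoped Topology
lemma factor_zeros (U : Set ℂ) (F : ℂ → ℂ) (hF : AnalyticOnNhd ℂ F U) (S : Finset ℂ)
    (hS : ∀ u ∈ S, u ∈ U) (hfin : ∀ u ∈ S, analyticOrderAt F u ≠ ⊤) :
    ∃ G : ℂ → ℂ, AnalyticOnNhd ℂ G U ∧
      (∀ z, F z = (∏ u ∈ S, (z - u) ^ analyticOrderNatAt F u) * G z) ∧ (∀ u ∈ S, G u ≠ 0) := by
  classical
  have hg : ∀ u : ℂ, ∃ g : ℂ → ℂ, u ∈ S → (AnalyticAt ℂ g u ∧ g u ≠ 0 ∧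
      ∀ᶠ z in 𝓝 u, F z = (z - u) ^ analyticOrderNatAt F u * g z) := by
    intro u
    by_cases hu : u ∈ S
    · obtain ⟨g, h⟩ := (hF u (hS u hu)).analyticOrderAt_ne_top.1 (hfin u hu)
      exact ⟨g, fun _ => by simpa [Filter.EventuallyEq] using h⟩
    · exact ⟨0, fun h => absurd h hu⟩
  choose g hg using hg
  set n := fun u => analyticOrderNatAt F u with hn
  let P : Finset ℂ → ℂ → ℂ := fun S z => ∏ u ∈ S, (z - u) ^ n u
  have hPan : ∀ S z, AnalyticAt ℂ (P S) z := by
    intro S z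
    have : AnalyticAt ℂ (fun z => ∏ u ∈ S, (z - u) ^ n u) z :=
      Finset.analyticAt_fun_prod S (fun u _ => (analyticAt_id.sub analyticAt_const).pow _)
    exact this
  have hP0 : ∀ (S : Finset ℂ) z, z ∉ S → P S z ≠ 0 := by
    intro S z hz
    refine Finset.prod_ne_zero_iff.2 fun u hu => pow_ne_zero _ (sub_ne_zero.2 ?_)
    rintro rfl; exact hz hu
  have hPs : ∀ u ∈ S, ∀ z, P S z = (z - u) ^ n u * P (S.erase u) z := by
    intro u hu z
    exact (Finset.mul_prod_erase S (fun u => (z - u) ^ n u) hu).symm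
  let G : ℂ → ℂ := fun z => if z ∈ S then g z z / P (S.erase z) z else F z / P S z
  refine ⟨G, ?_, ?_, ?_⟩
  · intro z hz
    by_cases hzS : z ∈ S
    · have h1 : AnalyticAt ℂ (fun w => g z w / P (S.erase z) w) z :=
        ((hg z hzS).1).div (hPan _ _) (hP0 _ _ (by simp))
      refine h1.congr ?_
      have h2 : ∀ᶠ w in 𝓝 z, w ∉ S.erase z := by
        have : IsClosed ((S.erase z : Finset ℂ) : Set ℂ) := (S.erase z).finite_toSet.isClosed
        exact this.isOpen_compl.mem_nhds (by simp)
      filter_upwards [(hg z hzS).2.2, h2] with w hw1 hw2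
      by_cases hwz : w = z
      · subst hwz; simp [G, hzS]
      · have hwS : w ∉ S := fun h => hw2 (Finset.mem_erase.2 ⟨hwz, h⟩)
        simp only [G, hwS, if_false]
        rw [hPs z hzS w, hw1]
        have : (w - z) ^ n z ≠ 0 := pow_ne_zero _ (sub_ne_zero.2 hwz)
        rw [mul_div_mul_left _ _ this]
    · have h1 : AnalyticAt ℂ (fun w => F w / P S w) z := (hF z hz).div (hPan _ _) (hP0 _ _ hzS)
      refine h1.congr ?_
      have h2 : ∀ᶠ w in 𝓝 z, w ∉ S := S.finite_toSet.isClosed.isOpen_compl.mem_nhds (by simpa)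
      filter_upwards [h2] with w hw
      simp [G, hw]
  · intro z
    change F z = P S z * G z
    by_cases hzS : z ∈ S
    · have h1 := (hg z hzS).2.2.self_of_nhds
      have h2 := hP0 (S.erase z) z (by simp)
      simp only [G, hzS, if_true]
      rw [hPs z hzS z, h1]
      change (z - z) ^ n z * _ = _
      field_simp
    · simp only [G, hzS, if_false]
      have := hP0 S z hzS
      field_simp
  · intro u hu
    simp only [G, hu, if_true]
    exact div_ne_zero (hg u hu).2.1 (hP0 _ _ (by simp))

lemma zeros_count (F : ℂ → ℂ) (c : ℂ) (M : ℝ) (hF : AnalyticOnNhd ℂ F (Metric.closedBall c (19/10)))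
    (h0 : F c ≠ 0) (hM : 2 ≤ M) (hb : ∀ z ∈ Metric.closedBall c (19/10), ‖F z‖ ≤ M * ‖F c‖) :
    ∃ S : Finset ℂ, (∀ u, u ∈ S ↔ u ∈ Metric.closedBall c (9/5) ∧ F u = 0) ∧
      (∀ u ∈ S, analyticOrderAt F u ≠ ⊤) ∧
      (∑ u ∈ S, (analyticOrderNatAt F u : ℝ)) ≤ Real.log M / Real.log ((19/10)/(9/5)) := by
  classical
  have hsub : Metric.closedBall c (9/5) ⊆ Metric.closedBall c (19/10) :=
    Metric.closedBall_subset_closedBall (by norm_num)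
  have hF' := hF.mono hsub
  have htop : ∀ u ∈ Metric.closedBall c (19/10), analyticOrderAt F u ≠ ⊤ := by
    intro u hu
    refine hF.analyticOrderAt_ne_top_of_isPreconnected (convex_closedBall c _).isPreconnected
      (Metric.mem_closedBall_self (by norm_num)) hu ?_
    rw [(analyticOrderAt_eq_zero).2 (Or.inr h0)]; simp
  have hdiv : ∀ u ∈ Metric.closedBall c (9/5), MeromorphicOn.divisor F (Metric.closedBall c (9/5)) u
      = (analyticOrderNatAt F u : ℤ) := by
    intro u hu
    rw [MeromorphicOn.AnalyticOnNhd.divisor_apply hF' hu, ← Nat.cast_analyticOrderNatAt (htop u (hsub hu))]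
    rfl
  have hfs := (MeromorphicOn.divisor F (Metric.closedBall c (9/5))).finiteSupport (isCompact_closedBall ..)
  have hkey : ∀ u, u ∈ hfs.toFinset ↔ u ∈ Metric.closedBall c (9/5) ∧ F u = 0 := by
    intro u
    rw [Set.Finite.mem_toFinset, Function.mem_support]
    by_cases hu : u ∈ Metric.closedBall c (9/5)
    · rw [hdiv u hu]
      simp only [hu, true_and]
      have h1 := (hF' u hu).analyticOrderAt_ne_zero
      rw [← h1, ← Nat.cast_analyticOrderNatAt (htop u (hsub hu))]
      norm_cast
    · simp only [hu, false_and, iff_false, not_not]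
      exact Function.locallyFinsuppWithin.apply_eq_zero_of_notMem _ hu
  refine ⟨hfs.toFinset, hkey, fun u hu => htop u (hsub ((hkey u).1 hu).1), ?_⟩
  set H : ℂ → ℂ := fun z => (F c)⁻¹ * F z with hH
  have hHan : AnalyticOnNhd ℂ H (Metric.closedBall c (19/10)) := fun z hz => analyticAt_const.mul (hF z hz)
  have hHo : ∀ u ∈ Metric.closedBall c (9/5), MeromorphicOn.divisor H (Metric.closedBall c (9/5)) u
      = (analyticOrderNatAt F u : ℤ) := by
    intro u hu
    rw [MeromorphicOn.AnalyticOnNhd.divisor_apply (hHan.mono hsub) hu]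
    have : analyticOrderAt H u = analyticOrderAt F u := by
      have h := analyticOrderAt_mul (f := fun _ : ℂ => (F c)⁻¹) (g := F) (z₀ := u) analyticAt_const (hF' u hu)
      have h2 : analyticOrderAt (fun _ : ℂ => (F c)⁻¹) u = 0 :=
        (analyticOrderAt_eq_zero).2 (Or.inr (inv_ne_zero h0))
      rw [h2, zero_add] at h
      exact h
    rw [this, ← Nat.cast_analyticOrderNatAt (htop u (hsub hu))]
    rfl
  have hHc : H c = 1 := by simp [hH, h0]
  have hJ := AnalyticOnNhd.sum_divisor_le (c := c) (r := 9/5) (R := 19/10) (M := M) (f := H)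
    (by norm_num) (by norm_num [abs_of_pos]) (by linarith)
    (by rwa [abs_of_pos (by norm_num)]) (by rw [hHc]; exact one_ne_zero)
    (fun z hz => by
      have := (hb z (Metric.sphere_subset_closedBall (by rwa [abs_of_pos (by norm_num)] at hz)))
      have h3 : 0 < ‖F c‖ := norm_pos_iff.2 h0
      rw [hH, norm_mul, norm_inv, inv_mul_le_iff₀ h3]; linarith)
  rw [hHc, norm_one, div_one, abs_of_pos (by norm_num : (0:ℝ) < 9/5)] at hJ
  refine le_trans (le_of_eq ?_) hJ
  rw [finsum_eq_sum_of_support_subset (s := hfs.toFinset)]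
  · push_cast
    refine Finset.sum_congr rfl fun u hu => ?_
    rw [hHo u ((hkey u).1 hu).1]; simp
  · intro u hu
    rw [Finset.mem_coe, Set.Finite.mem_toFinset, Function.mem_support]
    by_cases hu' : u ∈ Metric.closedBall c (9/5)
    · rw [hdiv u hu', ← hHo u hu']; exact hu
    · exact absurd (Function.locallyFinsuppWithin.apply_eq_zero_of_notMem _ hu') hu

/-- log derivative bound for nonvanishing function -/
lemma logDeriv_bound (G : ℂ → ℂ) (c : ℂ) (A : ℝ) (hA : 0 < A)
    (hG : DifferentiableOn ℂ G (Metric.ball c (9/5)))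
    (h0 : ∀ z ∈ Metric.ball c (9/5), G z ≠ 0)
    (hb : ∀ z ∈ Metric.ball c (9/5), ‖G z‖ ≤ Real.exp A * ‖G c‖) :
    ∀ z ∈ Metric.closedBall c (17/10), ‖deriv G z / G z‖ ≤ 1400 * A := by
  have hopen : IsOpen (Metric.ball c (9/5)) := Metric.isOpen_ball
  have hdd : DifferentiableOn ℂ (fun z => deriv G z / G z) (Metric.ball c (9/5)) :=
    (hG.deriv hopen).div hG h0
  obtain ⟨g, hgc, hg⟩ := (hdd.isExactOn_ball).with_val_at c 0
  have hcm : c ∈ Metric.ball c (9/5) := Metric.mem_ball_self (by norm_num)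
  have hexp : ∀ z ∈ Metric.ball c (9/5), G z = G c * Complex.exp (g z) := by
    have hd : ∀ z ∈ Metric.ball c (9/5), HasDerivAt (fun z => G z * Complex.exp (-g z)) 0 z := by
      intro z hz
      have h1 : HasDerivAt G (deriv G z) z := ((hG z hz).differentiableAt (hopen.mem_nhds hz)).hasDerivAt
      have h2 := h1.mul ((hg z hz).neg.cexp)
      have := h0 z hz
      have e : G z * (Complex.exp (-g z) * -(deriv G z / G z)) = -(deriv G z * Complex.exp (-g z)) := by
        field_simp
      have e2 : deriv G z * Complex.exp ((-g) z) + G z * (Complex.exp ((-g) z) * -(deriv G z / G z)) = 0 := by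
        rw [Pi.neg_apply, e]; ring
      rw [e2] at h2
      exact h2
    intro z hz
    have := (convex_ball c (9/5 : ℝ)).is_const_of_fderivWithin_eq_zero (𝕜 := ℂ)
      (f := fun z => G z * Complex.exp (-g z)) (fun z hz => (hd z hz).differentiableAt.differentiableWithinAt)
      (fun z hz => by
        rw [fderivWithin_of_isOpen hopen hz]
        have := (hd z hz).hasFDerivAt.fderiv
        rw [this]; ext; simp) hz hcm
    simp only [hgc, neg_zero, Complex.exp_zero, mul_one] at this
    rw [← this, mul_assoc, ← Complex.exp_add]; simp
  have hre : ∀ z ∈ Metric.ball c (9/5), (g z).re ≤ A := by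
    intro z hz
    have h1 := hb z hz
    have h3 : 0 < ‖G c‖ := norm_pos_iff.2 (h0 c hcm)
    rw [hexp z hz, norm_mul, Complex.norm_exp, mul_comm] at h1
    exact Real.exp_le_exp.1 (le_of_mul_le_mul_right h1 h3)
  have hBC : ∀ z ∈ Metric.closedBall c (7/4), ‖g z‖ ≤ 70 * A := by
    intro z hz
    have h1 := Complex.borelCaratheodory_zero (M := A) (R := 9/5) (f := fun w => g (c + w)) (z := z - c) hA
      (by
        intro w hw
        have : c + w ∈ Metric.ball c (9/5) := by simpa using hw
        exact ((hg _ this).differentiableAt.comp w (by fun_prop)).differentiableWithinAt)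
      (by
        intro w hw
        exact hre _ (by simpa using hw)) (by norm_num)
      (by simp only [Metric.mem_ball, dist_zero_right]
          rw [Metric.mem_closedBall, dist_eq_norm] at hz; linarith) (by simpa using hgc)
    simp only [add_sub_cancel] at h1
    rw [Metric.mem_closedBall, dist_eq_norm] at hz
    refine h1.trans ?_
    rw [div_le_iff₀ (by linarith)]
    nlinarith [norm_nonneg (z - c)]
  intro z hz
  have hz' : z ∈ Metric.ball c (9/5) := by
    rw [Metric.mem_closedBall] at hz; rw [Metric.mem_ball]; linarith
  have hsub : Metric.closedBall z (1/20) ⊆ Metric.closedBall c (7/4) := by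
    apply Metric.closedBall_subset_closedBall'; rw [Metric.mem_closedBall] at hz; linarith
  have hsub2 : Metric.closedBall c (7/4) ⊆ Metric.ball c (9/5) :=
    Metric.closedBall_subset_ball (by norm_num)
  have := Complex.norm_deriv_le_of_forall_mem_sphere_norm_le (c := z) (R := 1/20) (C := 70 * A) (f := g) (by norm_num)
    (DifferentiableOn.diffContOnCl (by
      rw [closure_ball z (by norm_num)]
      intro w hw
      exact (hg w (hsub2 (hsub hw))).differentiableAt.differentiableWithinAt))
    (fun w hw => hBC w (hsub (Metric.sphere_subset_closedBall hw)))
  rw [(hg z hz').deriv] at this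
  linarith

/-- local partial fraction lemma -/
theorem local_lemma : ∃ C : ℝ, 0 < C ∧ ∀ (F : ℂ → ℂ) (c : ℂ) (M : ℝ),
    AnalyticOnNhd ℂ F (Metric.closedBall c (19/10)) → F c ≠ 0 → 2 ≤ M →
    (∀ z ∈ Metric.closedBall c (19/10), ‖F z‖ ≤ M * ‖F c‖) →
    ∃ S : Finset ℂ, (∀ u, u ∈ S ↔ u ∈ Metric.closedBall c (9/5) ∧ F u = 0) ∧
      (∑ u ∈ S, (analyticOrderNatAt F u : ℝ)) ≤ C * Real.log M ∧
      ∀ z ∈ Metric.closedBall c (17/10), F z ≠ 0 →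
        ‖deriv F z / F z - ∑ u ∈ S, (analyticOrderNatAt F u : ℂ) / (z - u)‖ ≤ C * Real.log M := by
  have hl : 0 < Real.log ((19/10)/(9/5)) := Real.log_pos (by norm_num)
  set k := (Real.log ((19/10)/(9/5)))⁻¹ with hk
  have hk0 : 0 < k := inv_pos.2 hl
  have hl18 : 0 < Real.log 18 := Real.log_pos (by norm_num)
  refine ⟨1400 * (1 + k * Real.log 18) + k, by positivity, ?_⟩
  intro F c M hF h0 hM hb
  obtain ⟨S, hS, htop, hcount⟩ := zeros_count F c M hF h0 hM hb
  have hlM : 0 < Real.log M := Real.log_pos (by linarith)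
  rw [div_eq_mul_inv, ← hk] at hcount
  refine ⟨S, hS, hcount.trans ?_, ?_⟩
  · have : 0 ≤ 1400 * (1 + k * Real.log 18) * Real.log M := by positivity
    linarith
  have hsub : Metric.closedBall c (9/5) ⊆ Metric.closedBall c (19/10) :=
    Metric.closedBall_subset_closedBall (by norm_num)
  obtain ⟨G, hGan, hFG, hG0⟩ := factor_zeros (Metric.closedBall c (19/10)) F hF S
    (fun u hu => hsub ((hS u).1 hu).1) htop
  set n := fun u => analyticOrderNatAt F u with hn
  set N := ∑ u ∈ S, n u with hN
  have hNR : (N : ℝ) ≤ Real.log M * k := by rw [hN]; push_cast; exact hcount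
  have hGne : ∀ z ∈ Metric.closedBall c (9/5), G z ≠ 0 := by
    intro z hz hGz
    have hFz : F z = 0 := by rw [hFG z, hGz, mul_zero]
    exact hG0 z ((hS z).2 ⟨hz, hFz⟩) hGz
  have hGc : 0 < ‖G c‖ := norm_pos_iff.2 (hGne c (Metric.mem_closedBall_self (by norm_num)))
  have hFc : ‖F c‖ ≤ (9/5) ^ N * ‖G c‖ := by
    rw [hFG c, norm_mul]
    gcongr
    rw [norm_prod, hN, ← Finset.prod_pow_eq_pow_sum]
    refine Finset.prod_le_prod (fun _ _ => norm_nonneg _) fun u hu => ?_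
    rw [norm_pow]
    have := ((hS u).1 hu).1
    rw [Metric.mem_closedBall, dist_comm, dist_eq_norm] at this
    exact pow_le_pow_left₀ (norm_nonneg _) this _
  have hsph : ∀ z ∈ Metric.sphere c (19/10), ‖G z‖ ≤ M * 18 ^ N * ‖G c‖ := by
    intro z hz
    have h1 := hb z (Metric.sphere_subset_closedBall hz)
    have h2 : (1/10) ^ N * ‖G z‖ ≤ ‖F z‖ := by
      rw [hFG z, norm_mul]
      gcongr
      rw [norm_prod, hN, ← Finset.prod_pow_eq_pow_sum]
      refine Finset.prod_le_prod (fun _ _ => by positivity) fun u hu => ?_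
      rw [norm_pow]
      have h3 := ((hS u).1 hu).1
      rw [Metric.mem_closedBall] at h3
      rw [Metric.mem_sphere] at hz
      have h4 := dist_triangle z u c
      rw [dist_eq_norm z u] at h4
      exact pow_le_pow_left₀ (by norm_num) (by linarith) _
    have h5 : (1/10 : ℝ) ^ N * ‖G z‖ ≤ M * ((9/5) ^ N * ‖G c‖) :=
      h2.trans (h1.trans (by gcongr))
    have h6 : ‖G z‖ = 10 ^ N * ((1/10 : ℝ) ^ N * ‖G z‖) := by
      rw [← mul_assoc, ← mul_pow]; norm_num
    rw [h6]
    calc 10 ^ N * ((1/10 : ℝ) ^ N * ‖G z‖) ≤ 10 ^ N * (M * ((9/5) ^ N * ‖G c‖)) := by gcongr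
      _ = M * 18 ^ N * ‖G c‖ := by
        rw [show (18:ℝ) = 10 * (9/5) by norm_num, mul_pow]; ring
  have hball : ∀ z ∈ Metric.ball c (19/10), ‖G z‖ ≤ M * 18 ^ N * ‖G c‖ := by
    intro z hz
    refine Complex.norm_le_of_forall_mem_frontier_norm_le (U := Metric.ball c (19/10)) Metric.isBounded_ball
      (DifferentiableOn.diffContOnCl ?_) ?_ (subset_closure hz)
    · rw [closure_ball c (by norm_num)]; exact hGan.differentiableOn
    · rw [frontier_ball c (by norm_num)]; exact hsph
  set A := (1 + k * Real.log 18) * Real.log M with hA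
  have hAe : M * 18 ^ N ≤ Real.exp A := by
    have h1 : M * 18 ^ N = Real.exp (Real.log M + N * Real.log 18) := by
      rw [Real.exp_add, Real.exp_log (by linarith), ← Real.log_pow, Real.exp_log (by positivity)]
    rw [h1]
    apply Real.exp_le_exp.2
    have := mul_le_mul_of_nonneg_right hNR hl18.le
    rw [hA]; linarith
  have hbb : Metric.ball c (9/5) ⊆ Metric.closedBall c (9/5) := Metric.ball_subset_closedBall
  have hfinal := logDeriv_bound G c A (by positivity) ((hGan.differentiableOn).mono (hbb.trans hsub))
    (fun z hz => hGne z (hbb hz)) (fun z hz => by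
      refine (hball z (Metric.ball_subset_ball (by norm_num) hz)).trans ?_
      gcongr)
  intro z hz hFz
  have hz95 : z ∈ Metric.closedBall c (9/5) := by
    rw [Metric.mem_closedBall] at hz ⊢; linarith
  have hzu : ∀ u ∈ S, z - u ≠ 0 := by
    intro u hu h
    rw [sub_eq_zero] at h; subst h
    exact hFz ((hS z).1 hu).2
  have hlog : deriv F z / F z = ∑ u ∈ S, (n u : ℂ) / (z - u) + deriv G z / G z := by
    have e1 : F = fun z => (∏ u ∈ S, (z - u) ^ n u) * G z := funext hFG
    have e2 : logDeriv F z = logDeriv (fun z => ∏ u ∈ S, (z - u) ^ n u) z + logDeriv G z := by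
      rw [e1]
      refine logDeriv_mul z ?_ (hGne z hz95) ?_ (hGan z (hsub hz95)).differentiableAt
      · exact Finset.prod_ne_zero_iff.2 fun u hu => pow_ne_zero _ (hzu u hu)
      · exact DifferentiableAt.fun_finsetProd fun u _ => by fun_prop
    have e3 : logDeriv (fun z => ∏ u ∈ S, (z - u) ^ n u) z = ∑ u ∈ S, (n u : ℂ) / (z - u) := by
      rw [logDeriv_prod]
      · refine Finset.sum_congr rfl fun u hu => ?_
        rw [logDeriv_fun_pow (by fun_prop)]
        simp [logDeriv_apply, div_eq_mul_inv]
      · exact fun u hu => pow_ne_zero _ (hzu u hu)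
      · exact fun u _ => by fun_prop
    rw [← logDeriv_apply, e2, e3, logDeriv_apply]
  rw [hlog, add_sub_cancel_left]
  refine (hfinal z hz).trans ?_
  rw [hA]
  have : 0 ≤ k * Real.log M := by positivity
  linarith

end ModA

section ModB
open Complex Filter MeasureTheory Real Set
open scoped Topology
def zf : ℂ → ℂ := riemannZeta₁

lemma zf_diff : Differentiable ℂ zf := differentiable_riemannZeta₁
lemma zf_one : zf 1 = 1 := riemannZeta₁_one
lemma zf_eq {s : ℂ} (hs : s ≠ 1) : zf s = (s - 1) * riemannZeta s := by
  rw [riemannZeta_eq_inv_sub_mul hs, zf, ← mul_assoc, mul_inv_cancel₀ (sub_ne_zero.2 hs), one_mul]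

def zT (n : ℕ) (s : ℂ) : ℂ := (s - 1) * ((n + 1 : ℝ) : ℂ) ^ (-s) + ((n + 1 + 1 : ℝ) : ℂ) ^ (1 - s) - ((n + 1 : ℝ) : ℂ) ^ (1 - s)

lemma zT_diff (n : ℕ) : Differentiable ℂ (zT n) := by
  have h1 : ((n + 1 : ℝ) : ℂ) ≠ 0 := by exact_mod_cast (by positivity : (n + 1 : ℝ) ≠ 0)
  have h2 : ((n + 1 + 1 : ℝ) : ℂ) ≠ 0 := by exact_mod_cast (by positivity : (n + 1 + 1 : ℝ) ≠ 0)
  intro s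
  unfold zT
  refine DifferentiableAt.sub (DifferentiableAt.add (DifferentiableAt.mul (by fun_prop) ?_) ?_) ?_
  · exact DifferentiableAt.const_cpow (by fun_prop) (Or.inl h1)
  · exact DifferentiableAt.const_cpow (by fun_prop) (Or.inl h2)
  · exact DifferentiableAt.const_cpow (by fun_prop) (Or.inl h1)

lemma cpow_diff_bound (a : ℝ) (ha : 0 < a) (s : ℂ) (hs : 0 < s.re) (x : ℝ) (hx : x ∈ Icc a (a+1)) :
    ‖(x : ℂ) ^ (-s) - (a : ℂ) ^ (-s)‖ ≤ ‖s‖ * a ^ (-s.re - 1) := by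
  by_cases hs0 : s = 0
  · simp [hs0] at hs
  have := (convex_Icc a (a+1)).norm_image_sub_le_of_norm_hasDerivWithin_le
    (f := fun x : ℝ => (x : ℂ) ^ (-s)) (f' := fun x : ℝ => (-s) * (x : ℂ) ^ (-s - 1)) (C := ‖s‖ * a ^ (-s.re - 1))
    (fun y hy => (hasDerivAt_ofReal_cpow_const (by linarith [hy.1]) (by simpa using hs0)).hasDerivWithinAt)
    (fun y hy => by
      have hy0 : 0 < y := by linarith [hy.1]
      rw [norm_mul, norm_neg, Complex.norm_cpow_eq_rpow_re_of_pos hy0]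
      simp only [sub_re, neg_re, one_re]
      gcongr ?_ * ?_
      exact Real.rpow_le_rpow_of_nonpos ha hy.1 (by linarith))
    (left_mem_Icc.2 (by linarith)) hx
  refine this.trans ?_
  have h1 : ‖x - a‖ ≤ 1 := by rw [Real.norm_eq_abs, abs_le]; constructor <;> linarith [hx.1, hx.2]
  exact mul_le_of_le_one_right (by positivity) h1

lemma zT_bound (n : ℕ) (s : ℂ) (hs : 0 < s.re) :
    ‖zT n s‖ ≤ ‖s - 1‖ * ‖s‖ * (n + 1 : ℝ) ^ (-s.re - 1) := by
  set a : ℝ := n + 1 with ha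
  have ha0 : 0 < a := by positivity
  by_cases hs1 : s = 1
  · subst hs1; simp [zT]
  have := (convex_Icc a (a+1)).norm_image_sub_le_of_norm_hasDerivWithin_le
    (f := fun x : ℝ => (s - 1) * (a : ℂ) ^ (-s) * x + (x : ℂ) ^ (1 - s))
    (f' := fun x : ℝ => (s - 1) * (a : ℂ) ^ (-s) + (1 - s) * (x : ℂ) ^ (1 - s - 1))
    (C := ‖s - 1‖ * (‖s‖ * a ^ (-s.re - 1)))
    (fun y hy => by
      have h1 := (hasDerivAt_ofReal_cpow_const (x := y) (r := 1 - s) (by linarith [hy.1]) (sub_ne_zero.2 (Ne.symm hs1)))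
      have h2 : HasDerivAt (fun x : ℝ => (s - 1) * (a : ℂ) ^ (-s) * (x : ℂ)) ((s - 1) * (a : ℂ) ^ (-s)) y := by
        simpa using (Complex.ofRealCLM.hasDerivAt (x := y)).const_mul ((s - 1) * (a : ℂ) ^ (-s))
      exact (h2.add h1).hasDerivWithinAt)
    (fun y hy => by
      have e : (s - 1) * (a : ℂ) ^ (-s) + (1 - s) * (y : ℂ) ^ (1 - s - 1) = -(s - 1) * ((y : ℂ) ^ (-s) - (a : ℂ) ^ (-s)) := by
        rw [show (1 - s - 1) = -s by ring]; ring
      rw [e, norm_mul, norm_neg]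
      gcongr
      exact cpow_diff_bound a ha0 s hs y hy)
    (left_mem_Icc.2 (by linarith)) (right_mem_Icc.2 (by linarith))
  simp only [add_sub_cancel_left, norm_one, mul_one] at this
  rw [mul_assoc]
  refine le_trans (le_of_eq ?_) this
  congr 1
  unfold zT
  rw [← ha]
  push_cast
  ring

lemma summ_aux (σ : ℝ) (hσ : 0 < σ) : Summable fun n : ℕ => (n + 1 : ℝ) ^ (-σ - 1) := by
  have := (summable_nat_add_iff 1).2 (Real.summable_nat_rpow.2 (by linarith : -σ - 1 < -1))
  simpa using this

lemma zf_series_right (s : ℂ) (hs : 1 < s.re) : zf s = 1 + ∑' n, zT n s := by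
  have hs1 : s ≠ 1 := by rintro rfl; simp at hs
  have hsum : HasSum (fun n : ℕ => (s - 1) * ((n + 1 : ℝ) : ℂ) ^ (-s)) ((s - 1) * riemannZeta s) := by
    refine HasSum.mul_left _ ?_
    rw [zeta_eq_tsum_one_div_nat_add_one_cpow hs]
    have h := (summable_nat_add_iff 1).2 (Complex.summable_one_div_nat_cpow.2 hs)
    have h2 := h.hasSum
    have e1 : (fun n : ℕ => 1 / ((n + 1 : ℕ) : ℂ) ^ s) = fun n : ℕ => ((n + 1 : ℝ) : ℂ) ^ (-s) := by
      funext n; rw [Complex.cpow_neg]; simp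
    have e2 : (∑' n : ℕ, 1 / (n + 1 : ℂ) ^ s) = ∑' n : ℕ, 1 / ((n + 1 : ℕ) : ℂ) ^ s := by
      simp only [Nat.cast_add, Nat.cast_one]
    rw [e2]
    rw [← e1]
    exact h2
  have htel : HasSum (fun n : ℕ => ((n + 1 + 1 : ℝ) : ℂ) ^ (1 - s) - ((n + 1 : ℝ) : ℂ) ^ (1 - s)) (0 - 1) := by
    have hlim : Tendsto (fun n : ℕ => ((n + 1 : ℝ) : ℂ) ^ (1 - s)) atTop (𝓝 0) := by
      rw [tendsto_zero_iff_norm_tendsto_zero]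
      have : (fun n : ℕ => ‖((n + 1 : ℝ) : ℂ) ^ (1 - s)‖) = fun n : ℕ => ((n : ℝ) + 1) ^ (-(s.re - 1)) := by
        ext n
        rw [Complex.norm_cpow_eq_rpow_re_of_pos (by positivity)]; simp
      rw [this]
      exact (tendsto_rpow_neg_atTop (by linarith)).comp
        (tendsto_atTop_add_const_right _ _ tendsto_natCast_atTop_atTop)
    have hs' : Summable (fun n : ℕ => ((n + 1 + 1 : ℝ) : ℂ) ^ (1 - s) - ((n + 1 : ℝ) : ℂ) ^ (1 - s)) := by
      have h1 : Summable (fun n : ℕ => zT n s) := by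
        refine Summable.of_norm_bounded ((summ_aux s.re (by linarith)).mul_left _) fun n => zT_bound n s (by linarith)
      refine (h1.sub hsum.summable).congr fun n => ?_
      simp only [zT]; ring
    rw [hs'.hasSum_iff_tendsto_nat]
    have hr := fun N => Finset.sum_range_sub (fun n : ℕ => ((n + 1 : ℝ) : ℂ) ^ (1 - s)) N
    have hc : (fun N : ℕ => ∑ i ∈ Finset.range N, (((i + 1 + 1 : ℝ) : ℂ) ^ (1 - s) - ((i + 1 : ℝ) : ℂ) ^ (1 - s)))
        = fun N : ℕ => ((N + 1 : ℝ) : ℂ) ^ (1 - s) - 1 := by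
      ext N
      have := hr N
      push_cast at this ⊢
      rw [this]; simp
    rw [hc]
    exact hlim.sub_const 1
  have htot := hsum.add htel
  rw [zf_eq hs1]
  have : (fun n : ℕ => (s - 1) * ((n + 1 : ℝ) : ℂ) ^ (-s) + (((n + 1 + 1 : ℝ) : ℂ) ^ (1 - s) - ((n + 1 : ℝ) : ℂ) ^ (1 - s)))
      = fun n => zT n s := by
    ext n; simp only [zT]; ring
  rw [this] at htot
  rw [htot.tsum_eq]; ring

lemma zf_series (s : ℂ) (hs : 1/20 < s.re) : zf s = 1 + ∑' n, zT n s := by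
  have hcore : ∀ R : ℝ, 3 ≤ R → ∀ s : ℂ, s ∈ ({z : ℂ | 1/20 < z.re} ∩ Metric.ball 0 R) → zf s = 1 + ∑' n, zT n s := by
    intro R hR
    set U : Set ℂ := {z : ℂ | 1/20 < z.re} ∩ Metric.ball 0 R
    have hUo : IsOpen U := (isOpen_lt continuous_const Complex.continuous_re).inter Metric.isOpen_ball
    have hUc : Convex ℝ U := (convex_halfSpace_re_gt _).inter (convex_ball _ _)
    have hd : DifferentiableOn ℂ (fun s => 1 + ∑' n, zT n s) U := by
      refine (differentiableOn_const _).add (Complex.differentiableOn_tsum_of_summable_norm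
        (u := fun n : ℕ => (R + 1) * R * (n + 1 : ℝ) ^ (-(1/20) - 1 : ℝ)) ((summ_aux (1/20) (by norm_num)).mul_left _)
        (fun n => (zT_diff n).differentiableOn) hUo ?_)
      intro n w hw
      have hw2 : ‖w‖ < R := by simpa using hw.2
      have hw1 : 1/20 < w.re := hw.1
      refine (zT_bound n w (by linarith)).trans ?_
      gcongr ?_ * ?_ * ?_
      · exact (norm_sub_le _ _).trans (by simp; linarith)
      · exact Real.rpow_le_rpow_of_exponent_le (by linarith [Nat.cast_nonneg (α := ℝ) n]) (by linarith)
    have h2 : (2 : ℂ) ∈ U := ⟨by simp; norm_num, by simp; linarith⟩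
    have := (zf_diff.differentiableOn.analyticOnNhd hUo).eqOn_of_preconnected_of_eventuallyEq (hd.analyticOnNhd hUo)
      hUc.isPreconnected h2 (by
        have : {z : ℂ | 1 < z.re} ∈ 𝓝 (2 : ℂ) :=
          (isOpen_lt continuous_const Complex.continuous_re).mem_nhds (by simp)
        filter_upwards [this] with z hz
        exact zf_series_right z hz)
    exact this
  exact hcore (‖s‖ + 3) (by linarith [norm_nonneg s]) s ⟨hs, by simp⟩

def Lg (t : ℝ) : ℝ := Real.log (2 + |t|)

lemma zf_upper : ∃ C : ℝ, 0 < C ∧ ∀ s : ℂ, 1/10 ≤ s.re → s.re ≤ 4 → ‖zf s‖ ≤ C * (2 + |s.im|) ^ 2 := by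
  set sg0 := ∑' n : ℕ, (n + 1 : ℝ) ^ (-(1/10) - 1 : ℝ) with hsg
  have hsg0 : 0 ≤ sg0 := tsum_nonneg fun n => by positivity
  refine ⟨1 + 25 * sg0, by positivity, ?_⟩
  intro s h1 h2
  rw [zf_series s (by linarith)]
  have hn : ‖s‖ ≤ 5 * (2 + |s.im|) - 1 := by
    have := Complex.norm_le_abs_re_add_abs_im s
    rw [abs_of_nonneg (by linarith : 0 ≤ s.re)] at this
    linarith [abs_nonneg s.im]
  have hn1 : ‖s - 1‖ ≤ 5 * (2 + |s.im|) := (norm_sub_le _ _).trans (by simp; linarith)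
  have hb : ‖∑' n, zT n s‖ ≤ ‖s - 1‖ * ‖s‖ * sg0 := by
    refine tsum_of_norm_bounded (((summ_aux (1/10) (by norm_num)).hasSum).mul_left _) fun n => ?_
    refine (zT_bound n s (by linarith)).trans ?_
    gcongr ?_ * ?_
    exact Real.rpow_le_rpow_of_exponent_le (by linarith [Nat.cast_nonneg (α := ℝ) n]) (by linarith)
  have ha := abs_nonneg s.im
  have h3 : ‖s - 1‖ * ‖s‖ ≤ (5 * (2 + |s.im|)) * (5 * (2 + |s.im|)) := by
    gcongr; linarith
  calc ‖1 + ∑' n, zT n s‖ ≤ 1 + ‖s - 1‖ * ‖s‖ * sg0 := (norm_add_le _ _).trans (by simpa using hb)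
    _ ≤ 1 + (5 * (2 + |s.im|)) * (5 * (2 + |s.im|)) * sg0 := by gcongr
    _ ≤ _ := by nlinarith

lemma zeta_lower : ∃ c : ℝ, 0 < c ∧ ∀ t : ℝ, c ≤ ‖riemannZeta (2 + t * I)‖ := by
  set sg0 := ∑' n : ℕ, 1 / (n : ℝ) ^ (2:ℝ) with hsg
  have hsum : Summable (fun n : ℕ => 1 / (n : ℝ) ^ (2:ℝ)) := Real.summable_one_div_nat_rpow.2 (by norm_num)
  have hsg0 : 0 ≤ sg0 := tsum_nonneg fun n => by positivity
  refine ⟨1 / (1 + sg0), by positivity, fun t => ?_⟩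
  have hre : 1 < (2 + t * I : ℂ).re := by simp
  have h1 := ArithmeticFunction.LSeries_zeta_mul_Lseries_moebius hre
  rw [ArithmeticFunction.LSeries_zeta_eq_riemannZeta hre] at h1
  have h2 : ‖LSeries (fun n => ((ArithmeticFunction.moebius n : ℤ) : ℂ)) (2 + t * I)‖ ≤ sg0 := by
    refine tsum_of_norm_bounded hsum.hasSum fun n => ?_
    rw [LSeries.norm_term_eq]
    split_ifs with h
    · positivity
    · have : ‖((ArithmeticFunction.moebius n : ℤ) : ℂ)‖ ≤ 1 := by
        rw [Complex.norm_intCast]; exact_mod_cast ArithmeticFunction.abs_moebius_le_one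
      simp only [add_re, re_ofNat, mul_re, ofReal_re, I_re, mul_zero, ofReal_im, I_im, mul_one, sub_self, add_zero]
      gcongr
  have h3 := congrArg norm h1
  rw [norm_mul, norm_one] at h3
  rw [div_le_iff₀ (by positivity)]
  have h4 := norm_nonneg (riemannZeta (2 + t * I))
  nlinarith [mul_le_mul_of_nonneg_left h2 h4]

lemma Lg_pos (t : ℝ) : Real.log 2 ≤ Lg t := Real.log_le_log (by norm_num) (by linarith [abs_nonneg t])
lemma Lg_half (t : ℝ) : 1/2 ≤ Lg t := by
  have := Real.log_two_gt_d9
  linarith [Lg_pos t]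

theorem zf_local : ∃ C : ℝ, 0 < C ∧ ∀ t : ℝ, ∃ S : Finset ℂ,
    (∀ u, u ∈ S ↔ u ∈ Metric.closedBall (2 + t * I) (9/5) ∧ zf u = 0) ∧
      (∑ u ∈ S, (analyticOrderNatAt zf u : ℝ)) ≤ C * Lg t ∧
      ∀ z ∈ Metric.closedBall (2 + t * I : ℂ) (17/10), zf z ≠ 0 →
        ‖deriv zf z / zf z - ∑ u ∈ S, (analyticOrderNatAt zf u : ℂ) / (z - u)‖ ≤ C * Lg t := by
  obtain ⟨C1, hC1, hloc⟩ := local_lemma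
  obtain ⟨C2, hC2, hup⟩ := zf_upper
  obtain ⟨c, hc, hlow⟩ := zeta_lower
  set K := max 2 (4 * C2 / c) with hK
  have hK2 : 2 ≤ K := le_max_left _ _
  have hlK : 0 < Real.log K := Real.log_pos (by linarith)
  refine ⟨C1 * (2 * Real.log K + 2), by positivity, fun t => ?_⟩
  have hta := abs_nonneg t
  have hzc : c ≤ ‖zf (2 + t * I)‖ := by
    have h1 : (2 + t * I : ℂ) ≠ 1 := by
      intro h; have := congrArg Complex.re h; simp at this
    rw [zf_eq h1, norm_mul]
    have h2 : 1 ≤ ‖(2 + t * I - 1 : ℂ)‖ := by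
      have := Complex.abs_re_le_norm (2 + t * I - 1 : ℂ)
      simp at this
      norm_num at this ⊢
      exact this
    nlinarith [hlow t, norm_nonneg (riemannZeta (2 + t * I))]
  obtain ⟨S, hS1, hS2, hS3⟩ := hloc zf (2 + t * I) (K * (2 + |t|) ^ 2) (fun z _ => zf_diff.analyticAt z)
    (by intro h; rw [h] at hzc; simp at hzc; linarith) (by nlinarith)
    (by
      intro z hz
      rw [Metric.mem_closedBall, dist_eq_norm] at hz
      have h1 := (Complex.abs_re_le_norm (z - (2 + t * I))).trans hz
      have h2 := (Complex.abs_im_le_norm (z - (2 + t * I))).trans hz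
      simp only [sub_re, add_re, re_ofNat, mul_re, ofReal_re, I_re, mul_zero, ofReal_im, I_im, mul_one, sub_self, add_zero] at h1
      simp only [sub_im, add_im, im_ofNat, mul_im, ofReal_re, I_re, mul_zero, ofReal_im, I_im, mul_one, add_zero, zero_add] at h2
      rw [abs_le] at h1
      have h3 : |z.im| ≤ |t| + 2 := by
        have := abs_sub_abs_le_abs_sub z.im t
        linarith
      refine (hup z (by linarith [h1.1]) (by linarith [h1.2])).trans ?_
      have h4 : C2 * (2 + |z.im|) ^ 2 ≤ C2 * (2 * (2 + |t|)) ^ 2 := by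
        gcongr; linarith
      refine h4.trans ?_
      have h5 : 4 * C2 ≤ K * c := by
        have : 4 * C2 / c ≤ K := le_max_right _ _
        rwa [div_le_iff₀ hc] at this
      have h6 : 4 * C2 ≤ K * ‖zf (2 + t * I)‖ := h5.trans (by gcongr)
      have h7 : 0 ≤ (2 + |t|) ^ 2 := by positivity
      nlinarith [mul_le_mul_of_nonneg_right h6 h7])
  have hlog : C1 * Real.log (K * (2 + |t|) ^ 2) ≤ C1 * (2 * Real.log K + 2) * Lg t := by
    rw [Real.log_mul (by linarith) (by positivity), Real.log_pow, mul_assoc]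
    have := Lg_half t
    have e : Real.log (2 + |t|) = Lg t := rfl
    rw [e]
    gcongr
    push_cast
    nlinarith
  exact ⟨S, hS1, hS2.trans hlog, fun z hz hz0 => (hS3 z hz hz0).trans hlog⟩

end ModB

section ModCz
open Complex Filter MeasureTheory Real Set
open scoped Topology
abbrev ZZ := {γ : ℝ // zf (1/2 + γ * I) = 0}
def mz (γ : ZZ) : ℕ := analyticOrderNatAt zf (1/2 + (γ:ℝ) * I)
def wt (u : ℝ) : ℝ := (1 + u ^ 2) ^ (-(5/8) : ℝ)

lemma zz_inj : Function.Injective (fun γ : ZZ => (1/2 + (γ:ℝ) * I : ℂ)) := by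
  intro a b h
  have := congrArg Complex.im h
  simp at this
  exact Subtype.ext this

lemma zz_dist (γ t : ℝ) : ‖(1/2 + γ * I : ℂ) - (2 + t * I)‖ ^ 2 = 9/4 + (γ - t) ^ 2 := by
  rw [Complex.sq_norm, Complex.normSq_apply]
  simp; ring

lemma zz_near (γ t : ℝ) (h : |γ - t| ≤ 9/10) : (1/2 + γ * I : ℂ) ∈ Metric.closedBall (2 + t * I : ℂ) (9/5) := by
  rw [Metric.mem_closedBall, dist_eq_norm]
  apply le_of_sq_le_sq _ (by norm_num)
  rw [zz_dist]
  have := sq_abs (γ - t)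
  nlinarith [abs_nonneg (γ - t)]

lemma zz_far (γ t : ℝ) (h : (1/2 + γ * I : ℂ) ∈ Metric.closedBall (2 + t * I : ℂ) (9/5)) : |γ - t| ≤ 2 := by
  rw [Metric.mem_closedBall, dist_eq_norm] at h
  have := zz_dist γ t
  apply abs_le_of_sq_le_sq _ (by norm_num)
  nlinarith [norm_nonneg ((1/2 + γ * I : ℂ) - (2 + t * I))]

theorem zz_count : ∃ C : ℝ, 0 < C ∧ ∀ (t : ℝ) (A : Finset ZZ), (∀ γ ∈ A, |(γ:ℝ) - t| ≤ 9/10) →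
    ∑ γ ∈ A, (mz γ : ℝ) ≤ C * Lg t := by
  obtain ⟨C, hC, h⟩ := zf_local
  refine ⟨C, hC, fun t A hA => ?_⟩
  obtain ⟨S, hS1, hS2, -⟩ := h t
  refine le_trans ?_ hS2
  classical
  have : ∑ γ ∈ A, (mz γ : ℝ) = ∑ u ∈ A.image (fun γ : ZZ => (1/2 + (γ:ℝ) * I : ℂ)), (analyticOrderNatAt zf u : ℝ) := by
    rw [Finset.sum_image (fun a _ b _ h => zz_inj h)]; rfl
  rw [this]
  refine Finset.sum_le_sum_of_subset_of_nonneg ?_ (fun _ _ _ => Nat.cast_nonneg _)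
  intro u hu
  obtain ⟨γ, hγ, rfl⟩ := Finset.mem_image.1 hu
  exact (hS1 _).2 ⟨zz_near _ _ (hA γ hγ), γ.2⟩

instance zz_countable : Countable ZZ := by
  obtain ⟨C, hC, h⟩ := zf_local
  choose S hS using fun k : ℤ => h k
  have h1 : (⋃ k : ℤ, ((S k : Finset ℂ) : Set ℂ)).Countable := countable_iUnion fun k => (S k).countable_toSet
  have : Countable (⋃ k : ℤ, ((S k : Finset ℂ) : Set ℂ)) := h1.to_subtype
  let f : ZZ → (⋃ k : ℤ, ((S k : Finset ℂ) : Set ℂ)) := fun γ => ⟨1/2 + (γ:ℝ) * I, by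
    refine mem_iUnion.2 ⟨round (γ:ℝ), ?_⟩
    refine ((hS _).1 _).2 ⟨?_, γ.2⟩
    have := zz_near (γ:ℝ) (round (γ:ℝ) : ℤ) ((abs_sub_round _).trans (by norm_num))
    simpa using this⟩
  refine Function.Injective.countable (f := f) ?_
  intro a b hab
  exact zz_inj (Subtype.ext_iff.1 hab)

theorem rh_zero (hRH : RiemannHypothesis) (u : ℂ) (hu : 0 < u.re) (h : zf u = 0) : u = 1/2 + (u.im : ℂ) * I := by
  have h1 : u ≠ 1 := by rintro rfl; rw [zf_one] at h; exact one_ne_zero h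
  rw [zf_eq h1, mul_eq_zero, sub_eq_zero] at h
  have h2 := h.resolve_left h1
  have h3 := hRH u h2 (by
    rintro ⟨n, rfl⟩
    simp at hu
    have : (0:ℝ) ≤ n := Nat.cast_nonneg n
    nlinarith) h1
  apply Complex.ext <;> simp [h3]

theorem zf_local' (hRH : RiemannHypothesis) : ∃ C : ℝ, 0 < C ∧ ∀ t : ℝ, ∃ A : Finset ZZ,
    (∀ γ ∈ A, |(γ:ℝ) - t| ≤ 2) ∧ (∀ γ : ZZ, |(γ:ℝ) - t| ≤ 9/10 → γ ∈ A) ∧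
    ∑ γ ∈ A, (mz γ : ℝ) ≤ C * Lg t ∧
    ∀ s : ℂ, s.im = t → -1/10 ≤ s.re → s.re ≤ 1 → zf (1/2 + s) ≠ 0 →
      ‖deriv zf (1/2 + s) / zf (1/2 + s) - ∑ γ ∈ A, (mz γ : ℂ) / (s - (γ:ℝ) * I)‖ ≤ C * Lg t := by
  obtain ⟨C, hC, h⟩ := zf_local
  refine ⟨C, hC, fun t => ?_⟩
  obtain ⟨S, hS1, hS2, hS3⟩ := h t
  classical
  let A : Finset ZZ := S.preimage (fun γ : ZZ => (1/2 + (γ:ℝ) * I : ℂ)) (zz_inj.injOn)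
  have hAS : S = A.image (fun γ : ZZ => (1/2 + (γ:ℝ) * I : ℂ)) := by
    ext u
    constructor
    · intro hu
      have h1 := (hS1 u).1 hu
      have h2 : 0 < u.re := by
        have := h1.1
        rw [Metric.mem_closedBall, dist_eq_norm] at this
        have h3 := (Complex.abs_re_le_norm _).trans this
        rw [abs_le] at h3
        simp at h3
        linarith [h3.1]
      have h3 := rh_zero hRH u h2 h1.2
      refine Finset.mem_image.2 ⟨⟨u.im, by rw [← h3]; exact h1.2⟩, ?_, h3.symm⟩
      rw [Finset.mem_preimage]
      simp only
      rw [← h3]; exact hu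
    · intro hu
      obtain ⟨γ, hγ, rfl⟩ := Finset.mem_image.1 hu
      exact (Finset.mem_preimage (f := fun γ : ZZ => (1/2 + (γ:ℝ) * I : ℂ))).1 hγ
  refine ⟨A, ?_, ?_, ?_, ?_⟩
  · intro γ hγ
    exact zz_far _ _ ((hS1 _).1 ((Finset.mem_preimage (f := fun γ : ZZ => (1/2 + (γ:ℝ) * I : ℂ))).1 hγ)).1
  · intro γ hγ
    exact (Finset.mem_preimage (f := fun γ : ZZ => (1/2 + (γ:ℝ) * I : ℂ))).2 ((hS1 _).2 ⟨zz_near _ _ hγ, γ.2⟩)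
  · rw [hAS, Finset.sum_image (fun a _ b _ h => zz_inj h)] at hS2
    exact hS2
  · intro s hs h1 h2 h0
    have h3 := hS3 (1/2 + s) (by
      rw [Metric.mem_closedBall, dist_eq_norm]
      have : (1/2 + s - (2 + t * I) : ℂ) = ((s.re - 3/2 : ℝ) : ℂ) := by
        apply Complex.ext
        · simp; ring
        · simp [hs]
      rw [this, Complex.norm_real, Real.norm_eq_abs, abs_le]
      constructor <;> linarith) h0
    rw [hAS, Finset.sum_image (fun a _ b _ h => zz_inj h)] at h3
    refine le_trans (le_of_eq ?_) h3
    congr 2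
    refine Finset.sum_congr rfl fun γ _ => ?_
    rw [show (1 / 2 + s - (1 / 2 + (γ:ℝ) * I) : ℂ) = s - (γ:ℝ) * I by ring]
    rfl

lemma wt_pos (u : ℝ) : 0 < wt u := Real.rpow_pos_of_pos (by positivity) _

lemma wt_le_of (u v : ℝ) (c : ℝ) (hc : 0 < c) (h : 1 + v ^ 2 ≤ c * (1 + u ^ 2)) : wt u ≤ c ^ (5/8 : ℝ) * wt v := by
  unfold wt
  have h1 : (0:ℝ) < 1 + u ^ 2 := by positivity
  have h2 : (0:ℝ) < 1 + v ^ 2 := by positivity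
  have h3 : (1 + v^2) ^ (5/8 : ℝ) ≤ c ^ (5/8 : ℝ) * (1 + u ^ 2) ^ (5/8 : ℝ) := by
    rw [← Real.mul_rpow hc.le h1.le]
    exact Real.rpow_le_rpow h2.le h (by norm_num)
  rw [Real.rpow_neg h1.le, Real.rpow_neg h2.le, ← div_eq_mul_inv, inv_eq_one_div, div_le_div_iff₀ (by positivity) (by positivity)]
  linarith

lemma Lg_add (t u : ℝ) : Lg (t + u) ≤ Lg t + Lg u := by
  unfold Lg
  rw [← Real.log_mul (by positivity) (by positivity)]
  apply Real.log_le_log (by positivity)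
  have := abs_add_le t u
  nlinarith [abs_nonneg t, abs_nonneg u, mul_nonneg (abs_nonneg t) (abs_nonneg u)]

lemma Lg_rpow (u : ℝ) : Lg u ≤ 32 * (1 + u ^ 2) ^ (1/16 : ℝ) := by
  unfold Lg
  have h0 : (0:ℝ) < 1 + u ^ 2 := by positivity
  have h1 : 2 + |u| ≤ 4 * (1 + u ^ 2) := by
    nlinarith [sq_abs u, sq_nonneg (|u| - 1)]
  have h2 : Real.log (2 + |u|) ≤ Real.log 4 + Real.log (1 + u ^ 2) := by
    rw [← Real.log_mul (by norm_num) (by positivity)]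
    exact Real.log_le_log (by positivity) h1
  have h3 : Real.log (1 + u ^ 2) ≤ (1 + u^2) ^ (1/16 : ℝ) / (1/16) := Real.log_le_rpow_div h0.le (by norm_num)
  have h4 : (1:ℝ) ≤ (1 + u^2) ^ (1/16 : ℝ) := Real.one_le_rpow (by nlinarith [sq_nonneg u]) (by norm_num)
  have h5 : Real.log 4 ≤ 4 := (Real.log_le_sub_one_of_pos (by norm_num)).trans (by norm_num)
  linarith

lemma int_summ (a : ℝ) (ha : 1/2 < a) : Summable fun k : ℤ => (1 + (k:ℝ) ^ 2) ^ (-a) := by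
  have h1 : Summable fun k : ℤ => |(k:ℝ)| ^ (-(2 * a)) := by
    refine Summable.of_nat_of_neg ?_ ?_ <;>
    · have := Real.summable_nat_rpow.2 (by linarith : -(2 * a) < -1)
      simpa using this
  refine Summable.of_norm_bounded_eventually (g := fun k : ℤ => |(k:ℝ)| ^ (-(2 * a))) h1 ?_
  have : ∀ᶠ k : ℤ in cofinite, k ≠ 0 := by
    rw [eventually_cofinite]; simp
  filter_upwards [this] with k hk
  rw [Real.norm_of_nonneg (by positivity)]
  have hk' : 0 < |(k:ℝ)| := by positivity
  rw [show -(2 * a) = 2 * (-a) by ring, Real.rpow_mul hk'.le]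
  apply Real.rpow_le_rpow_of_nonpos (by positivity) _ (by linarith)
  rw [Real.rpow_two, sq_abs]; linarith

theorem zz_wsum : ∃ C : ℝ, 0 < C ∧ ∀ t : ℝ, Summable (fun γ : ZZ => (mz γ : ℝ) * wt (t - γ)) ∧
    ∑' γ : ZZ, (mz γ : ℝ) * wt (t - γ) ≤ C * Lg t := by
  obtain ⟨C, hC, hcount⟩ := zz_count
  set b : ℤ → ℝ := fun k => (1 + (k:ℝ) ^ 2) ^ (-(9/16) : ℝ) with hb
  have hbs : Summable b := int_summ (9/16) (by norm_num)
  have hb0 : ∀ k, 0 < b k := fun k => Real.rpow_pos_of_pos (by positivity) _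
  set D := (4:ℝ) ^ (5/8 : ℝ) with hD
  have hD0 : 0 < D := by positivity
  have hsum : ∀ (t : ℝ) (A : Finset ZZ), ∑ γ ∈ A, (mz γ : ℝ) * wt (t - γ) ≤ C * D * (1 + 64) * (∑' k, b k) * Lg t := by
    intro t A
    classical
    have hk : ∀ k : ℤ, ∑ γ ∈ A.filter (fun γ : ZZ => round ((γ:ℝ) - t) = k), (mz γ : ℝ) * wt (t - γ) ≤ C * D * (1 + 64) * Lg t * b k := by
      intro k
      have hround : ∀ γ ∈ A.filter (fun γ : ZZ => round ((γ:ℝ) - t) = k), |(γ:ℝ) - t - k| ≤ 1/2 := by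
        intro γ hγ
        have := abs_sub_round ((γ:ℝ) - t)
        rw [(Finset.mem_filter.1 hγ).2] at this
        exact this
      have h1 : ∀ γ ∈ A.filter (fun γ : ZZ => round ((γ:ℝ) - t) = k), (mz γ : ℝ) * wt (t - γ) ≤ (mz γ : ℝ) * (D * wt k) := by
        intro γ hγ
        gcongr
        apply wt_le_of _ _ _ (by norm_num)
        have := hround γ hγ
        rw [abs_le] at this
        nlinarith [sq_nonneg ((k:ℝ) - 2 * ((γ:ℝ) - t)), sq_nonneg ((γ:ℝ) - t - k)]
      refine (Finset.sum_le_sum h1).trans ?_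
      rw [← Finset.sum_mul]
      have h2 := hcount (t + k) (A.filter (fun γ : ZZ => round ((γ:ℝ) - t) = k)) (fun γ hγ => by
        have := hround γ hγ
        rw [show (γ:ℝ) - (t + k) = (γ:ℝ) - t - k by ring]; linarith)
      have h3 : Lg (t + k) ≤ (1 + 64) * Lg t * (1 + (k:ℝ) ^ 2) ^ (1/16 : ℝ) := by
        have h4 := Lg_add t k
        have h5 := Lg_rpow k
        have h6 := Lg_half t
        have h7 : (1:ℝ) ≤ (1 + (k:ℝ)^2) ^ (1/16 : ℝ) := Real.one_le_rpow (by nlinarith [sq_nonneg (k:ℝ)]) (by norm_num)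
        nlinarith
      have h8 : wt k * (1 + (k:ℝ) ^ 2) ^ (1/16 : ℝ) = b k := by
        rw [wt, hb, ← Real.rpow_add (by positivity)]; norm_num
      calc _ ≤ C * Lg (t + k) * (D * wt k) := by
            have := (wt_pos k).le
            gcongr
        _ ≤ C * ((1 + 64) * Lg t * (1 + (k:ℝ) ^ 2) ^ (1/16 : ℝ)) * (D * wt k) := by
            have := (wt_pos k).le
            gcongr
        _ = _ := by rw [← h8]; ring
    have h9 := Finset.sum_fiberwise_of_maps_to (s := A) (t := A.image (fun γ : ZZ => round ((γ:ℝ) - t)))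
      (g := fun γ : ZZ => round ((γ:ℝ) - t)) (fun γ hγ => Finset.mem_image_of_mem _ hγ)
      (fun γ : ZZ => (mz γ : ℝ) * wt (t - γ))
    rw [← h9]
    refine (Finset.sum_le_sum fun k _ => hk k).trans ?_
    rw [← Finset.mul_sum]
    have := hbs.sum_le_tsum (A.image (fun γ : ZZ => round ((γ:ℝ) - t))) (fun k _ => (hb0 k).le)
    have hL := Lg_half t
    have : C * D * (1 + 64) * Lg t * ∑ i ∈ A.image (fun γ : ZZ => round ((γ:ℝ) - t)), b i ≤ C * D * (1 + 64) * Lg t * ∑' k, b k := by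
      gcongr
    linarith
  have hpos : 0 < ∑' k, b k := hbs.tsum_pos (fun k => (hb0 k).le) 0 (hb0 0)
  refine ⟨C * D * (1 + 64) * (∑' k, b k), by positivity, fun t => ?_⟩
  have hnn : ∀ γ : ZZ, 0 ≤ (mz γ : ℝ) * wt (t - γ) := fun γ => mul_nonneg (Nat.cast_nonneg _) (wt_pos _).le
  exact ⟨summable_of_sum_le hnn (hsum t), Real.tsum_le_of_sum_le hnn (hsum t)⟩

/-- multiplicity link -/
theorem zetaMult_eq (ρ : ℂ) (h1 : ρ ≠ 1) : zetaMult ρ = analyticOrderNatAt zf ρ := by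
  have han : AnalyticAt ℂ riemannZeta ρ := by
    refine DifferentiableOn.analyticAt (s := {1}ᶜ) (fun z hz => (differentiableAt_riemannZeta hz).differentiableWithinAt)
      (isOpen_compl_singleton.mem_nhds h1)
  have hzf : analyticOrderAt zf ρ = analyticOrderAt riemannZeta ρ := by
    have e : zf =ᶠ[𝓝 ρ] (fun s => s - 1) * riemannZeta := by
      filter_upwards [isOpen_compl_singleton.mem_nhds h1] with s hs
      exact zf_eq hs
    rw [analyticOrderAt_congr e, analyticOrderAt_mul (by fun_prop) han]
    have : analyticOrderAt (fun s : ℂ => s - 1) ρ = 0 :=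
      (analyticOrderAt_eq_zero).2 (Or.inr (sub_ne_zero.2 h1))
    rw [this, zero_add]
  have htop : analyticOrderAt zf ρ ≠ ⊤ := by
    have hz : AnalyticOnNhd ℂ zf univ := fun z _ => zf_diff.analyticAt z
    refine hz.analyticOrderAt_ne_top_of_isPreconnected isPreconnected_univ (mem_univ 1) (mem_univ ρ) ?_
    rw [(analyticOrderAt_eq_zero).2 (Or.inr (by rw [zf_one]; exact one_ne_zero))]; simp
  have hn : analyticOrderAt riemannZeta ρ = (analyticOrderNatAt zf ρ : ℕ) := by
    rw [← hzf, Nat.cast_analyticOrderNatAt htop]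
  set n := analyticOrderNatAt zf ρ
  have hk := fun k => natCast_le_analyticOrderAt_iff_iteratedDeriv_eq_zero (n := k) han
  unfold zetaMult
  apply le_antisymm
  · apply Nat.sInf_le
    intro h0
    have := (hk (n+1)).2 (fun i hi => by
      rcases Nat.lt_succ_iff_lt_or_eq.1 hi with h | h
      · exact (hk n).1 hn.ge i h
      · rw [h]; exact h0)
    rw [hn] at this
    have := ENat.natCast_le_natCast.1 this
    omega
  · refine le_csInf ?_ ?_
    · by_contra hne
      rw [Set.not_nonempty_iff_eq_empty, Set.eq_empty_iff_forall_notMem] at hne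
      have := (hk (n+1)).2 (fun i _ => by simpa using hne i)
      rw [hn] at this
      have := ENat.natCast_le_natCast.1 this
      omega
    · intro k hk0
      by_contra hlt
      exact hk0 ((hk n).1 hn.ge k (by omega))

end ModCz

section ModE1
open Complex Filter MeasureTheory Real Set
open scoped Topology
/-- log derivative of zf at 1/2+s -/
def Ph (s : ℂ) : ℂ := deriv zf (1/2 + s) / zf (1/2 + s)
def pt (s : ℂ) (γ : ℝ) : ℂ := 1 / (s - γ * I) - 1 / (1 - γ * I)
def Pz (s : ℂ) : ℂ := ∑' γ : ZZ, (mz γ : ℂ) * pt s γ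

lemma mz_pos (γ : ZZ) : 1 ≤ mz γ := by
  have htop : analyticOrderAt zf (1/2 + (γ:ℝ) * I) ≠ ⊤ := by
    have hz : AnalyticOnNhd ℂ zf univ := fun z _ => zf_diff.analyticAt z
    refine hz.analyticOrderAt_ne_top_of_isPreconnected isPreconnected_univ (mem_univ 1) (mem_univ _) ?_
    rw [(analyticOrderAt_eq_zero).2 (Or.inr (by rw [zf_one]; exact one_ne_zero))]; simp
  have h1 := (zf_diff.analyticAt (1/2 + (γ:ℝ) * I)).analyticOrderAt_ne_zero.2 γ.2
  rw [← Nat.cast_analyticOrderNatAt htop] at h1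
  have : analyticOrderNatAt zf (1/2 + (γ:ℝ) * I) ≠ 0 := by exact_mod_cast h1
  exact Nat.one_le_iff_ne_zero.2 this

lemma fin_window (H : ℝ) : {γ : ZZ | |(γ:ℝ)| ≤ H}.Finite := by
  obtain ⟨C, hC, h⟩ := zz_wsum
  have h1 := (h 0).1.tendsto_cofinite_zero
  have h2 := h1.eventually (gt_mem_nhds (wt_pos H))
  rw [eventually_cofinite] at h2
  refine h2.subset ?_
  intro γ hγ
  simp only [Set.mem_ofPred_eq] at hγ ⊢
  rw [not_lt]
  have h3 : wt H ≤ wt (0 - γ) := by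
    unfold wt
    apply Real.rpow_le_rpow_of_nonpos (by positivity) _ (by norm_num)
    have : (0 - (γ:ℝ)) ^ 2 ≤ H ^ 2 := by
      rw [zero_sub, neg_sq]; exact sq_le_sq' (by linarith [neg_abs_le (γ:ℝ)]) (by linarith [le_abs_self (γ:ℝ)])
    linarith
  have h4 : (1:ℝ) ≤ mz γ := by exact_mod_cast mz_pos γ
  nlinarith [wt_pos (0 - (γ:ℝ))]

lemma three_AG (S A G : ℝ) (hS : 1 ≤ S) (hA : 1 ≤ A) (hG : 1 ≤ G) (h : S ≤ 2 * (A * G)) :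
    S ^ (1/2 : ℝ) * (A * G) ^ (-(1/2) : ℝ) ≤ 2 * S ^ (3/8 : ℝ) * (A ^ (-(5/8) : ℝ) + G ^ (-(5/8) : ℝ)) := by
  have hA0 : 0 < A := by linarith
  have hG0 : 0 < G := by linarith
  have hAG : 0 < A * G := by positivity
  have hS0 : 0 < S := by linarith
  have e1 : S ^ (1/2 : ℝ) = S ^ (3/8 : ℝ) * S ^ (1/8 : ℝ) := by rw [← Real.rpow_add hS0]; norm_num
  have e2 : (A * G) ^ (-(1/2) : ℝ) = (A * G) ^ (-(1/8) : ℝ) * (A * G) ^ (-(3/8) : ℝ) := by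
    rw [← Real.rpow_add hAG]; norm_num
  have h1 : S ^ (1/8 : ℝ) * (A * G) ^ (-(1/8) : ℝ) ≤ 2 := by
    have : S ^ (1/8 : ℝ) ≤ 2 ^ (1/8 : ℝ) * (A * G) ^ (1/8 : ℝ) := by
      rw [← Real.mul_rpow (by norm_num) hAG.le]
      exact Real.rpow_le_rpow hS0.le h (by norm_num)
    calc _ ≤ (2 ^ (1/8 : ℝ) * (A * G) ^ (1/8 : ℝ)) * (A * G) ^ (-(1/8) : ℝ) := by gcongr
      _ = 2 ^ (1/8 : ℝ) := by rw [mul_assoc, ← Real.rpow_add hAG]; norm_num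
      _ ≤ 2 ^ (1 : ℝ) := Real.rpow_le_rpow_of_exponent_le (by norm_num) (by norm_num)
      _ = 2 := by norm_num
  have h2 : (A * G) ^ (-(3/8) : ℝ) ≤ A ^ (-(5/8) : ℝ) + G ^ (-(5/8) : ℝ) := by
    rw [Real.mul_rpow hA0.le hG0.le]
    have a1 : A ^ (-(3/8) : ℝ) ^ 2 = 0 ∨ True := Or.inr trivial
    have hx : (A ^ (-(3/8) : ℝ)) ^ 2 ≤ A ^ (-(5/8) : ℝ) := by
      rw [← Real.rpow_natCast, ← Real.rpow_mul hA0.le]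
      exact Real.rpow_le_rpow_of_exponent_le hA (by norm_num)
    have hy : (G ^ (-(3/8) : ℝ)) ^ 2 ≤ G ^ (-(5/8) : ℝ) := by
      rw [← Real.rpow_natCast, ← Real.rpow_mul hG0.le]
      exact Real.rpow_le_rpow_of_exponent_le hG (by norm_num)
    nlinarith [sq_nonneg (A ^ (-(3/8) : ℝ) - G ^ (-(3/8) : ℝ)), sq_nonneg (A ^ (-(3/8) : ℝ)), sq_nonneg (G ^ (-(3/8) : ℝ))]
  rw [e1, e2]
  calc S ^ (3/8 : ℝ) * S ^ (1/8 : ℝ) * ((A * G) ^ (-(1/8) : ℝ) * (A * G) ^ (-(3/8) : ℝ))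
      = S ^ (3/8 : ℝ) * (S ^ (1/8 : ℝ) * (A * G) ^ (-(1/8) : ℝ)) * (A * G) ^ (-(3/8) : ℝ) := by ring
    _ ≤ S ^ (3/8 : ℝ) * 2 * (A ^ (-(5/8) : ℝ) + G ^ (-(5/8) : ℝ)) := by gcongr
    _ = _ := by ring

lemma sq_ineq (τ γ : ℝ) : 1 + τ ^ 2 ≤ 2 * ((1 + (τ - γ) ^ 2) * (1 + γ ^ 2)) := by
  nlinarith [sq_nonneg (τ - 2 * γ), sq_nonneg ((τ - γ) * γ)]

lemma pt_eq (s : ℂ) (γ : ℝ) (h : s - γ * I ≠ 0) : pt s γ = (1 - s) / ((s - γ * I) * (1 - γ * I)) := by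
  have h1 : (1 - γ * I : ℂ) ≠ 0 := by
    intro h; have := congrArg Complex.re h; simp at this
  unfold pt
  rw [div_sub_div _ _ h h1]; congr 1; ring

lemma norm_ge_aux (s : ℂ) (γ : ℝ) (h : 1/10 ≤ |s.re| ∨ 9/10 ≤ |γ - s.im|) :
    (1 + (s.im - γ) ^ 2) ^ (1/2 : ℝ) ≤ 10 * ‖s - γ * I‖ := by
  rw [← Real.sqrt_eq_rpow]
  apply Real.sqrt_le_iff.2 ⟨by positivity, ?_⟩
  rw [mul_pow, Complex.sq_norm, Complex.normSq_apply]
  simp only [sub_re, mul_re, ofReal_re, I_re, mul_zero, ofReal_im, I_im, mul_one, sub_self, sub_zero, sub_im, mul_im, add_zero]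
  rcases h with h | h
  · have := sq_abs s.re
    nlinarith [sq_nonneg (s.im - γ)]
  · have h1 := sq_abs (γ - s.im)
    nlinarith [sq_nonneg s.re]

lemma pt_bound (s : ℂ) (γ : ℝ) (h1 : -1/5 ≤ s.re) (h2 : s.re ≤ 1) (h : 1/10 ≤ |s.re| ∨ 9/10 ≤ |γ - s.im|) :
    ‖pt s γ‖ ≤ 40 * (1 + s.im ^ 2) ^ (3/8 : ℝ) * (wt (s.im - γ) + wt γ) := by
  have hA := norm_ge_aux s γ h
  have hA1 : (1:ℝ) ≤ (1 + (s.im - γ) ^ 2) := by nlinarith [sq_nonneg (s.im - γ)]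
  have hG1 : (1:ℝ) ≤ (1 + γ ^ 2) := by nlinarith [sq_nonneg γ]
  have hS1 : (1:ℝ) ≤ (1 + s.im ^ 2) := by nlinarith [sq_nonneg s.im]
  have hne : s - γ * I ≠ 0 := by
    intro h0
    rw [h0, norm_zero, mul_zero] at hA
    have : 0 < (1 + (s.im - γ) ^ 2) ^ (1/2 : ℝ) := by positivity
    linarith
  have hG : (1 + γ ^ 2) ^ (1/2 : ℝ) = ‖(1 - γ * I : ℂ)‖ := by
    rw [← Real.sqrt_eq_rpow, Complex.norm_def, Complex.normSq_apply]
    congr 1; simp; ring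
  have hS : ‖1 - s‖ ≤ 2 * (1 + s.im ^ 2) ^ (1/2 : ℝ) := by
    rw [← Real.sqrt_eq_rpow, Complex.norm_def, Complex.normSq_apply, Real.sqrt_le_left (by positivity), mul_pow, Real.sq_sqrt (by positivity)]
    simp
    nlinarith [sq_nonneg s.im]
  rw [pt_eq s γ hne, norm_div, norm_mul, ← hG]
  have h3 := three_AG _ _ _ hS1 hA1 hG1 (sq_ineq s.im γ)
  have hA0 : 0 < (1 + (s.im - γ) ^ 2) ^ (1/2 : ℝ) := by positivity
  have hG0 : 0 < (1 + γ ^ 2) ^ (1/2 : ℝ) := by positivity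
  have h4 : ((1 + (s.im - γ) ^ 2) * (1 + γ ^ 2)) ^ (-(1/2) : ℝ) = 1 / ((1 + (s.im - γ) ^ 2) ^ (1/2 : ℝ) * (1 + γ ^ 2) ^ (1/2 : ℝ)) := by
    rw [Real.rpow_neg (by positivity), Real.mul_rpow (by positivity) (by positivity)]
    exact (one_div _).symm
  calc ‖1 - s‖ / (‖s - γ * I‖ * (1 + γ ^ 2) ^ (1/2 : ℝ))
      ≤ (2 * (1 + s.im ^ 2) ^ (1/2 : ℝ)) / (((1 + (s.im - γ) ^ 2) ^ (1/2 : ℝ) / 10) * (1 + γ ^ 2) ^ (1/2 : ℝ)) := by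
        gcongr; linarith
    _ = 20 * ((1 + s.im ^ 2) ^ (1/2 : ℝ) * ((1 + (s.im - γ) ^ 2) * (1 + γ ^ 2)) ^ (-(1/2) : ℝ)) := by
        rw [h4]; field_simp; norm_num
    _ ≤ 20 * (2 * (1 + s.im ^ 2) ^ (3/8 : ℝ) * (wt (s.im - γ) + wt γ)) := by
        exact mul_le_mul_of_nonneg_left h3 (by norm_num)
    _ = _ := by ring

lemma zz_w0 : Summable (fun γ : ZZ => (mz γ : ℝ) * wt γ) := by
  obtain ⟨C, hC, h⟩ := zz_wsum
  have := (h 0).1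
  simpa [wt] using this

/-- bounding majorant summable -/
lemma maj_summable (τ : ℝ) : Summable (fun γ : ZZ => (mz γ : ℝ) * (wt (τ - γ) + wt γ)) := by
  obtain ⟨C, hC, h⟩ := zz_wsum
  simp only [mul_add]
  exact (h τ).1.add zz_w0

lemma pz_summable (s : ℂ) (h1 : -1/10 ≤ s.re) (h2 : s.re ≤ 1) : Summable (fun γ : ZZ => (mz γ : ℂ) * pt s γ) := by
  refine Summable.of_norm_bounded_eventually
    (g := fun γ : ZZ => 40 * (1 + s.im ^ 2) ^ (3/8 : ℝ) * ((mz γ : ℝ) * (wt (s.im - γ) + wt γ)))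
    ((maj_summable s.im).mul_left _) ?_
  rw [eventually_cofinite]
  refine (fin_window (|s.im| + 1)).subset ?_
  intro γ hγ
  simp only [Set.mem_ofPred_eq] at hγ ⊢
  by_contra hlt
  apply hγ
  have : 9/10 ≤ |(γ:ℝ) - s.im| := by
    have := abs_sub_abs_le_abs_sub (γ:ℝ) s.im
    linarith
  rw [norm_mul, Complex.norm_natCast]
  have h3 := mul_le_mul_of_nonneg_left (pt_bound s γ (by linarith) h2 (Or.inr this)) (Nat.cast_nonneg (α := ℝ) (mz γ))
  linarith

theorem q_bound (hRH : RiemannHypothesis) : ∃ C : ℝ, 0 < C ∧ ∀ s : ℂ, -1/10 ≤ s.re → s.re ≤ 1 →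
    zf (1/2 + s) ≠ 0 → ‖Ph s - Pz s‖ ≤ C * (1 + s.im ^ 2) ^ (3/8 : ℝ) * Lg s.im := by
  obtain ⟨C1, hC1, hl⟩ := zf_local' hRH
  obtain ⟨C2, hC2, hw⟩ := zz_wsum
  refine ⟨2 * C1 + 80 * C2 , by positivity, fun s h1 h2 h0 => ?_⟩
  obtain ⟨A, hA1, hA2, hA3, hA4⟩ := hl s.im
  have hA5 := hA4 s rfl h1 h2 h0
  have hsum := pz_summable s h1 h2
  have hS1 : (1:ℝ) ≤ (1 + s.im ^ 2) ^ (3/8 : ℝ) := Real.one_le_rpow (by nlinarith [sq_nonneg s.im]) (by norm_num)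
  set S := (1 + s.im ^ 2) ^ (3/8 : ℝ) with hS
  have hsplit : Pz s = ∑ γ ∈ A, (mz γ : ℂ) * pt s γ + ∑' γ : ↥((A : Set ZZ)ᶜ), (mz (γ:ZZ) : ℂ) * pt s (γ:ZZ) :=
    (hsum.sum_add_tsum_compl (s := A)).symm
  have hfar : ‖∑' γ : ↥((A : Set ZZ)ᶜ), (mz (γ:ZZ) : ℂ) * pt s (γ:ZZ)‖ ≤ 40 * S * (2 * C2 * Lg s.im) := by
    have hb : ∀ γ : ↥((A : Set ZZ)ᶜ), ‖(mz (γ:ZZ) : ℂ) * pt s (γ:ZZ)‖ ≤ 40 * S * ((mz (γ:ZZ) : ℝ) * (wt (s.im - (γ:ZZ)) + wt (γ:ZZ))) := by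
      rintro ⟨γ, hγ⟩
      have hγ' : 9/10 ≤ |(γ:ℝ) - s.im| := by
        by_contra hlt
        exact hγ (hA2 γ (by linarith))
      rw [norm_mul, Complex.norm_natCast]
      have h3 := mul_le_mul_of_nonneg_left (pt_bound s γ (by linarith) h2 (Or.inr hγ')) (Nat.cast_nonneg (α := ℝ) (mz γ))
      simp only at h3 ⊢
      rw [← hS] at h3
      linarith
    have hms := (maj_summable s.im)
    have hms' : Summable (fun γ : ↥((A : Set ZZ)ᶜ) => (mz (γ:ZZ) : ℝ) * (wt (s.im - (γ:ZZ)) + wt (γ:ZZ))) :=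
      hms.subtype _
    have h4 := tsum_of_norm_bounded ((hms'.hasSum).mul_left (40 * S)) hb
    refine h4.trans ?_
    gcongr
    refine (hms.tsum_subtype_le _ _ (fun γ => mul_nonneg (Nat.cast_nonneg _) (add_nonneg (wt_pos _).le (wt_pos _).le))).trans ?_
    simp only [mul_add]
    rw [(hw s.im).1.tsum_add zz_w0]
    have h5 := (hw s.im).2
    have h6 := (hw 0).2
    have h7 : ∑' γ : ZZ, (mz γ : ℝ) * wt (0 - γ) = ∑' γ : ZZ, (mz γ : ℝ) * wt γ := by simp [wt]
    rw [h7] at h6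
    have h8 : Lg 0 ≤ Lg s.im := by
      unfold Lg; apply Real.log_le_log (by norm_num); simp
    nlinarith
  have hnear : ‖∑ γ ∈ A, (mz γ : ℂ) * (1 / (1 - (γ:ℝ) * I))‖ ≤ C1 * Lg s.im := by
    refine (norm_sum_le _ _).trans (le_trans (Finset.sum_le_sum fun γ _ => ?_) hA3)
    rw [norm_mul, Complex.norm_natCast, norm_div, norm_one]
    have : 1 ≤ ‖(1 - (γ:ℝ) * I : ℂ)‖ := by
      have := Complex.abs_re_le_norm (1 - (γ:ℝ) * I : ℂ)
      simpa using this
    exact mul_le_of_le_one_right (Nat.cast_nonneg _) ((div_le_one (by linarith)).2 this)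
  have hid : Ph s - Pz s = (Ph s - ∑ γ ∈ A, (mz γ : ℂ) / (s - (γ:ℝ) * I)) + ∑ γ ∈ A, (mz γ : ℂ) * (1 / (1 - (γ:ℝ) * I))
      - ∑' γ : ↥((A : Set ZZ)ᶜ), (mz (γ:ZZ) : ℂ) * pt s (γ:ZZ) := by
    rw [hsplit]
    have : ∑ γ ∈ A, (mz γ : ℂ) * pt s γ = ∑ γ ∈ A, (mz γ : ℂ) / (s - (γ:ℝ) * I) - ∑ γ ∈ A, (mz γ : ℂ) * (1 / (1 - (γ:ℝ) * I)) := by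
      rw [← Finset.sum_sub_distrib]
      exact Finset.sum_congr rfl fun γ _ => by unfold pt; ring
    rw [this]; ring
  rw [hid]
  refine (norm_sub_le _ _).trans ((add_le_add (norm_add_le _ _) le_rfl).trans ?_)
  have hL := Lg_half s.im
  have h9 : (C1 * Lg s.im) * 1 ≤ (C1 * Lg s.im) * S := by gcongr
  have hA5' : ‖Ph s - ∑ γ ∈ A, (mz γ : ℂ) / (s - (γ:ℝ) * I)‖ ≤ C1 * Lg s.im := hA5
  nlinarith

lemma zf_ne (hRH : RiemannHypothesis) (s : ℂ) (h1 : -1/2 < s.re) (h2 : s.re ≠ 0) : zf (1/2 + s) ≠ 0 := by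
  intro h
  have := rh_zero hRH (1/2 + s) (by simp; linarith) h
  have := congrArg Complex.re this
  simp at this
  exact h2 this

lemma zf_ne' (hRH : RiemannHypothesis) (s : ℂ) (h1 : -1/2 < s.re) (h2 : ∀ γ : ZZ, s ≠ (γ:ℝ) * I) : zf (1/2 + s) ≠ 0 := by
  intro h
  have h3 := rh_zero hRH (1/2 + s) (by simp; linarith) h
  have h4 : s = (s.im : ℂ) * I := by
    have : ((1/2 + s : ℂ).im : ℂ) = s.im := by simp
    rw [this] at h3
    exact add_left_cancel h3
  exact h2 ⟨s.im, by rw [← h4]; exact h⟩ h4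

theorem phi_line (hRH : RiemannHypothesis) : ∃ C : ℝ, 0 < C ∧ ∀ s : ℂ, -1/10 ≤ s.re → s.re ≤ 1 →
    1/10 ≤ |s.re| → ‖Ph s‖ ≤ C * Lg s.im := by
  obtain ⟨C1, hC1, hl⟩ := zf_local' hRH
  refine ⟨11 * C1, by positivity, fun s h1 h2 h3 => ?_⟩
  obtain ⟨A, hA1, hA2, hA3, hA4⟩ := hl s.im
  have h0 := zf_ne hRH s (by linarith) (by intro h; rw [h] at h3; norm_num at h3)
  have hA5 : ‖Ph s - ∑ γ ∈ A, (mz γ : ℂ) / (s - (γ:ℝ) * I)‖ ≤ C1 * Lg s.im := hA4 s rfl h1 h2 h0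
  have hs : ‖∑ γ ∈ A, (mz γ : ℂ) / (s - (γ:ℝ) * I)‖ ≤ 10 * (C1 * Lg s.im) := by
    have h10 : ∑ γ ∈ A, 10 * (mz γ : ℝ) ≤ 10 * (C1 * Lg s.im) := by
      rw [← Finset.mul_sum]; exact mul_le_mul_of_nonneg_left hA3 (by norm_num)
    refine (norm_sum_le _ _).trans (le_trans (Finset.sum_le_sum fun γ _ => ?_) h10)
    · rw [norm_div, Complex.norm_natCast]
      have : 1/10 ≤ ‖s - (γ:ℝ) * I‖ := by
        have := Complex.abs_re_le_norm (s - (γ:ℝ) * I)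
        simp at this
        linarith
      rw [div_le_iff₀ (by linarith)]
      nlinarith [Nat.cast_nonneg (α := ℝ) (mz γ)]
  have := norm_sub_norm_le (Ph s) (∑ γ ∈ A, (mz γ : ℂ) / (s - (γ:ℝ) * I))
  linarith

end ModE1

section ModE2
open Complex Filter MeasureTheory Real Set
open scoped Topology
lemma wt_shift (τ γ H : ℝ) (h : |τ| ≤ H) : wt (τ - γ) ≤ (2 * (1 + H ^ 2)) ^ (5/8 : ℝ) * wt γ := by
  unfold wt
  have h1 : 1 + γ ^ 2 ≤ (2 * (1 + H ^ 2)) * (1 + (τ - γ) ^ 2) := by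
    have := sq_ineq γ τ
    have h2 : τ ^ 2 ≤ H ^ 2 := sq_le_sq' (by linarith [neg_abs_le τ]) (by linarith [le_abs_self τ])
    have h3 : (γ - τ) ^ 2 = (τ - γ) ^ 2 := by ring
    rw [h3] at this
    nlinarith [sq_nonneg (τ - γ)]
  have h2 : (1 + γ ^ 2) ^ (5/8 : ℝ) ≤ (2 * (1 + H ^ 2)) ^ (5/8 : ℝ) * (1 + (τ - γ) ^ 2) ^ (5/8 : ℝ) := by
    rw [← Real.mul_rpow (by positivity) (by positivity)]
    exact Real.rpow_le_rpow (by positivity) h1 (by norm_num)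
  rw [Real.rpow_neg (by positivity), Real.rpow_neg (by positivity)]
  have p1 : 0 < (1 + γ ^ 2) ^ (5/8 : ℝ) := by positivity
  have p2 : 0 < (1 + (τ - γ) ^ 2) ^ (5/8 : ℝ) := by positivity
  rw [inv_eq_one_div, ← div_eq_mul_inv, div_le_div_iff₀ p2 p1]
  linarith

lemma zf_order_ne_top (z : ℂ) : analyticOrderAt zf z ≠ ⊤ := by
  have hz : AnalyticOnNhd ℂ zf univ := fun z _ => zf_diff.analyticAt z
  refine hz.analyticOrderAt_ne_top_of_isPreconnected isPreconnected_univ (mem_univ 1) (mem_univ _) ?_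
  rw [(analyticOrderAt_eq_zero).2 (Or.inr (by rw [zf_one]; exact one_ne_zero))]; simp

theorem q_analytic (hRH : RiemannHypothesis) (H : ℝ) : ∃ g : ℂ → ℂ,
    DifferentiableOn ℂ g {s : ℂ | -1/5 < s.re ∧ s.re < 1 ∧ |s.im| < H + 1} ∧
    ∀ s : ℂ, -1/10 ≤ s.re → s.re < 1 → |s.im| < H + 1 → zf (1/2 + s) ≠ 0 → g s = Ph s - Pz s := by
  classical
  set A : Finset ZZ := (fin_window (H + 2)).toFinset with hA
  have hAm : ∀ γ : ZZ, γ ∈ A ↔ |(γ:ℝ)| ≤ H + 2 := by intro γ; simp [hA]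
  let e : ZZ → ℂ := fun γ => 1/2 + (γ:ℝ) * I
  have he : Function.Injective e := by
    intro a b h
    have : ((a:ℝ):ℂ) * I = ((b:ℝ):ℂ) * I := add_left_cancel h
    have := congrArg Complex.im this
    simp at this
    exact Subtype.ext this
  set S : Finset ℂ := A.image e with hS
  have hz : AnalyticOnNhd ℂ zf univ := fun z _ => zf_diff.analyticAt z
  obtain ⟨G, hGan, hFG, hG0⟩ := factor_zeros univ zf hz S (fun _ _ => mem_univ _) (fun u _ => zf_order_ne_top u)
  set U : Set ℂ := {s : ℂ | -1/5 < s.re ∧ s.re < 1 ∧ |s.im| < H + 1} with hU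
  have hUo : IsOpen U := by
    have h1 : IsOpen {s : ℂ | -1/5 < s.re} := isOpen_lt continuous_const Complex.continuous_re
    have h2 : IsOpen {s : ℂ | s.re < 1} := isOpen_lt Complex.continuous_re continuous_const
    have h3 : IsOpen {s : ℂ | |s.im| < H + 1} := isOpen_lt (by fun_prop) continuous_const
    exact h1.inter (h2.inter h3)
  have hGne : ∀ s ∈ U, G (1/2 + s) ≠ 0 := by
    rintro s ⟨hs1, hs2, hs3⟩
    by_cases h0 : zf (1/2 + s) = 0
    · have h3 := rh_zero hRH (1/2 + s) (by simp; linarith) h0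
      have h4 : s = (s.im : ℂ) * I := by
        have : ((1/2 + s : ℂ).im : ℂ) = s.im := by simp
        rw [this] at h3
        exact add_left_cancel h3
      apply hG0
      rw [hS, Finset.mem_image]
      refine ⟨⟨s.im, by rw [← h4]; exact h0⟩, (hAm _).2 (by simp only; linarith), ?_⟩
      simp only [e]; rw [← h4]
    · intro h; apply h0; rw [hFG, h, mul_zero]
  have hGd : ∀ z, DifferentiableAt ℂ G z := fun z => (hGan z (mem_univ z)).differentiableAt
  have hGd' : ∀ z, DifferentiableAt ℂ (deriv G) z := fun z => (hGan z (mem_univ z)).deriv.differentiableAt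
  -- tail
  have htail : ∀ γ : ↥((A : Set ZZ)ᶜ), ∀ s ∈ U, 1 < |((γ:ZZ):ℝ) - s.im| := by
    rintro ⟨γ, hγ⟩ s ⟨hs1, hs2, hs3⟩
    have h1 : H + 2 < |(γ:ℝ)| := by
      by_contra h; exact hγ ((hAm γ).2 (by linarith))
    have := abs_sub_abs_le_abs_sub (γ:ℝ) s.im
    simp only
    linarith
  have hdt : DifferentiableOn ℂ (fun s => ∑' γ : ↥((A : Set ZZ)ᶜ), (mz (γ:ZZ) : ℂ) * pt s (γ:ZZ)) U := by
    set K : ℝ := 40 * (1 + (H + 1) ^ 2) ^ (3/8 : ℝ) * ((2 * (1 + (H + 1) ^ 2)) ^ (5/8 : ℝ) + 1) with hK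
    refine differentiableOn_tsum_of_summable_norm (u := fun γ : ↥((A : Set ZZ)ᶜ) => K * ((mz (γ:ZZ) : ℝ) * wt (γ:ZZ)))
      ((zz_w0.subtype _).mul_left K) ?_ hUo ?_
    · intro γ s hs
      have hne : s - (((γ:ZZ):ℝ) : ℂ) * I ≠ 0 := by
        intro h
        have h1 := congrArg Complex.im h
        have h2 := htail γ s hs
        simp at h1
        have : ((γ:ZZ):ℝ) - s.im = 0 := by linarith
        rw [this] at h2; simp at h2; linarith
      unfold pt
      apply DifferentiableAt.differentiableWithinAt
      refine DifferentiableAt.const_mul (DifferentiableAt.sub_const ?_ _) _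
      exact (differentiableAt_const _).div (by fun_prop) hne
    · intro γ s hs
      have h1 := htail γ s hs
      obtain ⟨hs1, hs2, hs3⟩ := hs
      have h2 := pt_bound s (γ:ZZ) hs1.le hs2.le (Or.inr (by linarith))
      rw [norm_mul, Complex.norm_natCast]
      have h3 := wt_shift s.im (γ:ZZ) (H + 1) hs3.le
      have h4 : (1 + s.im ^ 2) ^ (3/8 : ℝ) ≤ (1 + (H + 1) ^ 2) ^ (3/8 : ℝ) := by
        apply Real.rpow_le_rpow (by positivity) _ (by norm_num)
        have : s.im ^ 2 ≤ (H + 1) ^ 2 := sq_le_sq' (by linarith [neg_abs_le s.im]) (by linarith [le_abs_self s.im])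
        linarith
      have h5 : ‖pt s (γ:ZZ)‖ ≤ K * wt (γ:ZZ) := by
        calc _ ≤ _ := h2
          _ ≤ 40 * (1 + (H + 1) ^ 2) ^ (3/8 : ℝ) * ((2 * (1 + (H + 1) ^ 2)) ^ (5/8 : ℝ) * wt (γ:ZZ) + wt (γ:ZZ)) := by
            have := (wt_pos (s.im - (γ:ZZ))).le
            have := (wt_pos ((γ:ZZ):ℝ)).le
            gcongr
          _ = _ := by rw [hK]; ring
      calc _ ≤ (mz (γ:ZZ) : ℝ) * (K * wt (γ:ZZ)) := by gcongr
        _ = _ := by ring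
  refine ⟨fun s => deriv G (1/2 + s) / G (1/2 + s) + ∑ γ ∈ A, (mz γ : ℂ) * (1 / (1 - (γ:ℝ) * I))
    - ∑' γ : ↥((A : Set ZZ)ᶜ), (mz (γ:ZZ) : ℂ) * pt s (γ:ZZ), ?_, ?_⟩
  · refine DifferentiableOn.sub (DifferentiableOn.add_const _ ?_) hdt
    intro s hs
    apply DifferentiableAt.differentiableWithinAt
    refine DifferentiableAt.div ?_ ?_ (hGne s hs)
    · exact DifferentiableAt.comp (g := deriv G) s (hGd' _) (by fun_prop)
    · exact DifferentiableAt.comp (g := G) s (hGd _) (by fun_prop)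
  · intro s h1 h2 h3 h0
    have hsU : s ∈ U := ⟨by linarith, h2, h3⟩
    have hzu : ∀ u ∈ S, (1/2 + s) - u ≠ 0 := by
      intro u hu h
      rw [sub_eq_zero] at h
      rw [hS, Finset.mem_image] at hu
      obtain ⟨γ, _, rfl⟩ := hu
      exact h0 (by rw [h]; exact γ.2)
    set z := 1/2 + s with hzdef
    set n : ℂ → ℕ := fun u => analyticOrderNatAt zf u with hn
    have hlog : deriv zf z / zf z = ∑ u ∈ S, (n u : ℂ) / (z - u) + deriv G z / G z := by
      have e1 : zf = fun z => (∏ u ∈ S, (z - u) ^ n u) * G z := funext hFG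
      have e2 : logDeriv zf z = logDeriv (fun z => ∏ u ∈ S, (z - u) ^ n u) z + logDeriv G z := by
        nth_rewrite 1 [e1]
        refine logDeriv_mul z ?_ (hGne s hsU) ?_ (hGd z)
        · exact Finset.prod_ne_zero_iff.2 fun u hu => pow_ne_zero _ (hzu u hu)
        · exact DifferentiableAt.fun_finsetProd fun u _ => by fun_prop
      have e3 : logDeriv (fun z => ∏ u ∈ S, (z - u) ^ n u) z = ∑ u ∈ S, (n u : ℂ) / (z - u) := by
        rw [logDeriv_prod]
        · refine Finset.sum_congr rfl fun u hu => ?_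
          rw [logDeriv_fun_pow (by fun_prop)]
          simp [logDeriv_apply, div_eq_mul_inv]
        · exact fun u hu => pow_ne_zero _ (hzu u hu)
        · exact fun u _ => by fun_prop
      rw [← logDeriv_apply, e2, e3, logDeriv_apply]
    have hsumS : ∑ u ∈ S, (n u : ℂ) / (z - u) = ∑ γ ∈ A, (mz γ : ℂ) / (s - (γ:ℝ) * I) := by
      rw [hS, Finset.sum_image (fun a _ b _ h => he h)]
      refine Finset.sum_congr rfl fun γ _ => ?_
      have : z - e γ = s - (γ:ℝ) * I := by simp only [e, hzdef]; ring
      rw [this]; rfl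
    have hsum := pz_summable s h1 h2.le
    have hsplit : Pz s = ∑ γ ∈ A, (mz γ : ℂ) * pt s γ + ∑' γ : ↥((A : Set ZZ)ᶜ), (mz (γ:ZZ) : ℂ) * pt s (γ:ZZ) :=
      (hsum.sum_add_tsum_compl (s := A)).symm
    have hd : ∑ γ ∈ A, (mz γ : ℂ) * pt s γ = ∑ γ ∈ A, (mz γ : ℂ) / (s - (γ:ℝ) * I) - ∑ γ ∈ A, (mz γ : ℂ) * (1 / (1 - (γ:ℝ) * I)) := by
      rw [← Finset.sum_sub_distrib]
      exact Finset.sum_congr rfl fun γ _ => by unfold pt; ring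
    unfold Ph
    rw [← hzdef, hlog, hsumS, hsplit, hd]; ring

end ModE2

section ModE3
open Complex Filter MeasureTheory Real Set
open scoped Topology
def Kt (t : ℝ) (s : ℂ) : ℂ := 2 / (1 - (s - t * I) ^ 2)

lemma Kt_den (t : ℝ) (s : ℂ) (h1 : -1 < s.re) (h2 : s.re < 1) : 1 - (s - t * I) ^ 2 ≠ 0 := by
  have e : 1 - (s - t * I) ^ 2 = (1 - (s - t * I)) * (1 + (s - t * I)) := by ring
  rw [e]
  refine mul_ne_zero ?_ ?_ <;> intro h <;> have := congrArg Complex.re h <;> simp at this <;> linarith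

lemma Kt_bound (t : ℝ) (s : ℂ) (h1 : -1/10 ≤ s.re) (h2 : s.re ≤ 3/4) :
    ‖Kt t s‖ ≤ 32 / (1 + (s.im - t) ^ 2) := by
  have e : 1 - (s - t * I) ^ 2 = (1 - (s - t * I)) * (1 + (s - t * I)) := by ring
  unfold Kt
  rw [norm_div, e, norm_mul]
  have p : (0:ℝ) ≤ 1 + (s.im - t) ^ 2 := by positivity
  have a1 : Real.sqrt (1 + (s.im - t) ^ 2) / 4 ≤ ‖1 - (s - t * I)‖ := by
    rw [Complex.norm_def, Complex.normSq_apply]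
    apply Real.le_sqrt_of_sq_le
    rw [div_pow, Real.sq_sqrt p]
    simp
    nlinarith [sq_nonneg (s.im - t)]
  have a2 : Real.sqrt (1 + (s.im - t) ^ 2) / 4 ≤ ‖1 + (s - t * I)‖ := by
    rw [Complex.norm_def, Complex.normSq_apply]
    apply Real.le_sqrt_of_sq_le
    rw [div_pow, Real.sq_sqrt p]
    simp
    nlinarith [sq_nonneg (s.im - t)]
  have hp : 0 < Real.sqrt (1 + (s.im - t) ^ 2) := Real.sqrt_pos.2 (by positivity)
  have a3 : (1 + (s.im - t) ^ 2) / 16 ≤ ‖1 - (s - t * I)‖ * ‖1 + (s - t * I)‖ := by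
    calc _ = (Real.sqrt (1 + (s.im - t) ^ 2) / 4) * (Real.sqrt (1 + (s.im - t) ^ 2) / 4) := by
          have := Real.mul_self_sqrt p
          nlinarith
      _ ≤ _ := by gcongr
  have hp' : 0 < 1 + (s.im - t) ^ 2 := by positivity
  have h2n : ‖(2:ℂ)‖ = 2 := by simp
  rw [h2n, div_le_div_iff₀ (by linarith [div_pos hp' (by norm_num : (0:ℝ) < 16)]) hp']
  nlinarith

def Fc (Y t : ℝ) (s : ℂ) : ℂ := (Ph s - Pz s) * (Complex.exp (s * Y) * Kt t s)

/-- decay of the kernel factor -/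
lemma expK_bound (Y t : ℝ) : ∃ C : ℝ, 0 < C ∧ ∀ s : ℂ, -1/10 ≤ s.re → s.re ≤ 3/4 →
    ‖Complex.exp (s * Y) * Kt t s‖ ≤ C * (1 + s.im ^ 2)⁻¹ := by
  refine ⟨Real.exp |Y| * (64 * (1 + t ^ 2)), by positivity, fun s h1 h2 => ?_⟩
  rw [norm_mul, Complex.norm_exp]
  have h3 : (s * Y).re ≤ |Y| := by
    simp
    have : |s.re| ≤ 1 := abs_le.2 ⟨by linarith, by linarith⟩
    calc s.re * Y ≤ |s.re * Y| := le_abs_self _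
      _ = |s.re| * |Y| := abs_mul _ _
      _ ≤ 1 * |Y| := by gcongr
      _ = |Y| := one_mul _
  have h4 := Kt_bound t s h1 h2
  have h5 : 32 / (1 + (s.im - t) ^ 2) ≤ 64 * (1 + t ^ 2) * (1 + s.im ^ 2)⁻¹ := by
    rw [← div_eq_mul_inv, div_le_div_iff₀ (by positivity) (by positivity)]
    have := sq_ineq s.im t
    nlinarith
  calc _ ≤ Real.exp |Y| * (64 * (1 + t ^ 2) * (1 + s.im ^ 2)⁻¹) := by
        gcongr; exact h4.trans h5
    _ = _ := by ring

lemma Fc_bound (hRH : RiemannHypothesis) (Y t : ℝ) : ∃ C : ℝ, 0 < C ∧ ∀ s : ℂ, -1/10 ≤ s.re → s.re ≤ 3/4 →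
    zf (1/2 + s) ≠ 0 → ‖Fc Y t s‖ ≤ C * (1 + s.im ^ 2) ^ (-(9/16) : ℝ) := by
  obtain ⟨C1, hC1, h1⟩ := q_bound hRH
  obtain ⟨C2, hC2, h2⟩ := expK_bound Y t
  refine ⟨C1 * 32 * C2, by positivity, fun s hs1 hs2 h0 => ?_⟩
  have p : 0 < 1 + s.im ^ 2 := by positivity
  unfold Fc
  rw [norm_mul]
  have e : (1 + s.im ^ 2) ^ (-(9/16) : ℝ) = (1 + s.im ^ 2) ^ (3/8 : ℝ) * (1 + s.im ^ 2) ^ (1/16 : ℝ) * (1 + s.im ^ 2)⁻¹ := by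
    rw [← Real.rpow_neg_one, ← Real.rpow_add p, ← Real.rpow_add p]; norm_num
  calc _ ≤ (C1 * (1 + s.im ^ 2) ^ (3/8 : ℝ) * Lg s.im) * (C2 * (1 + s.im ^ 2)⁻¹) := by
        gcongr
        · have := Lg_half s.im
          positivity
        · exact h1 s hs1 (by linarith) h0
        · exact h2 s hs1 hs2
    _ ≤ (C1 * (1 + s.im ^ 2) ^ (3/8 : ℝ) * (32 * (1 + s.im ^ 2) ^ (1/16 : ℝ))) * (C2 * (1 + s.im ^ 2)⁻¹) := by
        gcongr; exact Lg_rpow _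
    _ = _ := by rw [e]; ring

lemma int_916 : Integrable (fun τ : ℝ => (1 + τ ^ 2) ^ (-(9/16) : ℝ)) := by
  have := integrable_rpow_neg_one_add_norm_sq (E := ℝ) (μ := volume) (r := 9/8) (by norm_num)
  refine this.congr (Eventually.of_forall fun τ => ?_)
  simp only [Real.norm_eq_abs, sq_abs]
  norm_num

lemma line_re (c τ : ℝ) : ((c:ℂ) + τ * I).re = c := by simp
lemma line_im (c τ : ℝ) : ((c:ℂ) + τ * I).im = τ := by simp

lemma PhPz_cont (hRH : RiemannHypothesis) (c : ℝ) (h1 : -1/10 ≤ c) (h2 : c < 1) (h3 : c ≠ 0) :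
    Continuous (fun τ : ℝ => Ph (c + τ * I) - Pz (c + τ * I)) := by
  rw [continuous_iff_continuousAt]
  intro τ
  obtain ⟨g, hg1, hg2⟩ := q_analytic hRH |τ|
  have ho : IsOpen {s : ℂ | -1/5 < s.re ∧ s.re < 1 ∧ |s.im| < |τ| + 1} := by
    have h1 : IsOpen {s : ℂ | -1/5 < s.re} := isOpen_lt continuous_const Complex.continuous_re
    have h2 : IsOpen {s : ℂ | s.re < 1} := isOpen_lt Complex.continuous_re continuous_const
    have h3 : IsOpen {s : ℂ | |s.im| < |τ| + 1} := isOpen_lt (by fun_prop) continuous_const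
    exact h1.inter (h2.inter h3)
  have hmem : ((c:ℂ) + τ * I) ∈ {s : ℂ | -1/5 < s.re ∧ s.re < 1 ∧ |s.im| < |τ| + 1} := by
    refine ⟨?_, ?_, ?_⟩
    · rw [line_re]; linarith
    · rw [line_re]; linarith
    · rw [line_im]; linarith
  have hgc : ContinuousAt g ((c:ℂ) + τ * I) := (hg1.continuousOn).continuousAt (ho.mem_nhds hmem)
  have hcomp : ContinuousAt (fun x : ℝ => g ((c:ℂ) + x * I)) τ :=
    ContinuousAt.comp (f := fun x : ℝ => (c:ℂ) + x * I) hgc (by fun_prop)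
  refine hcomp.congr ?_
  have : ∀ᶠ x : ℝ in 𝓝 τ, |x| < |τ| + 1 :=
    continuous_abs.continuousAt.eventually (gt_mem_nhds (by linarith))
  filter_upwards [this] with x hx
  exact hg2 _ (by rw [line_re]; exact h1) (by rw [line_re]; exact h2) (by rw [line_im]; exact hx)
    (zf_ne hRH _ (by rw [line_re]; linarith) (by rw [line_re]; exact h3))

lemma expK_cont (Y t c : ℝ) (h1 : -1 < c) (h2 : c < 1) :
    Continuous (fun τ : ℝ => Complex.exp (((c:ℂ) + τ * I) * Y) * Kt t (c + τ * I)) := by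
  refine Continuous.mul (by fun_prop) ?_
  unfold Kt
  refine Continuous.div (by fun_prop) (by fun_prop) fun τ => Kt_den t _ ?_ ?_
  · rw [line_re]; exact h1
  · rw [line_re]; exact h2

lemma Ph_cont (hRH : RiemannHypothesis) (c : ℝ) (h1 : -1/10 ≤ c) (h3 : c ≠ 0) :
    Continuous (fun τ : ℝ => Ph (c + τ * I)) := by
  have hd : Continuous (deriv zf) := (zf_diff.contDiff (n := 1)).continuous_deriv le_rfl
  have hz : Continuous zf := zf_diff.continuous
  unfold Ph
  refine Continuous.div (by fun_prop) (by fun_prop) fun τ => zf_ne hRH _ ?_ ?_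
  · rw [line_re]; linarith
  · rw [line_re]; exact h3

lemma Fc_int (hRH : RiemannHypothesis) (Y t c : ℝ) (h1 : -1/10 ≤ c) (h2 : c ≤ 3/4) (h3 : c ≠ 0) :
    Integrable (fun τ : ℝ => Fc Y t (c + τ * I)) := by
  obtain ⟨C, hC, hb⟩ := Fc_bound hRH Y t
  refine (int_916.const_mul C).mono' ?_ (Eventually.of_forall fun τ => ?_)
  · exact ((PhPz_cont hRH c h1 (by linarith) h3).mul (expK_cont Y t c (by linarith) (by linarith))).aestronglyMeasurable
  · have := hb (c + τ * I) (by rw [line_re]; exact h1) (by rw [line_re]; exact h2)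
      (zf_ne hRH _ (by rw [line_re]; linarith) (by rw [line_re]; exact h3))
    rwa [line_im] at this

lemma good_height (n : ℕ) : ∃ H : ℝ, (n:ℝ) < H ∧ H < n + 1 ∧ ∀ γ : ZZ, (γ:ℝ) ≠ H ∧ (γ:ℝ) ≠ -H := by
  have hc : (Set.range (fun γ : ZZ => (γ:ℝ)) ∪ Set.range (fun γ : ZZ => -(γ:ℝ))).Countable :=
    (Set.countable_range _).union (Set.countable_range _)
  obtain ⟨H, hH1, hH2⟩ := (hc.dense_compl ℝ).exists_mem_open (isOpen_Ioo (a := (n:ℝ)) (b := n + 1)) ⟨n + 1/2, by constructor <;> linarith⟩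
  refine ⟨H, hH2.1, hH2.2, fun γ => ⟨fun h => hH1 (Or.inl ⟨γ, h⟩), fun h => hH1 (Or.inr ⟨γ, ?_⟩)⟩⟩
  simp [h]

theorem contour_shift (hRH : RiemannHypothesis) (Y t : ℝ) :
    ∫ τ : ℝ, Fc Y t (((3/4 : ℝ):ℂ) + τ * I) = ∫ τ : ℝ, Fc Y t (((-1/10 : ℝ):ℂ) + τ * I) := by
  choose H hH1 hH2 hH3 using good_height
  obtain ⟨C, hC, hb⟩ := Fc_bound hRH Y t
  have hHt : Tendsto H atTop atTop := tendsto_atTop_mono (fun n => (hH1 n).le) tendsto_natCast_atTop_atTop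
  have hHn : Tendsto (fun n => -H n) atTop atBot := tendsto_neg_atTop_atBot.comp hHt
  have L1 := intervalIntegral_tendsto_integral (Fc_int hRH Y t (3/4) (by norm_num) (by norm_num) (by norm_num)) hHn hHt
  have L2 := intervalIntegral_tendsto_integral (Fc_int hRH Y t (-1/10) (by norm_num) (by norm_num) (by norm_num)) hHn hHt
  have hzero : Tendsto (fun n => C * (1 + (H n) ^ 2) ^ (-(9/16) : ℝ) * |(3/4 : ℝ) - (-1/10)|) atTop (𝓝 0) := by
    have h1 : Tendsto (fun n => 1 + (H n) ^ 2) atTop atTop :=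
      tendsto_atTop_add_const_left _ _ ((tendsto_pow_atTop (by norm_num)).comp hHt)
    have h2 := (tendsto_rpow_neg_atTop (y := 9/16) (by norm_num)).comp h1
    have h3 := (h2.const_mul C).mul_const |(3/4 : ℝ) - (-1/10)|
    simpa using h3
  -- horizontal pieces
  have hor : ∀ n, ∀ y : ℝ, (y = H n ∨ y = -H n) →
      ‖∫ x : ℝ in (-1/10:ℝ)..(3/4), Fc Y t (x + y * I)‖ ≤ C * (1 + (H n) ^ 2) ^ (-(9/16) : ℝ) * |(3/4 : ℝ) - (-1/10)| := by
    intro n y hy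
    apply intervalIntegral.norm_integral_le_of_norm_le_const
    intro x hx
    rw [uIoc_of_le (by norm_num)] at hx
    have h1 : -1/10 ≤ ((x:ℂ) + y * I).re := by rw [line_re]; exact hx.1.le
    have h2 : ((x:ℂ) + y * I).re ≤ 3/4 := by rw [line_re]; exact hx.2
    have h0 := zf_ne' hRH ((x:ℂ) + y * I) (by linarith) (by
      intro γ h
      have := congrArg Complex.im h
      rw [line_im] at this
      simp at this
      rcases hy with hy | hy
      · exact (hH3 n γ).1 (by rw [← this, hy])
      · exact (hH3 n γ).2 (by rw [← this, hy]))
    have h3 := hb _ h1 h2 h0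
    rw [line_im] at h3
    have : y ^ 2 = H n ^ 2 := by rcases hy with hy | hy <;> rw [hy] <;> ring
    rwa [this] at h3
  have T1 : Tendsto (fun n => ∫ x : ℝ in (-1/10:ℝ)..(3/4), Fc Y t (x + ((-H n : ℝ):ℂ) * I)) atTop (𝓝 0) :=
    squeeze_zero_norm (fun n => hor n _ (Or.inr rfl)) hzero
  have T2 : Tendsto (fun n => ∫ x : ℝ in (-1/10:ℝ)..(3/4), Fc Y t (x + ((H n : ℝ):ℂ) * I)) atTop (𝓝 0) :=
    squeeze_zero_norm (fun n => hor n _ (Or.inl rfl)) hzero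
  have hid : ∀ n, (∫ x : ℝ in (-1/10:ℝ)..(3/4), Fc Y t (x + ((-H n : ℝ):ℂ) * I)) - (∫ x : ℝ in (-1/10:ℝ)..(3/4), Fc Y t (x + ((H n : ℝ):ℂ) * I))
     + I • (∫ τ : ℝ in (-H n)..(H n), Fc Y t (((3/4 : ℝ):ℂ) + τ * I)) - I • (∫ τ : ℝ in (-H n)..(H n), Fc Y t (((-1/10 : ℝ):ℂ) + τ * I)) = 0 := by
    intro n
    have hHpos : 0 < H n := lt_of_le_of_lt (Nat.cast_nonneg n) (hH1 n)
    obtain ⟨g, hg1, hg2⟩ := q_analytic hRH (H n)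
    set f : ℂ → ℂ := fun s => g s * (Complex.exp (s * Y) * Kt t s) with hf
    have hC := Complex.integral_boundary_rect_eq_zero_of_differentiableOn f (((-1/10:ℝ):ℂ) + ((-H n : ℝ):ℂ) * I) (((3/4:ℝ):ℂ) + ((H n : ℝ):ℂ) * I) ?_
    · simp only [line_re, line_im] at hC
      rw [← hC]
      have agree : ∀ s : ℂ, -1/10 ≤ s.re → s.re ≤ 3/4 → |s.im| ≤ H n → zf (1/2 + s) ≠ 0 → Fc Y t s = f s := by
        intro s h1 h2 h3 h0
        rw [hf]; simp only; rw [hg2 s h1 (by linarith) (by linarith) h0]; rfl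
      have horeq : ∀ y : ℝ, (y = H n ∨ y = -H n) → (∫ x : ℝ in (-1/10:ℝ)..(3/4), Fc Y t (x + (y:ℂ) * I)) = ∫ x : ℝ in (-1/10:ℝ)..(3/4), f (x + (y:ℂ) * I) := by
        intro y hy
        apply intervalIntegral.integral_congr
        intro x hx
        rw [uIcc_of_le (by norm_num)] at hx
        refine agree _ (by rw [line_re]; exact hx.1) (by rw [line_re]; exact hx.2) ?_ (zf_ne' hRH _ (by rw [line_re]; linarith [hx.1]) ?_)
        · rw [line_im]; rcases hy with hy | hy <;> rw [hy]
          · rw [abs_of_pos hHpos]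
          · rw [abs_neg, abs_of_pos hHpos]
        · intro γ h
          have := congrArg Complex.im h
          rw [line_im] at this
          simp at this
          rcases hy with hy | hy
          · exact (hH3 n γ).1 (by rw [← this, hy])
          · exact (hH3 n γ).2 (by rw [← this, hy])
      have vereq : ∀ c : ℝ, -1/10 ≤ c → c ≤ 3/4 → c ≠ 0 → (∫ τ : ℝ in (-H n)..(H n), Fc Y t ((c:ℂ) + τ * I)) = ∫ τ : ℝ in (-H n)..(H n), f ((c:ℂ) + τ * I) := by
        intro c h1 h2 h3
        apply intervalIntegral.integral_congr
        intro τ hτ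
        rw [uIcc_of_le (by linarith)] at hτ
        refine agree _ (by rw [line_re]; exact h1) (by rw [line_re]; exact h2) (by rw [line_im]; exact abs_le.2 hτ)
          (zf_ne hRH _ (by rw [line_re]; linarith) (by rw [line_re]; exact h3))
      rw [horeq _ (Or.inl rfl), horeq _ (Or.inr rfl), vereq _ (by norm_num) (by norm_num) (by norm_num), vereq _ (by norm_num) (by norm_num) (by norm_num)]
    · simp only [line_re, line_im]
      rw [uIcc_of_le (by norm_num), uIcc_of_le (by linarith)]
      intro s hs
      obtain ⟨hs1, hs2⟩ := Complex.mem_reProdIm.1 hs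
      have ho : IsOpen {s : ℂ | -1/5 < s.re ∧ s.re < 1 ∧ |s.im| < H n + 1} := by
        have h1 : IsOpen {s : ℂ | -1/5 < s.re} := isOpen_lt continuous_const Complex.continuous_re
        have h2 : IsOpen {s : ℂ | s.re < 1} := isOpen_lt Complex.continuous_re continuous_const
        have h3 : IsOpen {s : ℂ | |s.im| < H n + 1} := isOpen_lt (by fun_prop) continuous_const
        exact h1.inter (h2.inter h3)
      have hgd : DifferentiableAt ℂ g s := hg1.differentiableAt (ho.mem_nhds
        ⟨by linarith [hs1.1], by linarith [hs1.2], by have := abs_le.2 hs2; linarith⟩)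
      apply DifferentiableAt.differentiableWithinAt
      refine hgd.mul (DifferentiableAt.mul (by fun_prop) ?_)
      unfold Kt
      exact DifferentiableAt.div (by fun_prop) (by fun_prop) (Kt_den t s (by linarith [hs1.1]) (by linarith [hs1.2]))
  have L := ((T1.sub T2).add (L1.const_smul I)).sub (L2.const_smul I)
  have L' := L.congr hid
  have h0 := tendsto_nhds_unique L' tendsto_const_nhds
  have h1 : I * ((∫ τ : ℝ, Fc Y t (((3/4 : ℝ):ℂ) + τ * I)) - ∫ τ : ℝ, Fc Y t (((-1/10 : ℝ):ℂ) + τ * I)) = 0 := by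
    rw [smul_eq_mul, smul_eq_mul] at h0
    linear_combination h0
  exact sub_eq_zero.1 ((mul_eq_zero.1 h1).resolve_left I_ne_zero)

end ModE3

section ModE4
open Complex Filter MeasureTheory Real Set
open scoped Topology FourierTransform
def kap (t v : ℝ) : ℂ := Complex.exp (((-|v| : ℝ) : ℂ) - I * t * v)

lemma kap_cont (t : ℝ) : Continuous (kap t) := by unfold kap; fun_prop

lemma kap_norm (t v : ℝ) : ‖kap t v‖ = Real.exp (-|v|) := by
  unfold kap; rw [Complex.norm_exp]; simp

lemma kap_laplace (t : ℝ) (s : ℂ) (h1 : -1 < s.re) (h2 : s.re < 1) :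
    Integrable (fun v : ℝ => kap t v * Complex.exp (s * v)) ∧ ∫ v : ℝ, kap t v * Complex.exp (s * v) = Kt t s := by
  have ha : (s - t * I - 1).re < 0 := by simp; linarith
  have hb : 0 < (s - t * I + 1).re := by simp; linarith
  have e1 : EqOn (fun v : ℝ => Complex.exp ((s - t * I - 1) * v)) (fun v : ℝ => kap t v * Complex.exp (s * v)) (Ioi 0) := by
    intro v hv
    have hv' : |v| = v := abs_of_pos hv
    simp only [kap, ← Complex.exp_add, hv']
    congr 1; push_cast; ring
  have e2 : EqOn (fun v : ℝ => Complex.exp ((s - t * I + 1) * v)) (fun v : ℝ => kap t v * Complex.exp (s * v)) (Iic 0) := by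
    intro v hv
    have hv' : |v| = -v := abs_of_nonpos hv
    simp only [kap, ← Complex.exp_add, hv']
    congr 1; push_cast; ring
  have i1 := (integrableOn_exp_mul_complex_Ioi ha 0).congr_fun e1 measurableSet_Ioi
  have i2 := (integrableOn_exp_mul_complex_Iic hb 0).congr_fun e2 measurableSet_Iic
  have hIntg : Integrable (fun v : ℝ => kap t v * Complex.exp (s * v)) := by
    rw [← integrableOn_univ, ← Iic_union_Ioi (a := (0:ℝ))]
    exact i2.union i1
  refine ⟨hIntg, ?_⟩
  rw [← intervalIntegral.integral_Iic_add_Ioi i2 i1,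
    ← setIntegral_congr_fun measurableSet_Ioi e1, ← setIntegral_congr_fun measurableSet_Iic e2,
    integral_exp_mul_complex_Ioi ha, integral_exp_mul_complex_Iic hb]
  have ha' : s - t * I - 1 ≠ 0 := fun h => by rw [h] at ha; simp at ha
  have hb' : s - t * I + 1 ≠ 0 := fun h => by rw [h] at hb; simp at hb
  have hd := Kt_den t s h1 h2
  unfold Kt
  simp only [ofReal_zero, mul_zero, Complex.exp_zero]
  rw [div_add_div _ _ hb' ha', div_eq_div_iff (mul_ne_zero hb' ha') hd]
  ring

lemma inv_sq_int : Integrable (fun τ : ℝ => (1 + τ ^ 2)⁻¹) := integrable_inv_one_add_sq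

lemma expK_int (Y t c : ℝ) (h1 : -1/10 ≤ c) (h2 : c ≤ 3/4) :
    Integrable (fun τ : ℝ => Complex.exp (((c:ℂ) + τ * I) * Y) * Kt t (c + τ * I)) := by
  obtain ⟨C, hC, hb⟩ := expK_bound Y t
  refine (inv_sq_int.const_mul C).mono' (expK_cont Y t c (by linarith) (by linarith)).aestronglyMeasurable
    (Eventually.of_forall fun τ => ?_)
  have := hb (c + τ * I) (by rw [line_re]; exact h1) (by rw [line_re]; exact h2)
  rwa [line_im] at this

lemma kap_inversion (t c v : ℝ) (h1 : -1/10 ≤ c) (h2 : c ≤ 3/4) :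
    ∫ τ : ℝ, Complex.exp (-((c:ℂ) + τ * I) * v) * Kt t (c + τ * I) = 2 * π * kap t v := by
  set f : ℝ → ℂ := fun v => kap t v * Complex.exp ((c:ℂ) * v) with hf
  have hfi : Integrable f := (kap_laplace t c (by simp; linarith) (by simp; linarith)).1
  have hfc : Continuous f := by
    have := kap_cont t
    rw [hf]; fun_prop
  have hF : ∀ w : ℝ, 𝓕 f w = Kt t ((c:ℂ) + ((-(2 * π)) * w : ℝ) * I) := by
    intro w
    rw [Real.fourier_eq', ← (kap_laplace t ((c:ℂ) + ((-(2 * π)) * w : ℝ) * I) (by rw [line_re]; linarith) (by rw [line_re]; linarith)).2]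
    congr 1
    ext v
    simp only [hf, smul_eq_mul, RCLike.inner_apply, conj_trivial]
    rw [mul_left_comm, ← Complex.exp_add]
    congr 2; push_cast; ring
  have hK0 : Integrable (fun τ : ℝ => Kt t ((c:ℂ) + τ * I)) := by
    have := expK_int 0 t c h1 h2
    simpa using this
  have hFi : Integrable (𝓕 f) := by
    have := hK0.comp_mul_left' (R := -(2 * π)) (by simp [Real.pi_ne_zero])
    exact this.congr (Eventually.of_forall fun w => (hF w).symm)
  have inv := Integrable.fourierInv_fourier_eq hfi hFi (v := v) hfc.continuousAt
  rw [Real.fourierInv_eq'] at inv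
  have e : ∀ w : ℝ, Complex.exp (((2 * π * inner ℝ w v : ℝ) : ℂ) * I) • 𝓕 f w =
      (fun τ : ℝ => Complex.exp (-(τ * I) * v) * Kt t ((c:ℂ) + τ * I)) (-(2 * π) * w) := by
    intro w
    rw [hF]
    simp only [smul_eq_mul, RCLike.inner_apply, conj_trivial]
    congr 2; push_cast; ring
  rw [integral_congr_ae (Eventually.of_forall e), Measure.integral_comp_mul_left (fun τ : ℝ => Complex.exp (-(τ * I) * v) * Kt t ((c:ℂ) + τ * I)) (-(2 * π))] at inv
  have habs : |(-(2 * π))⁻¹| = (2 * π)⁻¹ := by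
    rw [abs_inv, abs_neg, abs_of_pos (by positivity)]
  rw [habs] at inv
  have e2 : ∀ τ : ℝ, Complex.exp (-((c:ℂ) + τ * I) * v) * Kt t (c + τ * I) =
      Complex.exp (-(c:ℂ) * v) * (Complex.exp (-(τ * I) * v) * Kt t ((c:ℂ) + τ * I)) := by
    intro τ
    rw [← mul_assoc, ← Complex.exp_add]; congr 2; ring
  simp_rw [e2]
  rw [integral_const_mul]
  have inv2 : ∫ τ : ℝ, Complex.exp (-(τ * I) * v) * Kt t ((c:ℂ) + τ * I) = 2 * π * f v := by
    rw [← inv, Complex.real_smul]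
    push_cast
    have : (2 * π:ℂ) ≠ 0 := by exact_mod_cast (by positivity : 2 * π ≠ 0)
    rw [← mul_assoc, mul_inv_cancel₀ this, one_mul]
  rw [inv2, hf]
  simp only
  have : Complex.exp (-(c:ℂ) * v) * Complex.exp ((c:ℂ) * v) = 1 := by
    rw [← Complex.exp_add]; simp
  linear_combination (2 * π * kap t v) * this

/-- Fubini with a one-sided exponential. -/
lemma fub (Y t c : ℝ) (h1 : -1/10 ≤ c) (h2 : c ≤ 3/4) (z : ℂ) (D : Set ℝ)
    (hi : IntegrableOn (fun u : ℝ => Complex.exp ((z - c) * u)) D) :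
    ∫ τ : ℝ, (Complex.exp (((c:ℂ) + τ * I) * Y) * Kt t (c + τ * I)) * (∫ u in D, Complex.exp ((z - (c + τ * I)) * u))
      = 2 * π * ∫ u in D, Complex.exp (z * u) * kap t (u - Y) := by
  have hE := expK_int Y t c h1 h2
  simp_rw [← integral_const_mul]
  rw [integral_integral_swap]
  · congr 1
    ext u
    have h3 := kap_inversion t c (u - Y) h1 h2
    have e : ∀ τ : ℝ, (Complex.exp (((c:ℂ) + τ * I) * Y) * Kt t (c + τ * I)) * Complex.exp ((z - (c + τ * I)) * u)
        = Complex.exp (z * u) * (Complex.exp (-((c:ℂ) + τ * I) * ((u - Y : ℝ) : ℂ)) * Kt t (c + τ * I)) := by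
      intro τ
      have : Complex.exp (((c:ℂ) + τ * I) * Y) * Complex.exp ((z - (c + τ * I)) * u) = Complex.exp (z * u) * Complex.exp (-((c:ℂ) + τ * I) * ((u - Y : ℝ) : ℂ)) := by
        rw [← Complex.exp_add, ← Complex.exp_add]; congr 1; push_cast; ring
      linear_combination Kt t (c + τ * I) * this
    simp_rw [e]
    rw [integral_const_mul, h3]; ring
  · have hp := hE.mul_prod hi
    refine hp.mono ?_ (Eventually.of_forall fun p => ?_)
    · apply Continuous.aestronglyMeasurable
      have h4 := expK_cont Y t c (by linarith) (by linarith)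
      have h5 : Continuous (fun p : ℝ × ℝ => Complex.exp (((c:ℂ) + p.1 * I) * Y) * Kt t (c + p.1 * I)) := h4.comp continuous_fst
      exact h5.mul (by fun_prop)
    · simp only [Function.uncurry]
      rw [norm_mul, norm_mul (Complex.exp (((c:ℂ) + p.1 * I) * Y) * Kt t (c + p.1 * I))]
      apply le_of_eq
      congr 1
      rw [Complex.norm_exp, Complex.norm_exp]
      congr 1
      simp

lemma line_right (Y t c : ℝ) (h1 : -1/10 ≤ c) (h2 : c ≤ 3/4) (z : ℂ) (hz : z.re < c) :
    ∫ τ : ℝ, (Complex.exp (((c:ℂ) + τ * I) * Y) * Kt t (c + τ * I)) * (1 / ((c + τ * I) - z))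
      = 2 * π * ∫ u in Ioi (0:ℝ), Complex.exp (z * u) * kap t (u - Y) := by
  rw [← fub Y t c h1 h2 z (Ioi 0) (integrableOn_exp_mul_complex_Ioi (by simpa using hz) 0)]
  congr 1; ext τ
  rw [integral_exp_mul_complex_Ioi (by simpa using hz)]
  simp only [ofReal_zero, mul_zero, Complex.exp_zero]
  congr 1
  rw [neg_div, ← div_neg, neg_sub]

lemma line_left (Y t c : ℝ) (h1 : -1/10 ≤ c) (h2 : c ≤ 3/4) (z : ℂ) (hz : c < z.re) :
    ∫ τ : ℝ, (Complex.exp (((c:ℂ) + τ * I) * Y) * Kt t (c + τ * I)) * (1 / ((c + τ * I) - z))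
      = -(2 * π * ∫ u in Iic (0:ℝ), Complex.exp (z * u) * kap t (u - Y)) := by
  rw [← fub Y t c h1 h2 z (Iic 0) (integrableOn_exp_mul_complex_Iic (by simpa using hz) 0), ← integral_neg]
  congr 1; ext τ
  rw [integral_exp_mul_complex_Iic (by simpa using hz)]
  simp only [ofReal_zero, mul_zero, Complex.exp_zero]
  rw [← mul_neg, ← div_neg, neg_sub]

lemma line_const (Y t c : ℝ) (h1 : -1/10 ≤ c) (h2 : c ≤ 3/4) :
    ∫ τ : ℝ, (Complex.exp (((c:ℂ) + τ * I) * Y) * Kt t (c + τ * I)) = 2 * π * kap t (-Y) := by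
  rw [← kap_inversion t c (-Y) h1 h2]
  congr 1; ext τ; congr 2; push_cast; ring

lemma pt_int (Y t c : ℝ) (h1 : -1/10 ≤ c) (h2 : c ≤ 3/4) (h3 : 1/10 ≤ |c|) (γ : ℝ) :
    Integrable (fun τ : ℝ => (Complex.exp (((c:ℂ) + τ * I) * Y) * Kt t (c + τ * I)) * (1 / ((c + τ * I) - γ * I))) := by
  refine (expK_int Y t c h1 h2).mul_bdd (c := 10) ?_ (Eventually.of_forall fun τ => ?_)
  · apply Continuous.aestronglyMeasurable
    refine Continuous.div (by fun_prop) (by fun_prop) fun τ h => ?_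
    have := congrArg Complex.re h
    simp at this; rw [this] at h3; norm_num at h3
  · have := Complex.abs_re_le_norm (((c:ℂ) + τ * I) - γ * I)
    simp at this
    rw [norm_div, norm_one, div_le_iff₀ (by linarith)]
    linarith

/-- Contribution of one zero. -/
lemma zero_diff (Y t γ : ℝ) :
    (∫ τ : ℝ, pt (((3/4:ℝ):ℂ) + τ * I) γ * (Complex.exp ((((3/4:ℝ):ℂ) + τ * I) * Y) * Kt t (((3/4:ℝ):ℂ) + τ * I)))
    - (∫ τ : ℝ, pt (((-1/10:ℝ):ℂ) + τ * I) γ * (Complex.exp ((((-1/10:ℝ):ℂ) + τ * I) * Y) * Kt t (((-1/10:ℝ):ℂ) + τ * I)))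
    = 2 * π * (Complex.exp (γ * I * Y) * (2 / (1 + (t - γ) ^ 2 : ℝ) : ℝ)) := by
  have key : ∀ c : ℝ, -1/10 ≤ c → c ≤ 3/4 → 1/10 ≤ |c| →
      ∫ τ : ℝ, pt ((c:ℂ) + τ * I) γ * (Complex.exp (((c:ℂ) + τ * I) * Y) * Kt t ((c:ℂ) + τ * I)) =
      (∫ τ : ℝ, (Complex.exp (((c:ℂ) + τ * I) * Y) * Kt t (c + τ * I)) * (1 / ((c + τ * I) - γ * I))) - (2 * π * kap t (-Y)) * (1 / (1 - γ * I)) := by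
    intro c h1 h2 h3
    rw [← line_const Y t c h1 h2, ← integral_mul_const, ← integral_sub (pt_int Y t c h1 h2 h3 γ) ((expK_int Y t c h1 h2).mul_const _)]
    congr 1; ext τ; unfold pt; ring
  rw [key _ (by norm_num) (by norm_num) (by rw [abs_of_pos (by norm_num)]; norm_num), key _ (by norm_num) (by norm_num) (by rw [abs_of_neg (by norm_num)]; norm_num),
    line_right Y t _ (by norm_num) (by norm_num) (γ * I) (by simp), line_left Y t _ (by norm_num) (by norm_num) (γ * I) (by simp; norm_num)]
  have hL := kap_laplace t (γ * I) (by simp) (by simp)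
  have hs : ∫ u : ℝ, Complex.exp (γ * I * u) * kap t (u - Y) = Complex.exp (γ * I * Y) * Kt t (γ * I) := by
    rw [← hL.2, ← integral_const_mul, ← integral_sub_right_eq_self (fun v : ℝ => Complex.exp (γ * I * Y) * (kap t v * Complex.exp (γ * I * v))) Y]
    congr 1; ext u
    have h : Complex.exp (γ * I * Y) * Complex.exp (γ * I * ((u - Y : ℝ):ℂ)) = Complex.exp (γ * I * u) := by
      rw [← Complex.exp_add]; congr 1; push_cast; ring
    linear_combination -kap t (u - Y) * h
  have hsi : Integrable (fun u : ℝ => Complex.exp (γ * I * u) * kap t (u - Y)) := by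
    have := (hL.1.comp_sub_right Y).const_mul (Complex.exp (γ * I * Y))
    refine this.congr (Eventually.of_forall fun u => ?_)
    have h : Complex.exp (γ * I * Y) * Complex.exp (γ * I * ((u - Y : ℝ):ℂ)) = Complex.exp (γ * I * u) := by
      rw [← Complex.exp_add]; congr 1; push_cast; ring
    simp only
    linear_combination kap t (u - Y) * h
  have hsplit := intervalIntegral.integral_Iic_add_Ioi (hsi.integrableOn (s := Iic 0)) (hsi.integrableOn (s := Ioi 0))
  have hKt : Kt t (γ * I) = ((2 / (1 + (t - γ) ^ 2 : ℝ) : ℝ) : ℂ) := by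
    unfold Kt; push_cast
    congr 1
    have : ((γ:ℂ) * I - t * I) ^ 2 = (γ - t) ^ 2 * I ^ 2 := by ring
    rw [this, I_sq]; ring
  rw [← hKt, ← hs, ← hsplit]; ring

end ModE4

section ModE5
open Complex Filter MeasureTheory Real Set
open scoped Topology
lemma wt_int : Integrable wt := by
  have := integrable_rpow_neg_one_add_norm_sq (E := ℝ) (μ := volume) (r := 5/4) (by norm_num)
  refine this.congr (Eventually.of_forall fun τ => ?_)
  simp only [Real.norm_eq_abs, sq_abs, wt]
  norm_num

lemma wt_conv (τ γ : ℝ) : wt τ * wt (τ - γ) ≤ 4 * wt γ * (wt τ + wt (τ - γ)) := by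
  have h4 : (4:ℝ) ^ (5/8 : ℝ) ≤ 4 := by
    calc (4:ℝ) ^ (5/8 : ℝ) ≤ 4 ^ (1:ℝ) := Real.rpow_le_rpow_of_exponent_le (by norm_num) (by norm_num)
      _ = 4 := Real.rpow_one 4
  have p1 := wt_pos τ
  have p2 := wt_pos (τ - γ)
  have p3 := wt_pos γ
  by_cases h : (τ - γ) ^ 2 ≤ τ ^ 2
  · have h1 := wt_le_of τ γ 4 (by norm_num) (by nlinarith [sq_nonneg (2 * τ - γ)])
    have h2 : wt τ ≤ 4 * wt γ := h1.trans (by gcongr)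
    nlinarith [mul_pos p3 p1]
  · have h1 := wt_le_of (τ - γ) γ 4 (by norm_num) (by nlinarith [sq_nonneg (2 * τ - γ)])
    have h2 : wt (τ - γ) ≤ 4 * wt γ := h1.trans (by gcongr)
    nlinarith [mul_pos p3 p2]

lemma ptK_int (Y t c : ℝ) (h1 : -1/10 ≤ c) (h2 : c ≤ 3/4) (h3 : 1/10 ≤ |c|) (γ : ℝ) :
    Integrable (fun τ : ℝ => pt ((c:ℂ) + τ * I) γ * (Complex.exp (((c:ℂ) + τ * I) * Y) * Kt t ((c:ℂ) + τ * I))) := by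
  refine ((pt_int Y t c h1 h2 h3 γ).sub ((expK_int Y t c h1 h2).mul_const (1 / (1 - γ * I)))).congr
    (Eventually.of_forall fun τ => ?_)
  simp only [Pi.sub_apply]; unfold pt; ring

lemma ptK_norm (Y t : ℝ) : ∃ C : ℝ, 0 < C ∧ ∀ c : ℝ, -1/10 ≤ c → c ≤ 3/4 → 1/10 ≤ |c| → ∀ γ : ℝ,
    ∫ τ : ℝ, ‖pt ((c:ℂ) + τ * I) γ * (Complex.exp (((c:ℂ) + τ * I) * Y) * Kt t ((c:ℂ) + τ * I))‖ ≤ C * wt γ := by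
  obtain ⟨C, hC, hb⟩ := expK_bound Y t
  set W := ∫ τ, wt τ with hW
  have hW0 : 0 ≤ W := integral_nonneg fun τ => (wt_pos τ).le
  refine ⟨40 * C * 9 * (W + 1), by positivity, fun c h1 h2 h3 γ => ?_⟩
  have hwγ := wt_int.comp_sub_right γ
  have hmaj : Integrable (fun τ => 40 * C * (9 * wt γ) * (wt τ + wt (τ - γ)) / 2 + 40 * C * (9 * wt γ) * (wt τ + wt (τ - γ)) / 2) :=
    (((wt_int.add hwγ).const_mul _).div_const _).add (((wt_int.add hwγ).const_mul _).div_const _)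
  have hpt : ∀ τ : ℝ, ‖pt ((c:ℂ) + τ * I) γ * (Complex.exp (((c:ℂ) + τ * I) * Y) * Kt t ((c:ℂ) + τ * I))‖ ≤
      40 * C * wt γ * (5 * wt τ + 4 * wt (τ - γ)) := by
    intro τ
    have a1 := pt_bound ((c:ℂ) + τ * I) γ (by rw [line_re]; linarith) (by rw [line_re]; linarith) (Or.inl (by rw [line_re]; exact h3))
    have a2 := hb ((c:ℂ) + τ * I) (by rw [line_re]; exact h1) (by rw [line_re]; exact h2)
    rw [line_im] at a1 a2
    rw [norm_mul]
    have e : (1 + τ ^ 2) ^ (3/8 : ℝ) * (1 + τ ^ 2)⁻¹ = wt τ := by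
      unfold wt
      rw [← Real.rpow_neg_one, ← Real.rpow_add (by positivity)]; norm_num
    have p1 := wt_pos τ
    have p2 := wt_pos (τ - γ)
    have p3 := wt_pos γ
    calc _ ≤ (40 * (1 + τ ^ 2) ^ (3/8 : ℝ) * (wt (τ - γ) + wt γ)) * (C * (1 + τ ^ 2)⁻¹) := by gcongr
      _ = 40 * C * (wt τ * wt (τ - γ) + wt τ * wt γ) := by rw [← e]; ring
      _ ≤ 40 * C * (4 * wt γ * (wt τ + wt (τ - γ)) + wt τ * wt γ) := by
          have := wt_conv τ γ
          exact mul_le_mul_of_nonneg_left (by linarith) (by positivity)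
      _ = _ := by ring
  calc _ ≤ ∫ τ, 40 * C * wt γ * (5 * wt τ + 4 * wt (τ - γ)) := by
        refine integral_mono (ptK_int Y t c h1 h2 h3 γ).norm ?_ hpt
        exact ((wt_int.const_mul 5).add (hwγ.const_mul 4)).const_mul _
    _ = 40 * C * wt γ * (5 * W + 4 * W) := by
        rw [integral_const_mul, integral_add (wt_int.const_mul 5) (hwγ.const_mul 4), integral_const_mul, integral_const_mul,
          integral_sub_right_eq_self wt γ]
    _ ≤ _ := by
        have p3 := wt_pos γ
        nlinarith [mul_pos hC p3]

lemma Pz_swap (Y t c : ℝ) (h1 : -1/10 ≤ c) (h2 : c ≤ 3/4) (h3 : 1/10 ≤ |c|) :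
    HasSum (fun γ : ZZ => (mz γ : ℂ) * ∫ τ : ℝ, pt ((c:ℂ) + τ * I) γ * (Complex.exp (((c:ℂ) + τ * I) * Y) * Kt t ((c:ℂ) + τ * I)))
      (∫ τ : ℝ, Pz ((c:ℂ) + τ * I) * (Complex.exp (((c:ℂ) + τ * I) * Y) * Kt t ((c:ℂ) + τ * I))) := by
  obtain ⟨C, hC, hb⟩ := ptK_norm Y t
  have := hasSum_integral_of_summable_integral_norm (μ := volume)
    (F := fun (γ : ZZ) (τ : ℝ) => (mz γ : ℂ) * (pt ((c:ℂ) + τ * I) γ * (Complex.exp (((c:ℂ) + τ * I) * Y) * Kt t ((c:ℂ) + τ * I))))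
    (fun γ => (ptK_int Y t c h1 h2 h3 γ).const_mul _) ?_
  · have e : ∀ τ : ℝ, Pz ((c:ℂ) + τ * I) * (Complex.exp (((c:ℂ) + τ * I) * Y) * Kt t ((c:ℂ) + τ * I)) =
        ∑' γ : ZZ, (mz γ : ℂ) * (pt ((c:ℂ) + τ * I) γ * (Complex.exp (((c:ℂ) + τ * I) * Y) * Kt t ((c:ℂ) + τ * I))) := by
      intro τ
      unfold Pz
      rw [← tsum_mul_right]
      congr 1; ext γ; ring
    simp_rw [e]
    simp_rw [integral_const_mul] at this
    exact this
  · refine Summable.of_nonneg_of_le (fun γ => integral_nonneg fun _ => norm_nonneg _) (fun γ => ?_) (zz_w0.mul_left C)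
    simp_rw [norm_mul (mz γ : ℂ), Complex.norm_natCast]
    rw [integral_const_mul]
    have := hb c h1 h2 h3 γ
    calc _ ≤ (mz γ : ℝ) * (C * wt γ) := by gcongr
      _ = _ := by ring

/-- the zero sum -/
def Zs (Y t : ℝ) : ℂ := ∑' γ : ZZ, (mz γ : ℂ) * (Complex.exp ((γ:ℝ) * I * Y) * (2 / (1 + (t - γ) ^ 2 : ℝ) : ℝ))

lemma PhK_int (hRH : RiemannHypothesis) (Y t c : ℝ) (h1 : -1/10 ≤ c) (h2 : c ≤ 3/4) (h3 : 1/10 ≤ |c|) :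
    Integrable (fun τ : ℝ => Ph ((c:ℂ) + τ * I) * (Complex.exp (((c:ℂ) + τ * I) * Y) * Kt t ((c:ℂ) + τ * I))) := by
  obtain ⟨C1, hC1, hp⟩ := phi_line hRH
  obtain ⟨C, hC, hb⟩ := expK_bound Y t
  have hc0 : c ≠ 0 := by rintro rfl; norm_num at h3
  refine (int_916.const_mul (C1 * 32 * C)).mono' ((Ph_cont hRH c h1 hc0).mul (expK_cont Y t c (by linarith) (by linarith))).aestronglyMeasurable
    (Eventually.of_forall fun τ => ?_)
  have a1 := hp ((c:ℂ) + τ * I) (by rw [line_re]; linarith) (by rw [line_re]; linarith) (by rw [line_re]; exact h3)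
  have a2 := hb ((c:ℂ) + τ * I) (by rw [line_re]; exact h1) (by rw [line_re]; exact h2)
  rw [line_im] at a1 a2
  rw [norm_mul]
  have hl := Lg_rpow τ
  have hl0 := Lg_half τ
  have hq : (1 + τ ^ 2) ^ (1/16 : ℝ) * (1 + τ ^ 2)⁻¹ ≤ (1 + τ ^ 2) ^ (-(9/16) : ℝ) := by
    rw [← Real.rpow_neg_one, ← Real.rpow_add (by positivity)]
    exact Real.rpow_le_rpow_of_exponent_le (by nlinarith [sq_nonneg τ]) (by norm_num)
  calc _ ≤ (C1 * (32 * (1 + τ ^ 2) ^ (1/16 : ℝ))) * (C * (1 + τ ^ 2)⁻¹) := by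
        gcongr; exact a1.trans (by gcongr)
    _ = C1 * 32 * C * ((1 + τ ^ 2) ^ (1/16 : ℝ) * (1 + τ ^ 2)⁻¹) := by ring
    _ ≤ _ := by gcongr

lemma Ph_contour (hRH : RiemannHypothesis) (Y t : ℝ) :
    (∫ τ : ℝ, Ph (((3/4:ℝ):ℂ) + τ * I) * (Complex.exp ((((3/4:ℝ):ℂ) + τ * I) * Y) * Kt t (((3/4:ℝ):ℂ) + τ * I)))
    - (∫ τ : ℝ, Ph (((-1/10:ℝ):ℂ) + τ * I) * (Complex.exp ((((-1/10:ℝ):ℂ) + τ * I) * Y) * Kt t (((-1/10:ℝ):ℂ) + τ * I)))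
    = 2 * π * Zs Y t := by
  have n1 : 1/10 ≤ |(3/4:ℝ)| := by rw [abs_of_pos (by norm_num)]; norm_num
  have n2 : 1/10 ≤ |(-1/10:ℝ)| := by rw [abs_of_neg (by norm_num)]; norm_num
  have s1 := Pz_swap Y t (3/4) (by norm_num) (by norm_num) n1
  have s2 := Pz_swap Y t (-1/10) (by norm_num) (by norm_num) n2
  have s3 := s1.sub s2
  simp_rw [← mul_sub, zero_diff] at s3
  have key : ∀ c : ℝ, -1/10 ≤ c → c ≤ 3/4 → 1/10 ≤ |c| → ∫ τ : ℝ, Fc Y t ((c:ℂ) + τ * I) =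
      (∫ τ : ℝ, Ph ((c:ℂ) + τ * I) * (Complex.exp (((c:ℂ) + τ * I) * Y) * Kt t ((c:ℂ) + τ * I))) -
      ∫ τ : ℝ, Pz ((c:ℂ) + τ * I) * (Complex.exp (((c:ℂ) + τ * I) * Y) * Kt t ((c:ℂ) + τ * I)) := by
    intro c h1 h2 h3
    have hc0 : c ≠ 0 := by rintro rfl; norm_num at h3
    have i1 := PhK_int hRH Y t c h1 h2 h3
    have i2 := Fc_int hRH Y t c h1 h2 hc0
    have i3 : Integrable (fun τ : ℝ => Pz ((c:ℂ) + τ * I) * (Complex.exp (((c:ℂ) + τ * I) * Y) * Kt t ((c:ℂ) + τ * I))) := by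
      refine (i1.sub i2).congr (Eventually.of_forall fun τ => ?_)
      simp only [Pi.sub_apply, Fc]; ring
    rw [← integral_sub i1 i3]
    congr 1; ext τ; simp only [Fc]; ring
  have hcs := contour_shift hRH Y t
  rw [key _ (by norm_num) (by norm_num) n1, key _ (by norm_num) (by norm_num) n2] at hcs
  have hz := s3.tsum_eq
  have : ∑' γ : ZZ, (mz γ : ℂ) * (2 * π * (Complex.exp ((γ:ℝ) * I * Y) * (2 / (1 + (t - γ) ^ 2 : ℝ) : ℝ))) = 2 * π * Zs Y t := by
    unfold Zs; rw [← tsum_mul_left]; congr 1; ext γ; ring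
  rw [← this, hz]
  linear_combination hcs

def Bf (Y t : ℝ) : ℂ := (∑' n : ℕ, (ArithmeticFunction.vonMangoldt n * (n:ℝ) ^ (-(1/2) : ℝ) : ℝ) * kap t (Real.log n - Y))
    - ∫ u in Ioi (0:ℝ), Complex.exp ((1/2 : ℂ) * u) * kap t (u - Y)

lemma Ph_right (s : ℂ) (h : s.re = 3/4) :
    HasSum (fun n : ℕ => ((ArithmeticFunction.vonMangoldt n * (n:ℝ) ^ (-(1/2) : ℝ) : ℝ):ℂ) * Complex.exp (-s * Real.log n)) (1 / (s - 1/2) - Ph s) := by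
  have hre : 1 < (1/2 + s).re := by simp [h]; norm_num
  have h1 := (ArithmeticFunction.LSeriesSummable_vonMangoldt hre).LSeriesHasSum
  rw [LSeriesHasSum] at h1
  have hne1 : (1/2 + s) ≠ 1 := by intro h; rw [h] at hre; simp at hre
  have hzne : riemannZeta (1/2 + s) ≠ 0 := riemannZeta_ne_zero_of_one_lt_re hre
  have hev : zf =ᶠ[𝓝 (1/2 + s)] fun z => (z - 1) * riemannZeta z := by
    filter_upwards [isOpen_ne.mem_nhds hne1] with z hz
    exact zf_eq hz
  have e1 : Ph s = 1 / (s - 1/2) + deriv riemannZeta (1/2 + s) / riemannZeta (1/2 + s) := by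
    unfold Ph
    rw [hev.deriv_eq, hev.eq_of_nhds]
    have hd : HasDerivAt (fun z => (z - 1) * riemannZeta z) (1 * riemannZeta (1/2 + s) + ((1/2 + s) - 1) * deriv riemannZeta (1/2 + s)) (1/2 + s) :=
      ((hasDerivAt_id _).sub_const 1).mul (differentiableAt_riemannZeta hne1).hasDerivAt
    rw [hd.deriv]
    have hs1 : (1/2 + s) - 1 ≠ 0 := sub_ne_zero.2 hne1
    have : s - 1/2 = (1/2 + s) - 1 := by ring
    rw [this]
    generalize (1/2 + s) = z at *
    field_simp
  have e2 : 1 / (s - 1/2) - Ph s = LSeries (fun n => ((ArithmeticFunction.vonMangoldt n : ℝ) : ℂ)) (1/2 + s) := by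
    rw [ArithmeticFunction.LSeries_vonMangoldt_eq_deriv_riemannZeta_div hre, e1]; ring
  rw [e2]
  refine h1.congr_fun ?_ 
  intro n
  rw [LSeries.term]
  split_ifs with hn
  · simp [hn]
  · have hn0 : (0:ℝ) < n := by positivity
    have hnc : (n:ℂ) ≠ 0 := by exact_mod_cast hn
    rw [Complex.cpow_add _ _ hnc, Complex.cpow_def_of_ne_zero hnc s, ← Complex.ofReal_natCast n, ← Complex.ofReal_log hn0.le]
    rw [neg_mul, Complex.exp_neg, Real.rpow_neg hn0.le]
    push_cast
    rw [Complex.ofReal_cpow hn0.le]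
    push_cast
    rw [mul_comm s]
    simp only [div_eq_mul_inv, mul_inv]
    ring

lemma Lambda_line (hRH : RiemannHypothesis) (Y t : ℝ) :
    ∫ τ : ℝ, Ph (((3/4:ℝ):ℂ) + τ * I) * (Complex.exp ((((3/4:ℝ):ℂ) + τ * I) * Y) * Kt t (((3/4:ℝ):ℂ) + τ * I)) = -(2 * π * Bf Y t) := by
  have n1 : 1/10 ≤ |(3/4:ℝ)| := by rw [abs_of_pos (by norm_num)]; norm_num
  set E : ℝ → ℂ := fun τ => Complex.exp ((((3/4:ℝ):ℂ) + τ * I) * Y) * Kt t (((3/4:ℝ):ℂ) + τ * I) with hE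
  have hEi : Integrable E := expK_int Y t (3/4) (by norm_num) (by norm_num)
  set a : ℕ → ℝ := fun n => ArithmeticFunction.vonMangoldt n * (n:ℝ) ^ (-(1/2) : ℝ) with ha
  have ha0 : ∀ n, 0 ≤ a n := fun n => mul_nonneg ArithmeticFunction.vonMangoldt_nonneg (by positivity)
  set F : ℕ → ℝ → ℂ := fun n τ => (a n : ℂ) * Complex.exp (-(((3/4:ℝ):ℂ) + τ * I) * Real.log n) * E τ with hFd
  have hnorm : ∀ n τ, ‖F n τ‖ = a n * Real.exp (-(3/4) * Real.log n) * ‖E τ‖ := by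
    intro n τ
    simp only [hFd]
    rw [norm_mul, norm_mul, Complex.norm_exp, Complex.norm_real, Real.norm_of_nonneg (ha0 n)]
    congr 3
    generalize Real.log (n:ℝ) = r
    simp
  have hFi : ∀ n, Integrable (F n) := by
    intro n
    refine (hEi.norm.const_mul (a n * Real.exp (-(3/4) * Real.log n))).mono' ?_ (Eventually.of_forall fun τ => (hnorm n τ).le)
    refine Continuous.aestronglyMeasurable ?_
    have := expK_cont Y t (3/4) (by norm_num) (by norm_num)
    simp only [hFd]
    exact Continuous.mul (by fun_prop) this
  have hsw := hasSum_integral_of_summable_integral_norm (μ := volume) (F := F) hFi (by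
    simp_rw [hnorm, integral_const_mul]
    refine Summable.mul_right _ ?_
    have h1 := (Ph_right ((3/4:ℝ):ℂ) (by simp)).summable.norm
    refine h1.congr fun n => ?_
    rw [norm_mul, Complex.norm_exp, Complex.norm_real, Real.norm_of_nonneg (ha0 n)]
    congr 2
    generalize Real.log (n:ℝ) = r
    simp)
  have hFint : ∀ n, ∫ τ, F n τ = 2 * π * ((a n : ℂ) * kap t (Real.log n - Y)) := by
    intro n
    have h3 := kap_inversion t (3/4) (Real.log n - Y) (by norm_num) (by norm_num)
    have e : ∀ τ : ℝ, F n τ = (a n : ℂ) * (Complex.exp (-(((3/4:ℝ):ℂ) + τ * I) * ((Real.log n - Y : ℝ) : ℂ)) * Kt t (((3/4:ℝ):ℂ) + τ * I)) := by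
      intro τ
      have : Complex.exp (-(((3/4:ℝ):ℂ) + τ * I) * Real.log n) * Complex.exp ((((3/4:ℝ):ℂ) + τ * I) * Y) = Complex.exp (-(((3/4:ℝ):ℂ) + τ * I) * ((Real.log n - Y : ℝ) : ℂ)) := by
        rw [← Complex.exp_add]; congr 1; push_cast; ring
      simp only [hFd, hE]
      linear_combination (a n : ℂ) * Kt t (((3/4:ℝ):ℂ) + τ * I) * this
    simp_rw [e]
    rw [integral_const_mul, h3]; ring
  have hFsum : ∀ τ : ℝ, ∑' n, F n τ = E τ * (1 / ((((3/4:ℝ):ℂ) + τ * I) - 1/2)) - Ph (((3/4:ℝ):ℂ) + τ * I) * E τ := by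
    intro τ
    have := ((Ph_right (((3/4:ℝ):ℂ) + τ * I) (line_re _ _)).mul_right (E τ)).tsum_eq
    simp only [hFd]
    rw [this]; ring
  have hlr := line_right Y t (3/4) (by norm_num) (by norm_num) (1/2) (by norm_num)
  have hli : Integrable (fun τ : ℝ => E τ * (1 / ((((3/4:ℝ):ℂ) + τ * I) - 1/2))) := by
    refine hEi.mul_bdd (c := 4) ?_ (Eventually.of_forall fun τ => ?_)
    · apply Continuous.aestronglyMeasurable
      refine Continuous.div (by fun_prop) (by fun_prop) fun τ h => ?_
      have := congrArg Complex.re h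
      simp at this; norm_num at this
    · have := Complex.abs_re_le_norm ((((3/4:ℝ):ℂ) + τ * I) - 1/2)
      have e : ((((3/4:ℝ):ℂ) + τ * I) - 1/2).re = 1/4 := by simp; norm_num
      rw [e, abs_of_pos (by norm_num)] at this
      rw [norm_div, norm_one, div_le_iff₀ (by linarith)]
      linarith
  have hPi := PhK_int hRH Y t (3/4) (by norm_num) (by norm_num) n1
  have h5 := hsw.tsum_eq
  simp_rw [hFint, hFsum] at h5
  rw [integral_sub hli hPi, hlr, tsum_mul_left] at h5
  unfold Bf
  linear_combination h5

/-- the smoothed explicit formula -/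
theorem explicit (hRH : RiemannHypothesis) : ∃ C : ℝ, 0 < C ∧ ∀ Y t : ℝ,
    ‖Bf Y t + Zs Y t‖ ≤ C * Real.exp (-Y/10) * Lg t := by
  obtain ⟨C1, hC1, hp⟩ := phi_line hRH
  set W : ℝ := ∫ τ : ℝ, (1 + τ ^ 2) ^ (-(9/16) : ℝ) with hW
  have hW0 : 0 ≤ W := integral_nonneg fun τ => by positivity
  refine ⟨C1 * 32 * 66 * (W + 1), by positivity, fun Y t => ?_⟩
  have h1 := Ph_contour hRH Y t
  rw [Lambda_line hRH] at h1
  set J := ∫ τ : ℝ, Ph (((-1/10:ℝ):ℂ) + τ * I) * (Complex.exp ((((-1/10:ℝ):ℂ) + τ * I) * Y) * Kt t (((-1/10:ℝ):ℂ) + τ * I)) with hJ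
  have hpi : (2 * π:ℂ) ≠ 0 := by exact_mod_cast (by positivity : 2 * π ≠ 0)
  have e : Bf Y t + Zs Y t = -(2 * (π:ℂ))⁻¹ * J := by
    apply mul_left_cancel₀ hpi
    rw [← mul_assoc, mul_neg, mul_inv_cancel₀ hpi]
    linear_combination -h1
  have hLt := Lg_half t
  have hJb : ‖J‖ ≤ C1 * 32 * 66 * Real.exp (-Y/10) * Lg t * W := by
    have hmaj : Integrable (fun τ : ℝ => C1 * 32 * 66 * Real.exp (-Y/10) * Lg t * (1 + (τ - t) ^ 2) ^ (-(9/16) : ℝ)) :=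
      (int_916.comp_sub_right t).const_mul _
    have := norm_integral_le_of_norm_le hmaj (Eventually.of_forall (fun τ : ℝ => (?_ : ‖Ph (((-1/10:ℝ):ℂ) + τ * I) * (Complex.exp ((((-1/10:ℝ):ℂ) + τ * I) * Y) * Kt t (((-1/10:ℝ):ℂ) + τ * I))‖ ≤ _)))
    · rw [integral_const_mul, integral_sub_right_eq_self (fun τ : ℝ => (1 + τ ^ 2) ^ (-(9/16) : ℝ)) t] at this
      exact this
    · have a1 := hp (((-1/10:ℝ):ℂ) + τ * I) (by rw [line_re]) (by rw [line_re]; norm_num) (by rw [line_re, abs_of_neg (by norm_num)]; norm_num)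
      have a2 := Kt_bound t (((-1/10:ℝ):ℂ) + τ * I) (by rw [line_re]) (by rw [line_re]; norm_num)
      rw [line_im] at a1 a2
      rw [norm_mul, norm_mul, Complex.norm_exp]
      have e3 : ((((-1/10:ℝ):ℂ) + τ * I) * Y).re = -Y/10 := by simp; ring
      rw [e3]
      have a3 : Lg τ ≤ 66 * Lg t * (1 + (τ - t) ^ 2) ^ (1/16 : ℝ) := by
        have b1 := Lg_add t (τ - t)
        have b2 := Lg_rpow (τ - t)
        have b3 : (1:ℝ) ≤ (1 + (τ - t) ^ 2) ^ (1/16 : ℝ) := Real.one_le_rpow (by nlinarith [sq_nonneg (τ - t)]) (by norm_num)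
        have : t + (τ - t) = τ := by ring
        rw [this] at b1
        nlinarith
      have hq : (1 + (τ - t) ^ 2) ^ (1/16 : ℝ) * (1 + (τ - t) ^ 2)⁻¹ ≤ (1 + (τ - t) ^ 2) ^ (-(9/16) : ℝ) := by
        rw [← Real.rpow_neg_one, ← Real.rpow_add (by positivity)]
        exact Real.rpow_le_rpow_of_exponent_le (by nlinarith [sq_nonneg (τ - t)]) (by norm_num)
      calc _ ≤ (C1 * (66 * Lg t * (1 + (τ - t) ^ 2) ^ (1/16 : ℝ))) * (Real.exp (-Y/10) * (32 / (1 + (τ - t) ^ 2))) := by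
            gcongr; exact a1.trans (by gcongr)
        _ = C1 * 32 * 66 * Real.exp (-Y/10) * Lg t * ((1 + (τ - t) ^ 2) ^ (1/16 : ℝ) * (1 + (τ - t) ^ 2)⁻¹) := by
            rw [div_eq_mul_inv]; ring
        _ ≤ _ := by gcongr
  rw [e, norm_mul, norm_neg, norm_inv]
  have hn : ‖(2 * π : ℂ)‖ = 2 * π := by
    rw [norm_mul, Complex.norm_real, Real.norm_of_nonneg Real.pi_pos.le]; simp
  rw [hn]
  have hi : (2 * π)⁻¹ ≤ 1 := inv_le_one_of_one_le₀ (by linarith [Real.pi_gt_three])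
  calc _ ≤ 1 * (C1 * 32 * 66 * Real.exp (-Y/10) * Lg t * W) := by gcongr
    _ ≤ 1 * (C1 * 32 * 66 * Real.exp (-Y/10) * Lg t * (W + 1)) := by gcongr; linarith
    _ = _ := by ring

end ModE5

section ModF1
open Complex Filter MeasureTheory Real Set
open scoped Topology
def gm (m : Measure ℝ) (r u : ℝ) : ℝ := m.real (Ioc u (u + r))

section
variable (m : Measure ℝ) [IsFiniteMeasure m]

lemma gm_eq (r u : ℝ) (hr : 0 ≤ r) : gm m r u = m.real (Iic (u + r)) - m.real (Iic u) := by
  unfold gm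
  have : Ioc u (u + r) = Iic (u + r) \ Iic u := by ext x; simp [and_comm]
  rw [this, measureReal_sdiff (Iic_subset_Iic.2 (by linarith)) measurableSet_Iic]

lemma meas_Iic : Measurable (fun u : ℝ => m.real (Iic u)) := by
  apply Monotone.measurable
  intro a b h
  exact measureReal_mono (Iic_subset_Iic.2 h)

lemma gm_meas (r : ℝ) (hr : 0 ≤ r) : Measurable (gm m r) := by
  have : gm m r = fun u => m.real (Iic (u + r)) - m.real (Iic u) := funext fun u => gm_eq m r u hr
  rw [this]
  exact ((meas_Iic m).comp (measurable_add_const r)).sub (meas_Iic m)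

lemma gm_nonneg (r u : ℝ) : 0 ≤ gm m r u := measureReal_nonneg

lemma gm_le (r u : ℝ) : gm m r u ≤ m.real univ := measureReal_mono (subset_univ _)

lemma win_meas (r : ℝ) : MeasurableSet {p : ℝ × ℝ | p.1 < p.2 ∧ p.2 ≤ p.1 + r} := by
  apply MeasurableSet.inter
  · exact measurableSet_lt measurable_fst measurable_snd
  · exact measurableSet_le measurable_snd (by fun_prop)

lemma win_int (r t : ℝ) (hr : 0 ≤ r) : Integrable (fun p : ℝ × ℝ =>
    {p : ℝ × ℝ | p.1 < p.2 ∧ p.2 ≤ p.1 + r}.indicator (fun p => Complex.exp (-(I * t * p.1))) p) ((volume : Measure ℝ).prod m) := by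
  have hms : AEStronglyMeasurable (fun p : ℝ × ℝ =>
    {p : ℝ × ℝ | p.1 < p.2 ∧ p.2 ≤ p.1 + r}.indicator (fun p => Complex.exp (-(I * t * p.1))) p) ((volume : Measure ℝ).prod m) := by
    refine AEStronglyMeasurable.indicator ?_ (win_meas r)
    apply Continuous.aestronglyMeasurable; fun_prop
  have hsec : ∀ v : ℝ, (fun u : ℝ => {p : ℝ × ℝ | p.1 < p.2 ∧ p.2 ≤ p.1 + r}.indicator (fun p => Complex.exp (-(I * t * p.1))) (u, v))
      = (Ico (v - r) v).indicator (fun u => Complex.exp (-(I * t * u))) := by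
    intro v; ext u
    by_cases h : u < v ∧ v ≤ u + r
    · rw [indicator_of_mem (by exact h), indicator_of_mem (by constructor <;> linarith [h.1, h.2])]
    · rw [indicator_of_notMem (by exact h), indicator_of_notMem (by rintro ⟨h1, h2⟩; exact h ⟨h2, by linarith⟩)]
  rw [integrable_prod_iff' hms]
  refine ⟨Eventually.of_forall fun v => ?_, ?_⟩
  · rw [hsec v, integrable_indicator_iff measurableSet_Ico]
    refine (Continuous.integrableOn_Icc (by fun_prop)).mono_set Ico_subset_Icc_self
  · have : ∀ v : ℝ, ∫ u : ℝ, ‖{p : ℝ × ℝ | p.1 < p.2 ∧ p.2 ≤ p.1 + r}.indicator (fun p => Complex.exp (-(I * t * p.1))) (u, v)‖ = r := by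
      intro v
      have e : ∀ u : ℝ, ‖{p : ℝ × ℝ | p.1 < p.2 ∧ p.2 ≤ p.1 + r}.indicator (fun p => Complex.exp (-(I * t * p.1))) (u, v)‖ = (Ico (v - r) v).indicator (fun _ => (1:ℝ)) u := by
        intro u
        have := congrFun (hsec v) u
        rw [this, norm_indicator_eq_indicator_norm]
        congr 1; ext u; rw [Complex.norm_exp]; simp
      simp_rw [e]
      rw [integral_indicator measurableSet_Ico]
      simp [hr]
    simp_rw [this]
    exact integrable_const r

def ah (r t : ℝ) : ℂ := ∫ y in Ico (-r) 0, Complex.exp (-(I * t * y))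

lemma gm_int (r : ℝ) (hr : 0 ≤ r) : Integrable (gm m r) := by
  have h := (win_int m r 0 hr).integral_prod_left
  have e : (fun u : ℝ => ∫ v, {p : ℝ × ℝ | p.1 < p.2 ∧ p.2 ≤ p.1 + r}.indicator (fun p => Complex.exp (-(I * (0:ℝ) * p.1))) (u, v) ∂m) = fun u => ((gm m r u : ℝ) : ℂ) := by
    ext u
    have : (fun v : ℝ => {p : ℝ × ℝ | p.1 < p.2 ∧ p.2 ≤ p.1 + r}.indicator (fun p => Complex.exp (-(I * (0:ℝ) * p.1))) (u, v))
      = (Ioc u (u + r)).indicator (fun _ => (1:ℂ)) := by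
      ext v
      simp [indicator]
    rw [this, integral_indicator measurableSet_Ioc]
    simp [gm, measureReal_def]
  rw [e] at h
  exact h.re.congr (Eventually.of_forall fun u => by simp)

lemma gm_FT (r t : ℝ) (hr : 0 ≤ r) : FT (fun u => ((gm m r u : ℝ) : ℂ)) t = ah r t * ∫ v, Complex.exp (-(I * t * v)) ∂m := by
  unfold FT
  have h := win_int m r t hr
  have e : ∀ u : ℝ, Complex.exp (-(I * t * u)) * ((gm m r u : ℝ) : ℂ) = ∫ v, {p : ℝ × ℝ | p.1 < p.2 ∧ p.2 ≤ p.1 + r}.indicator (fun p => Complex.exp (-(I * t * p.1))) (u, v) ∂m := by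
    intro u
    have : (fun v : ℝ => {p : ℝ × ℝ | p.1 < p.2 ∧ p.2 ≤ p.1 + r}.indicator (fun p => Complex.exp (-(I * t * p.1))) (u, v))
      = (Ioc u (u + r)).indicator (fun _ => Complex.exp (-(I * t * u))) := by
      ext v
      simp [indicator]
    rw [this, integral_indicator measurableSet_Ioc]
    simp [gm, measureReal_def, mul_comm]
  simp_rw [e]
  rw [integral_integral_swap (f := fun u v => {p : ℝ × ℝ | p.1 < p.2 ∧ p.2 ≤ p.1 + r}.indicator (fun p => Complex.exp (-(I * t * p.1))) (u, v)) h,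
    ← integral_const_mul]
  congr 1; ext v
  have : (fun u : ℝ => {p : ℝ × ℝ | p.1 < p.2 ∧ p.2 ≤ p.1 + r}.indicator (fun p => Complex.exp (-(I * t * p.1))) (u, v))
      = (Ico (v - r) v).indicator (fun u => Complex.exp (-(I * t * u))) := by
    ext u
    by_cases h : u < v ∧ v ≤ u + r
    · rw [indicator_of_mem (by exact h), indicator_of_mem (by constructor <;> linarith [h.1, h.2])]
    · rw [indicator_of_notMem (by exact h), indicator_of_notMem (by rintro ⟨h1, h2⟩; exact h ⟨h2, by linarith⟩)]
  rw [this, integral_indicator measurableSet_Ico]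
  have h1 : ∀ a : ℝ, a - r ≤ a := fun a => by linarith
  rw [ah, integral_Ico_eq_integral_Ioc, integral_Ico_eq_integral_Ioc, ← intervalIntegral.integral_of_le (h1 v),
    ← intervalIntegral.integral_of_le (by linarith : -r ≤ 0)]
  have h2 := intervalIntegral.integral_comp_add_right (a := -r) (b := 0) (fun u : ℝ => Complex.exp (-(I * t * u))) v
  rw [show -r + v = v - r by ring, zero_add] at h2
  rw [← h2, ← intervalIntegral.integral_mul_const]
  congr 1; ext u
  rw [← Complex.exp_add]; congr 1; push_cast; ring

end

end ModF1

section ModF2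
open Complex Filter MeasureTheory Real Set
open scoped Topology
lemma ah_FT (r : ℝ) (t : ℝ) : ah r t = FT ((Ico (-r) 0).indicator (fun _ => (1:ℂ))) t := by
  unfold ah FT
  rw [← integral_indicator measurableSet_Ico]
  congr 1; ext y
  by_cases h : y ∈ Ico (-r) 0
  · rw [indicator_of_mem h, indicator_of_mem h, mul_one]
  · rw [indicator_of_notMem h, indicator_of_notMem h, mul_zero]

lemma ind_int (r : ℝ) : Integrable ((Ico (-r) 0).indicator (fun _ => (1:ℂ))) := by
  rw [integrable_indicator_iff measurableSet_Ico]
  exact (integrable_const (1:ℂ))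

lemma ind_L2 (r : ℝ) : MemLp ((Ico (-r) 0).indicator (fun _ => (1:ℂ))) 2 := by
  rw [memLp_indicator_iff_restrict measurableSet_Ico]
  exact memLp_const 1

lemma ah_cont (r : ℝ) : Continuous (ah r) := by
  have : ah r = FT ((Ico (-r) 0).indicator (fun _ => (1:ℂ))) := funext (ah_FT r)
  rw [this]; exact FT_cont _ (ind_int r)

lemma ah_sq_int (r : ℝ) : Integrable (fun t => ‖ah r t‖ ^ 2) := by
  have := (plancherel_FT _ (ind_int r) (ind_L2 r)).1
  simpa only [ah_FT] using this

lemma ah_sq (r : ℝ) (hr : 0 ≤ r) : ∫ t, ‖ah r t‖ ^ 2 = 2 * π * r := by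
  have := (plancherel_FT _ (ind_int r) (ind_L2 r)).2
  simp only [← ah_FT] at this
  have e : ∫ y, ‖(Ico (-r) 0).indicator (fun _ => (1:ℂ)) y‖ ^ 2 = r := by
    have : ∀ y, ‖(Ico (-r) 0).indicator (fun _ => (1:ℂ)) y‖ ^ 2 = (Ico (-r) 0).indicator (fun _ => (1:ℝ)) y := by
      intro y
      by_cases h : y ∈ Ico (-r) 0
      · rw [indicator_of_mem h, indicator_of_mem h]; simp
      · rw [indicator_of_notMem h, indicator_of_notMem h]; simp
    simp_rw [this]
    rw [integral_indicator measurableSet_Ico]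
    simp [hr]
  rw [e] at this
  have hp := Real.pi_pos
  field_simp at this
  linarith

lemma ah_le (r t : ℝ) (hr : 0 ≤ r) : ‖ah r t‖ ≤ r := by
  unfold ah
  have := norm_setIntegral_le_of_norm_le_const (μ := volume) (s := Ico (-r) 0) (C := 1) (f := fun y : ℝ => Complex.exp (-(I * t * y))) (by simp)
    (fun x _ => by rw [Complex.norm_exp]; simp)
  simpa [hr] using this

lemma ah_neg (r t : ℝ) : ‖ah r (-t)‖ = ‖ah r t‖ := by
  have : ah r (-t) = (starRingEnd ℂ) (ah r t) := by
    unfold ah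
    rw [← integral_conj]
    congr 1; ext y
    rw [← Complex.exp_conj]; simp
  rw [this, RCLike.norm_conj]

lemma ah_formula (r t : ℝ) (hr : 0 ≤ r) (ht : t ≠ 0) : ‖ah r t‖ ^ 2 = 4 * Real.sin (r * t / 2) ^ 2 / t ^ 2 := by
  have h1 : ah r t = (Complex.exp (I * ((r * t : ℝ))) - 1) / (I * t) := by
    unfold ah
    rw [integral_Ico_eq_integral_Ioc, ← intervalIntegral.integral_of_le (by linarith : -r ≤ 0)]
    have hc : -(I * (t:ℂ)) ≠ 0 := by simp [ht]
    have := integral_exp_mul_complex (a := -r) (b := 0) hc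
    have e : ∀ y : ℝ, -(I * (t:ℂ) * y) = -(I * (t:ℂ)) * y := fun y => by ring
    simp_rw [e]
    rw [this]
    have ht' : (t:ℂ) ≠ 0 := by exact_mod_cast ht
    rw [show -(I * (t:ℂ)) * ((-r : ℝ) : ℂ) = I * ((r * t : ℝ) : ℂ) by push_cast; ring]
    simp only [Complex.ofReal_zero, mul_zero, Complex.exp_zero]
    field_simp
    ring
  rw [h1, norm_div, Complex.norm_exp_I_mul_ofReal_sub_one, norm_mul, norm_mul, Complex.norm_I, one_mul, Complex.norm_real, div_pow]
  simp only [Real.norm_eq_abs, mul_pow, sq_abs]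
  ring

lemma ah_le2 (r t : ℝ) (hr : 0 ≤ r) (ht : t ≠ 0) : ‖ah r t‖ ^ 2 ≤ 4 / t ^ 2 := by
  rw [ah_formula r t hr ht]
  have := Real.sin_sq_le_one (r * t / 2)
  gcongr; linarith

lemma half_even {f : ℝ → ℝ} (hf : ∀ t, f (-t) = f t) : ∫ t, f t = 2 * ∫ t in Ioi (0:ℝ), f t := by
  rw [← integral_comp_abs]
  congr 1; ext t
  rcases abs_choice t with h | h <;> rw [h]
  rw [hf]

lemma ah_sq_half (r : ℝ) (hr : 0 ≤ r) : ∫ t in Ioi (0:ℝ), ‖ah r t‖ ^ 2 = π * r := by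
  have := half_even (f := fun t => ‖ah r t‖ ^ 2) (fun t => by simp only [ah_neg])
  rw [ah_sq r hr] at this
  linarith

/-- derivative bound for the Fejer kernel -/
lemma xcos (x : ℝ) (hx : 0 ≤ x) : |x * Real.cos x - Real.sin x| ≤ 2 * x ^ 3 := by
  have h1 := Real.one_sub_sq_div_two_le_cos (x := x)
  have h2 := Real.sin_le hx
  rw [abs_le]
  constructor
  · nlinarith [pow_nonneg hx 3]
  · rcases le_or_gt x 1 with h | h
    · rcases eq_or_lt_of_le hx with h0 | h0
      · rw [← h0]; simp
      · have := Real.sin_gt_sub_cube h0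
        nlinarith [Real.cos_le_one x, pow_nonneg hx 3]
    · nlinarith [Real.cos_le_one x, Real.neg_one_le_sin x, pow_nonneg hx 3, mul_pos (by linarith : 0 < x) (by linarith : 0 < x), mul_self_nonneg (x-1), mul_nonneg (mul_self_nonneg (x-1)) hx]

lemma fej_deriv (r t : ℝ) (ht : 0 < t) : HasDerivAt (fun t : ℝ => 4 * Real.sin (r * t / 2) ^ 2 / t ^ 2)
    (8 * Real.sin (r * t / 2) * ((r * t / 2) * Real.cos (r * t / 2) - Real.sin (r * t / 2)) / t ^ 3) t := by
  have h1 : HasDerivAt (fun t : ℝ => r * t / 2) (r / 2) t := by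
    simpa using ((hasDerivAt_id t).const_mul r).div_const 2
  have h2 := ((h1.sin.pow 2).const_mul 4).div ((hasDerivAt_id t).pow 2) (by simp [ht.ne'])
  refine h2.congr_deriv ?_
  simp only [id, Pi.pow_apply]
  generalize Real.sin (r * t / 2) = s
  generalize Real.cos (r * t / 2) = c
  field_simp
  push_cast
  ring

lemma fej_deriv_le (r t : ℝ) (hr : 0 ≤ r) (ht : 0 < t) :
   |8 * Real.sin (r * t / 2) * ((r * t / 2) * Real.cos (r * t / 2) - Real.sin (r * t / 2)) / t ^ 3| ≤ 2 * r ^ 3 := by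
  have h := xcos (r * t / 2) (by positivity)
  have hs := Real.abs_sin_le_one (r * t / 2)
  rw [abs_div, abs_mul, abs_mul, abs_of_pos (by positivity : 0 < t^3), div_le_iff₀ (by positivity)]
  calc |8| * |Real.sin (r * t / 2)| * |(r * t / 2) * Real.cos (r * t / 2) - Real.sin (r * t / 2)| ≤ 8 * 1 * (2 * (r * t/2)^3) := by
        rw [abs_of_pos (by norm_num : (0:ℝ) < 8)]
        gcongr
    _ = _ := by ring

end ModF2

section ModF3
open Complex Filter MeasureTheory Real Set
open scoped Topology
lemma meas_comp (m : Measure ℝ) [IsFiniteMeasure m] (φ p : ℝ → ℝ) (hp : Measurable p) (K u h : ℝ) (hh : 0 ≤ h)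
    (hpb : ∀ s ∈ Ioc u (u + h), |p s| ≤ K)
    (hφ : ∀ v ∈ Ioc u (u + h), φ (u + h) - φ v = ∫ s in Ioc v (u + h), p s) :
    ∫ v in Ioc u (u + h), φ v ∂m = φ (u + h) * gm m h u - ∫ r in Ioc 0 h, p (u + r) * gm m r u := by
  have hms : MeasurableSet {q : ℝ × ℝ | q.1 ≤ q.2} := measurableSet_le measurable_fst measurable_snd
  set G : ℝ × ℝ → ℝ := {q : ℝ × ℝ | q.1 ≤ q.2}.indicator (fun q => p q.2) with hG
  have hGm : Measurable G := (hp.comp measurable_snd).indicator hms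
  have hGi : Integrable G ((m.restrict (Ioc u (u + h))).prod ((volume : Measure ℝ).restrict (Ioc u (u + h)))) := by
    refine Integrable.mono' (integrable_const K) hGm.aestronglyMeasurable ?_
    rw [Measure.prod_restrict]
    refine (ae_restrict_iff' (measurableSet_Ioc.prod measurableSet_Ioc)).2 (Eventually.of_forall ?_)
    rintro ⟨a, b⟩ ⟨ha, hb⟩
    have h0 := hpb b hb
    rw [hG]
    refine (norm_indicator_le_norm_self _ _).trans ?_
    simpa using h0
  have e1 : ∀ v ∈ Ioc u (u + h), φ v = φ (u + h) - ∫ s in Ioc u (u + h), G (v, s) := by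
    intro v hv
    have : ∫ s in Ioc u (u + h), G (v, s) = ∫ s in Ioc v (u + h), p s := by
      have e : (fun s => G (v, s)) = (Ici v).indicator p := by
        ext s
        by_cases hs : v ≤ s
        · rw [hG, indicator_of_mem (by exact hs), indicator_of_mem (by exact hs)]
        · rw [hG, indicator_of_notMem (by exact hs), indicator_of_notMem (by exact hs)]
      rw [e, setIntegral_indicator measurableSet_Ici]
      have : Ioc u (u + h) ∩ Ici v = Icc v (u + h) := by
        ext s; simp only [mem_inter_iff, mem_Ioc, mem_Ici, mem_Icc]
        constructor
        · rintro ⟨⟨a, b⟩, c⟩; exact ⟨c, b⟩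
        · rintro ⟨a, b⟩; exact ⟨⟨lt_of_lt_of_le hv.1 a, b⟩, a⟩
      rw [this, integral_Icc_eq_integral_Ioc]
    rw [this, ← hφ v hv]; ring
  rw [setIntegral_congr_fun measurableSet_Ioc e1, integral_sub (integrable_const _) hGi.integral_prod_left]
  congr 1
  · simp [gm, mul_comm]
  · rw [integral_integral_swap (f := fun v s => G (v, s)) hGi]
    have e2 : ∀ s ∈ Ioc u (u + h), ∫ v in Ioc u (u + h), G (v, s) ∂m = p s * gm m (s - u) u := by
      intro s hs
      have e : (fun v => G (v, s)) = (Iic s).indicator (fun _ => p s) := by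
        ext v
        by_cases hs : v ≤ s
        · rw [hG, indicator_of_mem (by exact hs), indicator_of_mem (by exact hs)]
        · rw [hG, indicator_of_notMem (by exact hs), indicator_of_notMem (by exact hs)]
      rw [e, setIntegral_indicator measurableSet_Iic]
      have : Ioc u (u + h) ∩ Iic s = Ioc u (u + (s - u)) := by
        ext v; simp only [mem_inter_iff, mem_Ioc, mem_Iic]
        constructor
        · rintro ⟨⟨a, b⟩, c⟩; exact ⟨a, by linarith⟩
        · rintro ⟨a, b⟩; exact ⟨⟨a, by linarith [hs.2]⟩, by linarith⟩
      rw [this]; simp [gm, mul_comm]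
    rw [setIntegral_congr_fun measurableSet_Ioc e2, ← intervalIntegral.integral_of_le (by linarith),
      ← intervalIntegral.integral_of_le hh]
    have := intervalIntegral.integral_comp_add_left (a := 0) (b := h) (fun s : ℝ => p s * gm m (s - u) u) u
    rw [add_zero] at this
    rw [← this]
    simp

/-- the weight -/
def phw (Y v : ℝ) : ℝ := Real.exp (v / 2 + |v - Y|)
def php (Y v : ℝ) : ℝ := (if v < Y then (-1/2) else (3/2)) * phw Y v

lemma phw_cont (Y : ℝ) : Continuous (phw Y) := by unfold phw; fun_prop
lemma phw_pos (Y v : ℝ) : 0 < phw Y v := Real.exp_pos _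
lemma php_meas (Y : ℝ) : Measurable (php Y) := by
  unfold php
  refine Measurable.mul (Measurable.ite measurableSet_Iio measurable_const measurable_const) (phw_cont Y).measurable

lemma phw_ratio (Y u v h : ℝ) (h0 : u ≤ v) (hv : v ≤ u + h) : phw Y v ≤ phw Y u * Real.exp (3 / 2 * h) ∧ phw Y u * Real.exp (-(3/2 * h)) ≤ phw Y v := by
  unfold phw
  rw [← Real.exp_add, ← Real.exp_add, Real.exp_le_exp, Real.exp_le_exp]
  have h1 := abs_sub_abs_le_abs_sub (v - Y) (u - Y)
  have h2 := abs_sub_abs_le_abs_sub (u - Y) (v - Y)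
  rw [show v - Y - (u - Y) = v - u by ring, abs_of_nonneg (show 0 ≤ v - u by linarith)] at h1
  rw [show u - Y - (v - Y) = -(v - u) by ring, abs_neg, abs_of_nonneg (show 0 ≤ v - u by linarith)] at h2
  constructor <;> linarith

lemma php_abs (Y v : ℝ) : |php Y v| ≤ 3/2 * phw Y v := by
  unfold php
  rw [abs_mul, abs_of_pos (phw_pos Y v)]
  refine mul_le_mul_of_nonneg_right ?_ (phw_pos Y v).le
  split_ifs <;> norm_num [abs_of_nonneg, abs_of_neg]

lemma phw_ftc (Y a b : ℝ) (hab : a ≤ b) : phw Y b - phw Y a = ∫ s in Ioc a b, php Y s := by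
  rw [← intervalIntegral.integral_of_le hab]
  symm
  have hd : ∀ x ∈ Ioo a b \ {Y}, HasDerivAt (phw Y) (php Y x) x := by
    rintro x ⟨_, hx⟩
    have hx' : x ≠ Y := hx
    rcases lt_or_gt_of_ne hx' with h | h
    · have h1 : HasDerivAt (fun v : ℝ => Real.exp (v / 2 + -(v - Y))) (Real.exp (x / 2 + -(x - Y)) * (1 / 2 + -1)) x :=
        (((hasDerivAt_id x).div_const 2).add ((hasDerivAt_id x).sub_const Y).neg).exp
      have h2 : phw Y =ᶠ[𝓝 x] fun v : ℝ => Real.exp (v / 2 + -(v - Y)) := by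
        filter_upwards [Iio_mem_nhds h] with v hv
        have hv' : v < Y := hv
        simp only [phw]; rw [abs_of_neg (by linarith)]
      refine (h1.congr_of_eventuallyEq h2).congr_deriv ?_
      rw [php, if_pos h, phw, abs_of_neg (by linarith)]; ring
    · have h1 : HasDerivAt (fun v : ℝ => Real.exp (v / 2 + (v - Y))) (Real.exp (x / 2 + (x - Y)) * (1 / 2 + 1)) x :=
        (((hasDerivAt_id x).div_const 2).add ((hasDerivAt_id x).sub_const Y)).exp
      have h2 : phw Y =ᶠ[𝓝 x] fun v : ℝ => Real.exp (v / 2 + (v - Y)) := by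
        filter_upwards [Ioi_mem_nhds h] with v hv
        have hv' : Y < v := hv
        simp only [phw]; rw [abs_of_pos (by linarith)]
      refine (h1.congr_of_eventuallyEq h2).congr_deriv ?_
      rw [php, if_neg (by linarith), phw, abs_of_pos (by linarith)]; ring
  refine integral_eq_of_hasDerivAt_off_countable_of_le (phw Y) (php Y) hab (countable_singleton Y) (phw_cont Y).continuousOn hd ?_
  rw [intervalIntegrable_iff_integrableOn_Ioc_of_le hab]
  have h3 : IntegrableOn (fun s => 3/2 * phw Y s) (Ioc a b) :=
    (Continuous.integrableOn_Icc ((phw_cont Y).const_mul _)).mono_set Ioc_subset_Icc_self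
  exact Integrable.mono' h3 (php_meas Y).aestronglyMeasurable (Eventually.of_forall fun s => php_abs Y s)

end ModF3

section ModF4
open Complex Filter MeasureTheory Real Set
open scoped Topology
def gd (m1 m2 : Measure ℝ) (r u : ℝ) : ℝ := gm m1 r u - gm m2 r u
def Dd (Y : ℝ) (m1 m2 : Measure ℝ) (h u : ℝ) : ℝ :=
  ((∫ v in Ioc u (u + h), phw Y v ∂m1) - ∫ v in Ioc u (u + h), phw Y v ∂m2) / phw Y u

section
variable (m m1 m2 : Measure ℝ) [IsFiniteMeasure m] [IsFiniteMeasure m1] [IsFiniteMeasure m2]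

lemma gm_meas2 : Measurable (fun q : ℝ × ℝ => m.real (Iic (q.2 + q.1)) - m.real (Iic q.2)) :=
  ((meas_Iic m).comp (measurable_snd.add measurable_fst)).sub ((meas_Iic m).comp measurable_snd)

lemma gm_mono (r h u : ℝ) (hr : r ≤ h) : gm m r u ≤ gm m h u :=
  measureReal_mono (Ioc_subset_Ioc_right (by linarith))

lemma gm_intr (u h : ℝ) : IntegrableOn (fun r => gm m r u) (Ioc 0 h) := by
  refine Integrable.mono' (integrable_const (gm m h u)) ?_ ?_
  · have h1 : Measurable (fun r => m.real (Iic (u + r)) - m.real (Iic u)) :=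
      ((meas_Iic m).comp (measurable_const_add u)).sub_const _
    refine h1.aestronglyMeasurable.congr ?_
    refine (ae_restrict_iff' measurableSet_Ioc).2 (Eventually.of_forall fun r hr => ?_)
    exact (gm_eq m r u hr.1.le).symm
  · refine (ae_restrict_iff' measurableSet_Ioc).2 (Eventually.of_forall fun r hr => ?_)
    rw [Real.norm_of_nonneg (gm_nonneg m r u)]
    exact gm_mono m r h u hr.2

lemma gd_intr (u h : ℝ) : IntegrableOn (fun r => gd m1 m2 r u) (Ioc 0 h) :=
  (gm_intr m1 u h).sub (gm_intr m2 u h)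

lemma exp_log2 (h : ℝ) (hh : h ≤ 1/2) : Real.exp (3/2 * h) ≤ 3 := by
  have : Real.exp (3/2 * h) ≤ Real.exp 1 := Real.exp_le_exp.2 (by linarith)
  linarith [Real.exp_one_lt_d9]

lemma comp_pt (Y h u : ℝ) (hh : 0 ≤ h) (hh2 : h ≤ 1/2) :
    |Dd Y m1 m2 h u - gd m1 m2 h u| ≤ 7 * h * |gd m1 m2 h u| + 7 * ∫ r in Ioc 0 h, |gd m1 m2 r u| := by
  have hw := phw_pos Y u
  have hE := exp_log2 h hh2
  have hK : ∀ s ∈ Ioc u (u + h), |php Y s| ≤ 5 * phw Y u := by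
    intro s hs
    have h1 := php_abs Y s
    have h2 := (phw_ratio Y u s h hs.1.le hs.2).1
    nlinarith
  have hf : ∀ v ∈ Ioc u (u + h), phw Y (u + h) - phw Y v = ∫ s in Ioc v (u + h), php Y s :=
    fun v hv => phw_ftc Y v (u + h) hv.2
  have i : ∀ (m : Measure ℝ) [IsFiniteMeasure m], IntegrableOn (fun r => php Y (u + r) * gm m r u) (Ioc 0 h) := by
    intro m _
    refine Integrable.bdd_mul (c := 5 * phw Y u) (gm_intr m u h) ((php_meas Y).comp (measurable_const_add u)).aestronglyMeasurable ?_
    refine (ae_restrict_iff' measurableSet_Ioc).2 (Eventually.of_forall fun r hr => ?_)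
    exact hK _ ⟨by linarith [hr.1], by linarith [hr.2]⟩
  have e : Dd Y m1 m2 h u - gd m1 m2 h u = (phw Y (u + h) / phw Y u - 1) * gd m1 m2 h u
      - (∫ r in Ioc 0 h, php Y (u + r) * gd m1 m2 r u) / phw Y u := by
    have : ∫ r in Ioc 0 h, php Y (u + r) * gd m1 m2 r u = (∫ r in Ioc 0 h, php Y (u + r) * gm m1 r u) - ∫ r in Ioc 0 h, php Y (u + r) * gm m2 r u := by
      rw [← integral_sub (i m1) (i m2)]
      congr 1; ext r; simp only [gd]; ring
    rw [this, Dd, meas_comp m1 (phw Y) (php Y) (php_meas Y) _ u h hh hK hf, meas_comp m2 (phw Y) (php Y) (php_meas Y) _ u h hh hK hf]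
    simp only [gd]
    field_simp
    ring
  rw [e]
  refine (abs_sub _ _).trans (add_le_add ?_ ?_)
  · rw [abs_mul]
    refine mul_le_mul_of_nonneg_right ?_ (abs_nonneg _)
    have h1 := (phw_ratio Y u (u + h) h (by linarith) le_rfl)
    have h2 : phw Y (u + h) / phw Y u ≤ Real.exp (3/2 * h) := by rw [div_le_iff₀ hw]; linarith [h1.1]
    have h3 : Real.exp (-(3/2 * h)) ≤ phw Y (u + h) / phw Y u := by rw [le_div_iff₀ hw]; linarith [h1.2]
    have h4 : 1 - 3/2 * h ≤ Real.exp (-(3/2 * h)) := by linarith [Real.add_one_le_exp (-(3/2 * h))]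
    have h5 : Real.exp (3/2 * h) - 1 ≤ 5 * h := by
      have h6 : Real.exp (3/2*h) * Real.exp (-(3/2 * h)) = 1 := by rw [← Real.exp_add]; simp
      nlinarith [Real.exp_pos (3/2*h)]
    rw [abs_le]; constructor <;> linarith
  · rw [abs_div, abs_of_pos hw, div_le_iff₀ hw]
    calc |∫ r in Ioc 0 h, php Y (u + r) * gd m1 m2 r u| ≤ ∫ r in Ioc 0 h, |php Y (u + r) * gd m1 m2 r u| := abs_integral_le_integral_abs
      _ ≤ ∫ r in Ioc 0 h, 5 * phw Y u * |gd m1 m2 r u| := by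
          refine integral_mono_of_nonneg (Eventually.of_forall fun r => abs_nonneg _) (((gd_intr m1 m2 u h).abs).const_mul _) ?_
          refine (ae_restrict_iff' measurableSet_Ioc).2 (Eventually.of_forall fun r hr => ?_)
          simp only [abs_mul]
          exact mul_le_mul_of_nonneg_right (hK _ ⟨by linarith [hr.1], by linarith [hr.2]⟩) (abs_nonneg _)
      _ = 5 * phw Y u * ∫ r in Ioc 0 h, |gd m1 m2 r u| := integral_const_mul _ _
      _ ≤ _ := by
          have : 0 ≤ ∫ r in Ioc 0 h, |gd m1 m2 r u| := integral_nonneg fun r => abs_nonneg _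
          nlinarith [mul_nonneg this hw.le]

/-- Cauchy-Schwarz on a short interval -/
lemma cs_int (f : ℝ → ℝ) (h : ℝ) (hh : 0 ≤ h) (hf : IntegrableOn f (Ioc 0 h)) (hf2 : IntegrableOn (fun r => f r ^ 2) (Ioc 0 h)) :
    (∫ r in Ioc 0 h, f r) ^ 2 ≤ h * ∫ r in Ioc 0 h, f r ^ 2 := by
  set A := ∫ r in Ioc 0 h, f r with hA
  rcases eq_or_lt_of_le hh with h0 | h0
  · subst h0; simp [hA]
  have h1 : 0 ≤ ∫ r in Ioc 0 h, (f r - A / h) ^ 2 := integral_nonneg fun r => sq_nonneg _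
  have h2 : ∫ r in Ioc 0 h, (f r - A / h) ^ 2 = (∫ r in Ioc 0 h, f r ^ 2) - 2 * (A / h) * A + h * (A / h) ^ 2 := by
    have : ∀ r, (f r - A / h) ^ 2 = f r ^ 2 - 2 * (A / h) * f r + (A / h) ^ 2 := fun r => by ring
    simp_rw [this]
    have hx : Integrable (fun r => f r ^ 2 - 2 * (A / h) * f r) (volume.restrict (Ioc 0 h)) := hf2.sub (hf.const_mul _)
    rw [integral_add hx (integrable_const _), integral_sub hf2 (hf.const_mul _), integral_const_mul, ← hA]
    simp [hh]
  rw [h2] at h1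
  have h3 : h * ((∫ r in Ioc 0 h, f r ^ 2) - 2 * (A / h) * A + h * (A / h) ^ 2) = h * (∫ r in Ioc 0 h, f r ^ 2) - A ^ 2 := by
    field_simp; ring
  nlinarith [mul_nonneg hh h1]

lemma gd_meas (r : ℝ) (hr : 0 ≤ r) : Measurable (gd m1 m2 r) := (gm_meas m1 r hr).sub (gm_meas m2 r hr)

def bd (m1 m2 : Measure ℝ) (h u : ℝ) : ℝ := gm m1 h u + gm m2 h u

lemma gd_abs_le (r h u : ℝ) (hr : r ≤ h) : |gd m1 m2 r u| ≤ bd m1 m2 h u := by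
  have h1 := gm_mono m1 r h u hr
  have h2 := gm_mono m2 r h u hr
  have h3 := gm_nonneg m1 r u
  have h4 := gm_nonneg m2 r u
  rw [gd, bd, abs_le]; constructor <;> linarith

lemma bd_nonneg (h u : ℝ) : 0 ≤ bd m1 m2 h u := add_nonneg (gm_nonneg m1 h u) (gm_nonneg m2 h u)

lemma bd_sq_int (h : ℝ) (hh : 0 ≤ h) : Integrable (fun u => bd m1 m2 h u ^ 2) := by
  have h1 : Integrable (bd m1 m2 h) := (gm_int m1 h hh).add (gm_int m2 h hh)
  have h2 : ∀ u, bd m1 m2 h u ^ 2 = bd m1 m2 h u * bd m1 m2 h u := fun u => by ring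
  simp_rw [h2]
  refine Integrable.bdd_mul (c := m1.real univ + m2.real univ) h1 h1.aestronglyMeasurable (Eventually.of_forall fun u => ?_)
  rw [Real.norm_of_nonneg (bd_nonneg m1 m2 h u)]
  exact add_le_add (gm_le m1 h u) (gm_le m2 h u)

lemma gd_sq_int (r : ℝ) (hr : 0 ≤ r) : Integrable (fun u => gd m1 m2 r u ^ 2) := by
  refine Integrable.mono' (bd_sq_int m1 m2 r hr) ((gd_meas m1 m2 r hr).pow_const 2).aestronglyMeasurable (Eventually.of_forall fun u => ?_)
  rw [Real.norm_of_nonneg (sq_nonneg _), ← sq_abs (gd m1 m2 r u)]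
  exact pow_le_pow_left₀ (abs_nonneg _) (gd_abs_le m1 m2 r r u le_rfl) 2

lemma gd_sq_int2 (h : ℝ) (hh : 0 ≤ h) : Integrable (fun q : ℝ × ℝ => gd m1 m2 q.2 q.1 ^ 2) ((volume : Measure ℝ).prod (volume.restrict (Ioc 0 h))) := by
  have h0 : Integrable (fun q : ℝ × ℝ => bd m1 m2 h q.1 ^ 2) ((volume : Measure ℝ).prod (volume.restrict (Ioc 0 h))) := by
    have := (bd_sq_int m1 m2 h hh).mul_prod (ν := volume.restrict (Ioc 0 h)) (integrable_const (1:ℝ))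
    simpa using this
  have hae : ∀ᵐ q ∂((volume : Measure ℝ).prod (volume.restrict (Ioc 0 h))), q.2 ∈ Ioc 0 h := by
    have : (volume : Measure ℝ).prod (volume.restrict (Ioc 0 h)) = ((volume : Measure ℝ).prod volume).restrict (univ ×ˢ Ioc 0 h) := by
      rw [← Measure.prod_restrict, Measure.restrict_univ]
    rw [this]
    refine (ae_restrict_iff' (MeasurableSet.univ.prod measurableSet_Ioc)).2 (Eventually.of_forall ?_)
    rintro q ⟨_, h⟩; exact h
  refine Integrable.mono' h0 ?_ ?_
  · have h1 : Measurable (fun q : ℝ × ℝ => ((m1.real (Iic (q.1 + q.2)) - m1.real (Iic q.1)) - (m2.real (Iic (q.1 + q.2)) - m2.real (Iic q.1))) ^ 2) :=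
      ((((gm_meas2 m1).comp measurable_swap).sub ((gm_meas2 m2).comp measurable_swap)).pow_const 2)
    refine h1.aestronglyMeasurable.congr ?_
    filter_upwards [hae] with q hq
    rw [gd, gm_eq m1 _ _ hq.1.le, gm_eq m2 _ _ hq.1.le]
  · filter_upwards [hae] with q hq
    rw [Real.norm_of_nonneg (sq_nonneg _), ← sq_abs (gd m1 m2 q.2 q.1)]
    exact pow_le_pow_left₀ (abs_nonneg _) (gd_abs_le m1 m2 q.2 h q.1 hq.2) 2

lemma comp_L2 (Y h M : ℝ) (hh : 0 < h) (hh2 : h ≤ 1/2) (hDm : AEStronglyMeasurable (Dd Y m1 m2 h))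
    (hM : ∀ r, 0 ≤ r → r ≤ h → ∫ u, gd m1 m2 r u ^ 2 ≤ M) :
    Integrable (fun u => Dd Y m1 m2 h u ^ 2) ∧
    |(∫ u, Dd Y m1 m2 h u ^ 2) - ∫ u, gd m1 m2 h u ^ 2| ≤ 400 * h * M := by
  set g := gd m1 m2 h with hg
  set D := Dd Y m1 m2 h with hD
  set Q : ℝ → ℝ := fun u => ∫ r in Ioc 0 h, gd m1 m2 r u ^ 2 with hQ
  have hQi : Integrable Q := (gd_sq_int2 m1 m2 h hh.le).integral_prod_left
  have hgi : Integrable (fun u => g u ^ 2) := gd_sq_int m1 m2 h hh.le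
  have hQM : ∫ u, Q u ≤ h * M := by
    rw [hQ]
    rw [integral_integral_swap (f := fun u r => gd m1 m2 r u ^ 2) (gd_sq_int2 m1 m2 h hh.le)]
    have : ∫ r in Ioc 0 h, ∫ u, gd m1 m2 r u ^ 2 ≤ ∫ r in Ioc 0 h, M := by
      refine integral_mono_of_nonneg (Eventually.of_forall fun r => integral_nonneg fun u => sq_nonneg _) (integrable_const _) ?_
      refine (ae_restrict_iff' measurableSet_Ioc).2 (Eventually.of_forall fun r hr => hM r hr.1.le hr.2)
    simpa [hh.le] using this
  have hgM : ∫ u, g u ^ 2 ≤ M := hM h hh.le le_rfl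
  have hg0 : 0 ≤ ∫ u, g u ^ 2 := integral_nonneg fun u => sq_nonneg _
  have hpt : ∀ u, (D u - g u) ^ 2 ≤ 98 * h ^ 2 * g u ^ 2 + 98 * h * Q u := by
    intro u
    have h1 := comp_pt m1 m2 Y h u hh.le hh2
    have h2 := cs_int (fun r => |gd m1 m2 r u|) h hh.le (gd_intr m1 m2 u h).abs (by
      simp only [sq_abs]
      have hb : IntegrableOn (fun r => gd m1 m2 r u * gd m1 m2 r u) (Ioc 0 h) := by
        refine Integrable.bdd_mul (c := bd m1 m2 h u) (gd_intr m1 m2 u h) (gd_intr m1 m2 u h).aestronglyMeasurable ?_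
        exact (ae_restrict_iff' measurableSet_Ioc).2 (Eventually.of_forall fun r hr => gd_abs_le m1 m2 r h u hr.2)
      simpa only [sq] using hb)
    simp only [sq_abs] at h2
    have h3 : 0 ≤ ∫ r in Ioc 0 h, |gd m1 m2 r u| := integral_nonneg fun r => abs_nonneg _
    set B := ∫ r in Ioc 0 h, |gd m1 m2 r u|
    have h4 : (D u - g u) ^ 2 ≤ (7 * h * |g u| + 7 * B) ^ 2 := by
      rw [← sq_abs]; exact pow_le_pow_left₀ (abs_nonneg _) h1 2
    have h5 : |g u| ^ 2 = g u ^ 2 := sq_abs _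
    nlinarith [sq_nonneg (h * |g u| - B)]
  have hpt2 : ∀ u, |D u ^ 2 - g u ^ 2| ≤ h * g u ^ 2 + (1 + 1 / h) * (98 * h ^ 2 * g u ^ 2 + 98 * h * Q u) := by
    intro u
    refine le_trans ?_ (add_le_add_right (mul_le_mul_of_nonneg_left (hpt u) (by positivity)) _)
    have e : D u ^ 2 - g u ^ 2 = 2 * g u * (D u - g u) + (D u - g u) ^ 2 := by ring
    set d := D u - g u
    have e2 : h * g u ^ 2 + (1 + 1 / h) * d ^ 2 - (2 * g u * d + d ^ 2) = h * (g u - d / h) ^ 2 := by field_simp; ring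
    have e3 : h * g u ^ 2 + (1 + 1 / h) * d ^ 2 + (2 * g u * d + d ^ 2) = h * (g u + d / h) ^ 2 + 2 * d ^ 2 := by field_simp; ring
    have p1 : 0 ≤ h * (g u - d / h) ^ 2 := by positivity
    have p2 : 0 ≤ h * (g u + d / h) ^ 2 + 2 * d ^ 2 := by positivity
    rw [e, abs_le]; constructor <;> linarith
  have hRi : Integrable (fun u => h * g u ^ 2 + (1 + 1 / h) * (98 * h ^ 2 * g u ^ 2 + 98 * h * Q u)) :=
    (hgi.const_mul _).add (((hgi.const_mul _).add (hQi.const_mul _)).const_mul _)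
  have hdi : Integrable (fun u => D u ^ 2 - g u ^ 2) :=
    Integrable.mono' hRi ((hDm.pow 2).sub hgi.aestronglyMeasurable) (Eventually.of_forall hpt2)
  have hDi : Integrable (fun u => D u ^ 2) := by
    have := hdi.add hgi
    refine this.congr (Eventually.of_forall fun u => ?_)
    simp
  refine ⟨hDi, ?_⟩
  rw [← integral_sub hDi hgi]
  calc |∫ u, (D u ^ 2 - g u ^ 2)| ≤ ∫ u, |D u ^ 2 - g u ^ 2| := abs_integral_le_integral_abs
    _ ≤ ∫ u, (h * g u ^ 2 + (1 + 1 / h) * (98 * h ^ 2 * g u ^ 2 + 98 * h * Q u)) := integral_mono hdi.abs hRi hpt2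
    _ = h * (∫ u, g u ^ 2) + (1 + 1 / h) * (98 * h ^ 2 * (∫ u, g u ^ 2) + 98 * h * ∫ u, Q u) := by
        have hx : Integrable (fun u => 98 * h ^ 2 * g u ^ 2 + 98 * h * Q u) := (hgi.const_mul _).add (hQi.const_mul _)
        rw [integral_add (hgi.const_mul _) (hx.const_mul _), integral_const_mul, integral_const_mul,
          integral_add (hgi.const_mul _) (hQi.const_mul _), integral_const_mul, integral_const_mul]
    _ ≤ h * M + (1 + 1 / h) * (98 * h ^ 2 * M + 98 * h * (h * M)) := by gcongr
    _ = (h + (1 + 1/h) * (196 * h ^ 2)) * M := by ring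
    _ = (197 * h + 196 * h ^ 2) * M := by field_simp; ring
    _ ≤ _ := by
        have : 0 ≤ M := hg0.trans hgM
        refine mul_le_mul_of_nonneg_right ?_ this
        nlinarith

end

end ModF4

section ModF5
open Complex Filter MeasureTheory Real Set
open scoped Topology
def cf (Y : ℝ) (n : ℕ) : ℝ := ArithmeticFunction.vonMangoldt n * (n:ℝ) ^ (-(1/2) : ℝ) * Real.exp (-|Real.log n - Y|)

lemma cf_nonneg (Y : ℝ) (n : ℕ) : 0 ≤ cf Y n :=
  mul_nonneg (mul_nonneg ArithmeticFunction.vonMangoldt_nonneg (by positivity)) (Real.exp_pos _).le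

lemma vM_summ : Summable (fun n : ℕ => ArithmeticFunction.vonMangoldt n * (n:ℝ) ^ (-(3/2) : ℝ)) := by
  have h := (ArithmeticFunction.LSeriesSummable_vonMangoldt (s := 3/2) (by norm_num)).norm
  refine h.congr fun n => ?_
  rcases Nat.eq_zero_or_pos n with h0 | h0
  · subst h0; simp
  · rw [LSeries.norm_term_eq, if_neg h0.ne']
    have h1 : (0:ℝ) < n := by exact_mod_cast h0
    rw [Real.rpow_neg h1.le, Complex.norm_real, Real.norm_of_nonneg ArithmeticFunction.vonMangoldt_nonneg]
    norm_num [div_eq_mul_inv]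

lemma cf_summ (Y : ℝ) : Summable (cf Y) := by
  refine Summable.of_nonneg_of_le (cf_nonneg Y) (fun n => ?_) (vM_summ.mul_left (Real.exp Y))
  rcases Nat.eq_zero_or_pos n with h0 | h0
  · subst h0; simp [cf]
  · have h1 : (0:ℝ) < n := by exact_mod_cast h0
    have h2 : Real.exp (-|Real.log n - Y|) ≤ Real.exp Y * (n:ℝ) ^ (-1:ℝ) := by
      rw [Real.rpow_def_of_pos h1, ← Real.exp_add, Real.exp_le_exp]
      linarith [le_abs_self (Real.log n - Y)]
    have h3 : (n:ℝ) ^ (-(3/2) : ℝ) = (n:ℝ) ^ (-(1/2) : ℝ) * (n:ℝ) ^ (-1:ℝ) := by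
      rw [← Real.rpow_add h1]; norm_num
    rw [cf, h3]
    calc _ ≤ ArithmeticFunction.vonMangoldt n * (n:ℝ) ^ (-(1/2) : ℝ) * (Real.exp Y * (n:ℝ) ^ (-1:ℝ)) :=
          mul_le_mul_of_nonneg_left h2 (mul_nonneg ArithmeticFunction.vonMangoldt_nonneg (by positivity))
      _ = _ := by ring

def mu1 (Y : ℝ) : Measure ℝ := Measure.sum (fun n : ℕ => ENNReal.ofReal (cf Y n) • Measure.dirac (Real.log n))

instance (Y : ℝ) : IsFiniteMeasure (mu1 Y) := by
  constructor
  rw [mu1, Measure.sum_apply _ MeasurableSet.univ]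
  simp only [Measure.smul_apply, measure_univ, smul_eq_mul, mul_one]
  rw [← ENNReal.ofReal_tsum_of_nonneg (cf_nonneg Y) (cf_summ Y)]
  exact ENNReal.ofReal_lt_top

def dn (Y v : ℝ) : ℝ := Real.exp (v / 2 - |v - Y|)
lemma dn_cont (Y : ℝ) : Continuous (dn Y) := by unfold dn; fun_prop

lemma dn_int (Y : ℝ) : IntegrableOn (dn Y) (Ioi 0) := by
  have h := (exp_neg_integrableOn_Ioi 0 (by norm_num : (0:ℝ) < 1/2)).const_mul (Real.exp Y)
  refine Integrable.mono' h (dn_cont Y).aestronglyMeasurable (Eventually.of_forall fun v => ?_)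
  rw [dn, Real.norm_of_nonneg (Real.exp_pos _).le, ← Real.exp_add, Real.exp_le_exp]
  linarith [le_abs_self (v - Y)]

def mu2 (Y : ℝ) : Measure ℝ := (volume.restrict (Ioi 0)).withDensity (fun v => ENNReal.ofReal (dn Y v))

instance (Y : ℝ) : IsFiniteMeasure (mu2 Y) := isFiniteMeasure_withDensity_ofReal (dn_int Y).2

lemma int_mu1 {E : Type*} [NormedAddCommGroup E] [NormedSpace ℝ E] [CompleteSpace E] (Y : ℝ) (f : ℝ → E) (hf : Integrable f (mu1 Y)) : ∫ v, f v ∂(mu1 Y) = ∑' n : ℕ, cf Y n • f (Real.log n) := by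
  rw [mu1] at hf ⊢
  rw [integral_sum_measure hf]
  congr 1; ext n
  rw [integral_smul_measure, integral_dirac, ENNReal.toReal_ofReal (cf_nonneg Y n)]

lemma int_mu2 {E : Type*} [NormedAddCommGroup E] [NormedSpace ℝ E] (Y : ℝ) (f : ℝ → E) : ∫ v, f v ∂(mu2 Y) = ∫ v in Ioi (0:ℝ), dn Y v • f v := by
  rw [mu2, integral_withDensity_eq_integral_toReal_smul (by have := dn_cont Y; fun_prop) (Eventually.of_forall fun _ => ENNReal.ofReal_lt_top)]
  congr 1; ext v
  rw [ENNReal.toReal_ofReal (show 0 ≤ dn Y v from (Real.exp_pos _).le)]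

lemma exp_int (m : Measure ℝ) [IsFiniteMeasure m] (t : ℝ) : Integrable (fun v : ℝ => Complex.exp (-(I * t * v))) m := by
  refine Integrable.mono' (integrable_const (1:ℝ)) (by apply Continuous.aestronglyMeasurable; fun_prop) (Eventually.of_forall fun v => ?_)
  rw [Complex.norm_exp]; simp

lemma kap_shift (Y t v : ℝ) : Complex.exp (-(I * t * Y)) * kap t (v - Y) = (Real.exp (-|v - Y|) : ℂ) * Complex.exp (-(I * t * v)) := by
  unfold kap
  rw [Complex.ofReal_exp, ← Complex.exp_add, ← Complex.exp_add]
  congr 1; push_cast; ring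

lemma FT_mu (Y t : ℝ) : (∫ v, Complex.exp (-(I * t * v)) ∂(mu1 Y)) - ∫ v, Complex.exp (-(I * t * v)) ∂(mu2 Y)
    = Complex.exp (-(I * t * Y)) * Bf Y t := by
  rw [Bf, mul_sub, int_mu1 Y _ (exp_int _ t), int_mu2, ← tsum_mul_left, ← integral_const_mul]
  congr 1
  · congr 1; ext n
    rw [cf]
    generalize Real.log (n:ℝ) = r
    have := kap_shift Y t r
    calc _ = ((ArithmeticFunction.vonMangoldt n * (n:ℝ) ^ (-(1/2) : ℝ) : ℝ) : ℂ) * ((Real.exp (-|r - Y|) : ℂ) * Complex.exp (-(I * t * r))) := by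
          rw [Complex.real_smul, Complex.ofReal_mul]; ring
      _ = _ := by rw [← this]; ring
  · refine setIntegral_congr_fun measurableSet_Ioi fun v _ => ?_
    have := kap_shift Y t v
    have e : dn Y v = Real.exp (v / 2) * Real.exp (-|v - Y|) := by rw [dn, ← Real.exp_add]; rfl
    rw [e, Complex.real_smul, Complex.ofReal_mul, mul_assoc, ← this, Complex.ofReal_exp]
    push_cast
    rw [show (v:ℂ)/2 = 1/2 * v by ring]; ring

lemma Bf_cont (Y : ℝ) : Continuous (Bf Y) := by
  have h : ∀ m : Measure ℝ, IsFiniteMeasure m → Continuous (fun t : ℝ => ∫ v, Complex.exp (-(I * t * v)) ∂m) := by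
    intro m _
    refine continuous_of_dominated (bound := fun _ => 1) (fun t => by apply Continuous.aestronglyMeasurable; fun_prop) (fun t => Eventually.of_forall fun v => ?_) (integrable_const _) (Eventually.of_forall fun v => by fun_prop)
    rw [Complex.norm_exp]; simp
  have e : Bf Y = fun t : ℝ => Complex.exp (I * t * Y) * ((∫ v, Complex.exp (-(I * t * v)) ∂(mu1 Y)) - ∫ v, Complex.exp (-(I * t * v)) ∂(mu2 Y)) := by
    ext t
    rw [FT_mu, ← mul_assoc, ← Complex.exp_add]; simp
  rw [e]
  have h1 := h (mu1 Y) inferInstance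
  have h2 := h (mu2 Y) inferInstance
  fun_prop

lemma Bf_norm (Y t : ℝ) : ‖Bf Y t‖ = ‖(∫ v, Complex.exp (-(I * t * v)) ∂(mu1 Y)) - ∫ v, Complex.exp (-(I * t * v)) ∂(mu2 Y)‖ := by
  rw [FT_mu, norm_mul, Complex.norm_exp]; simp

lemma Bf_neg (Y t : ℝ) : ‖Bf Y (-t)‖ = ‖Bf Y t‖ := by
  rw [Bf_norm, Bf_norm, ← RCLike.norm_conj ((∫ v, Complex.exp (-(I * t * v)) ∂(mu1 Y)) - _), map_sub, ← integral_conj, ← integral_conj]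
  simp only [← Complex.exp_conj]
  simp

/-- Plancherel for window counts -/
lemma gd_planch (Y r : ℝ) (hr : 0 ≤ r) : Integrable (fun t => ‖ah r t‖ ^ 2 * ‖Bf Y t‖ ^ 2) ∧
    ∫ u, gd (mu1 Y) (mu2 Y) r u ^ 2 = (1 / π) * ∫ t in Ioi (0:ℝ), ‖ah r t‖ ^ 2 * ‖Bf Y t‖ ^ 2 := by
  have i1 := (gm_int (mu1 Y) r hr).ofReal (𝕜 := ℂ)
  have i2 := (gm_int (mu2 Y) r hr).ofReal (𝕜 := ℂ)
  set f : ℝ → ℂ := fun u => ((gd (mu1 Y) (mu2 Y) r u : ℝ) : ℂ) with hf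
  have ef : f = fun u => ((gm (mu1 Y) r u : ℝ) : ℂ) - ((gm (mu2 Y) r u : ℝ) : ℂ) := by
    ext u; simp [hf, gd]
  have hfi : Integrable f := by rw [ef]; exact i1.sub i2
  have h2 : MemLp f 2 := by
    rw [memLp_two_iff_integrable_sq_norm hfi.aestronglyMeasurable]
    refine (gd_sq_int (mu1 Y) (mu2 Y) r hr).congr (Eventually.of_forall fun u => ?_)
    simp [hf]
  have hFT : ∀ t, ‖FT f t‖ ^ 2 = ‖ah r t‖ ^ 2 * ‖Bf Y t‖ ^ 2 := by
    intro t
    have : FT f t = FT (fun u => ((gm (mu1 Y) r u : ℝ) : ℂ)) t - FT (fun u => ((gm (mu2 Y) r u : ℝ) : ℂ)) t := by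
      unfold FT
      rw [← integral_sub]
      · rw [ef]; congr 1; ext u; ring
      · refine Integrable.bdd_mul (c := 1) i1 (by apply Continuous.aestronglyMeasurable; fun_prop) (Eventually.of_forall fun u => ?_)
        rw [Complex.norm_exp]; simp
      · refine Integrable.bdd_mul (c := 1) i2 (by apply Continuous.aestronglyMeasurable; fun_prop) (Eventually.of_forall fun u => ?_)
        rw [Complex.norm_exp]; simp
    rw [this, gm_FT _ r t hr, gm_FT _ r t hr, ← mul_sub, norm_mul, ← Bf_norm, mul_pow]
  obtain ⟨p1, p2⟩ := plancherel_FT f hfi h2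
  simp only [hFT] at p1 p2
  refine ⟨p1, ?_⟩
  rw [half_even (f := fun t => ‖ah r t‖ ^ 2 * ‖Bf Y t‖ ^ 2) (fun t => by simp only [ah_neg, Bf_neg])] at p2
  have e : ∀ u, ‖f u‖ ^ 2 = gd (mu1 Y) (mu2 Y) r u ^ 2 := fun u => by simp [hf]
  simp only [e] at p2
  rw [p2]
  have := Real.pi_pos
  field_simp

end ModF5

section ModF6
open Complex Filter MeasureTheory Real Set
open scoped Topology
def Er (h u : ℝ) : ℝ := chebyshevPsi (Real.exp (u + h)) - chebyshevPsi (Real.exp u) - (Real.exp (max (u + h) 0) - Real.exp (max u 0))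

lemma psi_hasSum (x : ℝ) (hx : 0 ≤ x) : HasSum (fun n : ℕ => if (n:ℝ) ≤ x then ArithmeticFunction.vonMangoldt n else 0) (chebyshevPsi x) := by
  have h1 : chebyshevPsi x = ∑ n ∈ Finset.Iic ⌊x⌋₊, (if (n:ℝ) ≤ x then ArithmeticFunction.vonMangoldt n else 0) := by
    unfold chebyshevPsi
    refine Finset.sum_congr rfl fun n hn => ?_
    rw [if_pos]
    exact (Nat.le_floor_iff hx).1 (Finset.mem_Iic.1 hn)
  rw [h1]
  refine hasSum_sum_of_ne_finset_zero fun n hn => ?_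
  rw [if_neg]
  intro h
  exact hn (Finset.mem_Iic.2 ((Nat.le_floor_iff hx).2 h))

lemma psi_mono : Monotone chebyshevPsi := by
  intro a b hab
  unfold chebyshevPsi
  exact Finset.sum_le_sum_of_subset_of_nonneg (Finset.Iic_subset_Iic.2 (Nat.floor_le_floor hab)) (fun _ _ _ => ArithmeticFunction.vonMangoldt_nonneg)

lemma phw_on_int (m : Measure ℝ) [IsFiniteMeasure m] (Y u h : ℝ) : IntegrableOn (phw Y) (Ioc u (u + h)) m := by
  refine Integrable.mono' (integrable_const (phw Y u * Real.exp (3/2 * h))) (phw_cont Y).aestronglyMeasurable ?_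
  refine (ae_restrict_iff' measurableSet_Ioc).2 (Eventually.of_forall fun v hv => ?_)
  rw [Real.norm_of_nonneg (phw_pos Y v).le]
  exact (phw_ratio Y u v h hv.1.le hv.2).1

lemma mu1_phw (Y u h : ℝ) (hh : 0 ≤ h) : ∫ v in Ioc u (u + h), phw Y v ∂(mu1 Y) = chebyshevPsi (Real.exp (u + h)) - chebyshevPsi (Real.exp u) := by
  rw [← integral_indicator measurableSet_Ioc, int_mu1 Y _ ((phw_on_int (mu1 Y) Y u h).integrable_indicator measurableSet_Ioc)]
  refine HasSum.tsum_eq ?_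
  refine ((psi_hasSum (Real.exp (u + h)) (Real.exp_pos _).le).sub (psi_hasSum (Real.exp u) (Real.exp_pos _).le)).congr_fun fun n => ?_
  rcases Nat.eq_zero_or_pos n with h0 | h0
  · subst h0; simp [cf]
  · have h1 : (0:ℝ) < n := by exact_mod_cast h0
    have a1 : (n:ℝ) ≤ Real.exp (u + h) ↔ Real.log n ≤ u + h := (Real.log_le_iff_le_exp h1).symm
    have a2 : (n:ℝ) ≤ Real.exp u ↔ Real.log n ≤ u := (Real.log_le_iff_le_exp h1).symm
    have h2 : cf Y n * phw Y (Real.log n) = ArithmeticFunction.vonMangoldt n := by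
      rw [cf, phw, Real.rpow_def_of_pos h1, mul_assoc, mul_assoc, ← Real.exp_add, ← Real.exp_add]
      rw [show Real.log n * -(1/2) + (-|Real.log n - Y| + (Real.log n / 2 + |Real.log n - Y|)) = 0 by ring]
      simp
    simp only [a1, a2]
    by_cases c1 : Real.log n ≤ u
    · rw [if_pos (by linarith), if_pos c1, indicator_of_notMem (by intro h; exact absurd h.1 (by linarith))]; simp
    · by_cases c2 : Real.log n ≤ u + h
      · rw [if_pos c2, if_neg c1, indicator_of_mem (show Real.log n ∈ Ioc u (u + h) from ⟨by linarith, c2⟩), smul_eq_mul, h2]; simp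
      · rw [if_neg c2, if_neg c1, indicator_of_notMem (by intro h; exact c2 h.2)]; simp

lemma mu2_phw (Y u h : ℝ) (hh : 0 ≤ h) : ∫ v in Ioc u (u + h), phw Y v ∂(mu2 Y) = Real.exp (max (u + h) 0) - Real.exp (max u 0) := by
  rw [← integral_indicator measurableSet_Ioc, int_mu2]
  have e : ∀ v, dn Y v • (Ioc u (u + h)).indicator (phw Y) v = (Ioc u (u + h)).indicator Real.exp v := by
    intro v
    by_cases hv : v ∈ Ioc u (u + h)
    · rw [indicator_of_mem hv, indicator_of_mem hv, smul_eq_mul, dn, phw, ← Real.exp_add]; congr 1; ring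
    · rw [indicator_of_notMem hv, indicator_of_notMem hv]; simp
  simp_rw [e]
  rw [setIntegral_indicator measurableSet_Ioc]
  have : Ioi 0 ∩ Ioc u (u + h) = Ioc (max u 0) (max (u + h) 0) := by
    ext v
    simp only [mem_inter_iff, mem_Ioi, mem_Ioc, max_lt_iff, le_max_iff]
    constructor
    · rintro ⟨a, b, c⟩; exact ⟨⟨b, a⟩, Or.inl c⟩
    · rintro ⟨⟨a, b⟩, c | c⟩
      · exact ⟨b, a, c⟩
      · exact absurd b (by linarith)
  rw [this, ← intervalIntegral.integral_of_le (max_le_max_right 0 (by linarith)), integral_exp]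

lemma Dd_eq (Y u h : ℝ) (hh : 0 ≤ h) : Dd Y (mu1 Y) (mu2 Y) h u = Er h u / phw Y u := by
  rw [Dd, mu1_phw Y u h hh, mu2_phw Y u h hh, Er]

lemma Er_meas (h : ℝ) : Measurable (Er h) := by
  unfold Er
  have h1 : Measurable chebyshevPsi := psi_mono.measurable
  fun_prop

def fE (h u : ℝ) : ℝ := Real.exp (-u) * Er h u ^ 2

lemma fE_nonneg (h u : ℝ) : 0 ≤ fE h u := by unfold fE; positivity
lemma fE_meas (h : ℝ) : Measurable (fE h) := by
  unfold fE; have := Er_meas h; fun_prop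

lemma Dd_sq (Y u h : ℝ) (hh : 0 ≤ h) : Dd Y (mu1 Y) (mu2 Y) h u ^ 2 = Real.exp (-(2 * |u - Y|)) * fE h u := by
  rw [Dd_eq Y u h hh, fE, div_pow, phw, ← Real.exp_nat_mul, ← mul_assoc, ← Real.exp_add, div_eq_mul_inv, ← Real.exp_neg, mul_comm]
  congr 2; push_cast; ring

def SS (h Y : ℝ) : ℝ := ∫ u, Real.exp (-(2 * |u - Y|)) * fE h u
def Nh (h Y : ℝ) : ℝ := ∫ t in Ioi (0:ℝ), ‖ah h t‖ ^ 2 * ‖Bf Y t‖ ^ 2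

theorem FF (Y h M : ℝ) (hh : 0 < h) (hh2 : h ≤ 1/2) (hM : ∀ r, 0 ≤ r → r ≤ h → Nh r Y ≤ M) :
    Integrable (fun u => Real.exp (-(2 * |u - Y|)) * fE h u) ∧ |SS h Y - (1/π) * Nh h Y| ≤ 400 * h * ((1/π) * M) := by
  have hp := Real.pi_pos
  have h1 : Dd Y (mu1 Y) (mu2 Y) h = fun u => Er h u / phw Y u := funext fun u => Dd_eq Y u h hh.le
  have := comp_L2 (mu1 Y) (mu2 Y) Y h ((1/π) * M) hh hh2 (by
    rw [h1]; exact ((Er_meas h).div (phw_cont Y).measurable).aestronglyMeasurable) (fun r r0 r1 => by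
      rw [(gd_planch Y r r0).2]
      exact mul_le_mul_of_nonneg_left (hM r r0 r1) (by positivity))
  simp only [Dd_sq Y _ h hh.le, (gd_planch Y h hh.le).2] at this
  exact this

end ModF6

section ModG1
open Complex Filter MeasureTheory Real Set
open scoped Topology
def zterm (Y t : ℝ) (γ : ZZ) : ℂ := (mz γ : ℂ) * (Complex.exp ((γ:ℝ) * I * Y) * (2 / (1 + (t - γ) ^ 2 : ℝ) : ℝ))

lemma inv_le_wt (u : ℝ) : 1 / (1 + u ^ 2) ≤ wt u := by
  unfold wt
  rw [one_div, ← Real.rpow_neg_one]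
  exact Real.rpow_le_rpow_of_exponent_le (by nlinarith [sq_nonneg u]) (by norm_num)

lemma zterm_norm (Y t : ℝ) (γ : ZZ) : ‖zterm Y t γ‖ = 2 * (mz γ * (1 / (1 + (t - γ) ^ 2))) := by
  unfold zterm
  have h : 0 < 1 + (t - γ) ^ 2 := by positivity
  rw [norm_mul, norm_mul, Complex.norm_real, Complex.norm_exp, Real.norm_of_nonneg (by positivity), Complex.norm_natCast]
  simp
  ring

def aw (u : ℝ) : ℝ := (1 + u ^ 2) ^ (-(3/8) : ℝ)
lemma aw_pos (u : ℝ) : 0 < aw u := by unfold aw; positivity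

lemma inv_split (u : ℝ) : 1 / (1 + u ^ 2) = aw u * wt u := by
  unfold aw wt
  rw [← Real.rpow_add (by positivity), one_div, ← Real.rpow_neg_one]; norm_num

lemma aw_anti (u v : ℝ) (h : |v| ≤ |u|) : aw u ≤ aw v := by
  unfold aw
  have := sq_le_sq.2 h
  exact Real.rpow_le_rpow_of_nonpos (by positivity) (by linarith) (by norm_num)

lemma zterm_bd (Y t T : ℝ) (γ : ZZ) (h : |t| ≤ |t - γ| ∨ |t - T| ≤ |t - γ|) : ‖zterm Y t γ‖ ≤ 2 * (aw t + aw (t - T)) * (mz γ * wt (t - γ)) := by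
  rw [zterm_norm, inv_split]
  have : aw (t - γ) ≤ aw t + aw (t - T) := by
    rcases h with h | h
    · linarith [aw_anti _ _ h, aw_pos (t - T)]
    · linarith [aw_anti _ _ h, aw_pos t]
  have hw : (0:ℝ) ≤ mz γ * wt (t - γ) := mul_nonneg (by positivity) (wt_pos _).le
  nlinarith

lemma zsum_bd : ∃ C : ℝ, 0 < C ∧ ∀ (Y t T : ℝ) (P : ZZ → Prop) [DecidablePred P], (∀ γ, P γ → |t| ≤ |t - (γ:ℝ)| ∨ |t - T| ≤ |t - (γ:ℝ)|) →
    ‖∑' γ : ZZ, if P γ then zterm Y t γ else 0‖ ≤ C * Lg t * (aw t + aw (t - T)) := by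
  obtain ⟨C, hC, h⟩ := zz_wsum
  refine ⟨2 * C, by positivity, fun Y t T P _ hP => ?_⟩
  obtain ⟨hs, hb⟩ := h t
  have hpos : 0 ≤ aw t + aw (t - T) := add_nonneg (aw_pos _).le (aw_pos _).le
  have := tsum_of_norm_bounded (f := fun γ : ZZ => if P γ then zterm Y t γ else 0) (hs.hasSum.mul_left (2 * (aw t + aw (t - T)))) (fun γ => by
    split_ifs with hh
    · exact zterm_bd Y t T γ (hP γ hh)
    · simp only [norm_zero]
      exact mul_nonneg (by linarith) (mul_nonneg (by positivity) (wt_pos _).le))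
  refine this.trans ?_
  nlinarith

lemma zterm_summ (Y t : ℝ) : Summable (zterm Y t) := by
  obtain ⟨C, hC, h⟩ := zz_wsum
  refine Summable.of_norm_bounded ((h t).1.mul_left 2) fun γ => ?_
  rw [zterm_norm]
  have := mul_le_mul_of_nonneg_left (inv_le_wt (t - γ)) (by positivity : (0:ℝ) ≤ mz γ)
  linarith

lemma Zs_bd : ∃ C : ℝ, 0 < C ∧ ∀ Y t : ℝ, ‖Zs Y t‖ ≤ C * Lg t := by
  obtain ⟨C, hC, h⟩ := zz_wsum
  refine ⟨2 * C, by positivity, fun Y t => ?_⟩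
  have := tsum_of_norm_bounded (f := zterm Y t) ((h t).1.hasSum.mul_left 2) (fun γ => by
    rw [zterm_norm]
    have := mul_le_mul_of_nonneg_left (inv_le_wt (t - γ)) (by positivity : (0:ℝ) ≤ mz γ)
    linarith)
  have h2 := (h t).2
  have e : Zs Y t = ∑' γ, zterm Y t γ := rfl
  rw [e]; linarith

lemma Bf_bd (hRH : RiemannHypothesis) : ∃ C : ℝ, 0 < C ∧ ∀ Y t : ℝ, 0 ≤ Y → ‖Bf Y t‖ ≤ C * Lg t := by
  obtain ⟨C, hC, h⟩ := explicit hRH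
  obtain ⟨D, hD, h'⟩ := Zs_bd
  refine ⟨C + D, by positivity, fun Y t hY => ?_⟩
  have h1 := h Y t
  have h2 := h' Y t
  have h3 : Real.exp (-Y/10) ≤ 1 := Real.exp_le_one_iff.2 (by linarith)
  have h4 := Lg_half t
  have h5 : ‖Bf Y t‖ ≤ ‖Bf Y t + Zs Y t‖ + ‖Zs Y t‖ := by
    have := norm_sub_le (Bf Y t + Zs Y t) (Zs Y t)
    simpa using this
  have h6 : C * Real.exp (-Y/10) * Lg t ≤ C * 1 * Lg t := by gcongr
  linarith

/-- tails -/
lemma Lg_mul (T s : ℝ) (hT : 1 ≤ T) : Lg (T * s) ≤ Lg T + Lg s := by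
  unfold Lg
  rw [← Real.log_mul (by positivity) (by positivity)]
  refine Real.log_le_log (by positivity) ?_
  rw [abs_mul, abs_of_pos (by linarith : 0 < T)]
  nlinarith [abs_nonneg s]

lemma Lg_cont : Continuous Lg := by
  unfold Lg
  refine Continuous.log (by fun_prop) fun t => by positivity

lemma tail1 : IntegrableOn (fun s : ℝ => (1 + Lg s) ^ 2 / s ^ 2) (Ioi 1) := by
  have h := (integrableOn_Ioi_rpow_of_lt (by norm_num : (-(7/4):ℝ) < -1) one_pos).const_mul 10000
  refine Integrable.mono' h ?_ ?_
  · refine ContinuousOn.aestronglyMeasurable ?_ measurableSet_Ioi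
    refine ContinuousOn.div (by have := Lg_cont; fun_prop) (by fun_prop) fun s hs => ?_
    have : (1:ℝ) < s := hs
    positivity
  · refine (ae_restrict_iff' measurableSet_Ioi).2 (Eventually.of_forall fun s hs => ?_)
    have hs1 : (1:ℝ) < s := hs
    have hs0 : (0:ℝ) < s := by linarith
    rw [Real.norm_of_nonneg (by positivity)]
    have h1 := Lg_rpow s
    have h2 : (1 + s ^ 2) ^ (1/16:ℝ) ≤ 2 * s ^ (1/8:ℝ) := by
      calc (1 + s ^ 2) ^ (1/16:ℝ) ≤ (2 * s ^ 2) ^ (1/16:ℝ) := Real.rpow_le_rpow (by positivity) (by nlinarith) (by norm_num)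
        _ = 2 ^ (1/16:ℝ) * s ^ (1/8:ℝ) := by
            rw [Real.mul_rpow (by norm_num) (by positivity), ← Real.rpow_natCast s 2, ← Real.rpow_mul hs0.le]; norm_num
        _ ≤ 2 * s ^ (1/8:ℝ) := by
            refine mul_le_mul_of_nonneg_right ?_ (by positivity)
            calc (2:ℝ) ^ (1/16:ℝ) ≤ 2 ^ (1:ℝ) := Real.rpow_le_rpow_of_exponent_le (by norm_num) (by norm_num)
              _ = 2 := by simp
    have h3 : (1:ℝ) ≤ s ^ (1/8:ℝ) := Real.one_le_rpow hs1.le (by norm_num)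
    have h4 : 1 + Lg s ≤ 100 * s ^ (1/8:ℝ) := by linarith
    have h5 : 0 ≤ 1 + Lg s := by linarith [Lg_half s]
    have h6 : (s ^ (1/8:ℝ)) ^ 2 = s ^ (-(7/4):ℝ) * s ^ 2 := by
      rw [← Real.rpow_natCast (s ^ (1/8:ℝ)) 2, ← Real.rpow_mul hs0.le, ← Real.rpow_natCast s 2, ← Real.rpow_add hs0]; norm_num
    rw [div_le_iff₀ (by positivity)]
    calc (1 + Lg s) ^ 2 ≤ (100 * s ^ (1/8:ℝ)) ^ 2 := pow_le_pow_left₀ h5 h4 2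
      _ = _ := by rw [mul_pow, h6]; ring

lemma tail_bd : ∃ C : ℝ, 0 < C ∧ ∀ T : ℝ, 1 ≤ T → IntegrableOn (fun t => Lg t ^ 2 / t ^ 2) (Ioi T) ∧
    ∫ t in Ioi T, Lg t ^ 2 / t ^ 2 ≤ C * Lg T ^ 2 / T := by
  set A := ∫ s in Ioi (1:ℝ), (1 + Lg s) ^ 2 / s ^ 2
  have hA : 0 ≤ A := setIntegral_nonneg measurableSet_Ioi fun s _ => by positivity
  refine ⟨4 * A + 1, by positivity, fun T hT => ?_⟩
  have hT0 : 0 < T := by linarith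
  have hL := Lg_half T
  constructor
  · refine Integrable.mono' (tail1.mono_set (Ioi_subset_Ioi hT)) ?_ (Eventually.of_forall fun s => ?_)
    · refine ContinuousOn.aestronglyMeasurable ?_ measurableSet_Ioi
      refine ContinuousOn.div (by have := Lg_cont; fun_prop) (by fun_prop) fun s hs => ?_
      have : T < s := hs
      have : 0 < s := by linarith
      positivity
    · rw [Real.norm_of_nonneg (by positivity)]
      have := Lg_half s
      gcongr; linarith
  · have h1 := integral_comp_mul_left_Ioi (fun t => Lg t ^ 2 / t ^ 2) 1 hT0
    rw [mul_one, smul_eq_mul] at h1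
    have h2 : ∫ t in Ioi T, Lg t ^ 2 / t ^ 2 = T * ∫ x in Ioi 1, Lg (T * x) ^ 2 / (T * x) ^ 2 := by
      rw [h1]; field_simp
    rw [h2]
    have h3 : ∫ x in Ioi 1, Lg (T * x) ^ 2 / (T * x) ^ 2 ≤ ∫ x in Ioi (1:ℝ), (4 * Lg T ^ 2 / T ^ 2) * ((1 + Lg x) ^ 2 / x ^ 2) := by
      refine integral_mono_of_nonneg (Eventually.of_forall fun x => by positivity) (tail1.const_mul _) ?_
      refine (ae_restrict_iff' measurableSet_Ioi).2 (Eventually.of_forall fun x hx => ?_)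
      have hx1 : (1:ℝ) < x := hx
      have hx0 : (0:ℝ) < x := by linarith
      have h4 := Lg_mul T x hT
      have h5 : Lg (T * x) ≤ 2 * Lg T * (1 + Lg x) := by nlinarith [Lg_half x]
      have h6 := Lg_half (T * x)
      simp only
      rw [mul_pow, div_mul_div_comm]
      gcongr
      calc Lg (T * x) ^ 2 ≤ (2 * Lg T * (1 + Lg x)) ^ 2 := pow_le_pow_left₀ (by linarith) h5 2
        _ = _ := by ring
    rw [integral_const_mul] at h3
    calc T * ∫ x in Ioi 1, Lg (T * x) ^ 2 / (T * x) ^ 2 ≤ T * ((4 * Lg T ^ 2 / T ^ 2) * A) := mul_le_mul_of_nonneg_left h3 hT0.le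
      _ = 4 * A * Lg T ^ 2 / T := by field_simp
      _ ≤ _ := by gcongr; linarith

end ModG1

section ModG2
open Complex Filter MeasureTheory Real Set
open scoped Topology
lemma Lg_mono {a b : ℝ} (h : |a| ≤ |b|) : Lg a ≤ Lg b := by
  unfold Lg; exact Real.log_le_log (by positivity) (by linarith)

def kerB (h Y t : ℝ) : ℝ := ‖ah h t‖ ^ 2 * ‖Bf Y t‖ ^ 2

lemma kerB_cont (h Y : ℝ) : Continuous (kerB h Y) := by
  unfold kerB
  have := ah_cont h; have := Bf_cont Y
  fun_prop

lemma kerB_int (h Y : ℝ) (hh : 0 ≤ h) : Integrable (kerB h Y) := (gd_planch Y h hh).1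

lemma kerB_nonneg (h Y t : ℝ) : 0 ≤ kerB h Y t := by unfold kerB; positivity

lemma ends_bd (hRH : RiemannHypothesis) : ∃ C : ℝ, 0 < C ∧ ∀ Y r T : ℝ, 0 ≤ Y → 0 ≤ r → 1 ≤ T →
    (∫ t in Ioi T, kerB r Y t ≤ C * Lg T ^ 2 / T) ∧ (∫ t in Ioc 0 T, kerB r Y t ≤ C * r ^ 2 * T * Lg T ^ 2) := by
  obtain ⟨C, hC, hB⟩ := Bf_bd hRH
  obtain ⟨D, hD, hT⟩ := tail_bd
  refine ⟨4 * C ^ 2 * D + C ^ 2, by positivity, fun Y r T hY hr h1 => ⟨?_, ?_⟩⟩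
  · obtain ⟨hi, hb⟩ := hT T h1
    have h2 : ∫ t in Ioi T, kerB r Y t ≤ ∫ t in Ioi T, 4 * C ^ 2 * (Lg t ^ 2 / t ^ 2) := by
      refine setIntegral_mono_on (kerB_int r Y hr).integrableOn (hi.const_mul _) measurableSet_Ioi fun t ht => ?_
      have ht0 : 0 < t := lt_trans (by linarith) (show T < t from ht)
      have h3 := ah_le2 r t hr ht0.ne'
      have h4 : ‖Bf Y t‖ ^ 2 ≤ (C * Lg t) ^ 2 := pow_le_pow_left₀ (norm_nonneg _) (hB Y t hY) 2
      calc kerB r Y t ≤ 4 / t ^ 2 * (C * Lg t) ^ 2 := by unfold kerB; gcongr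
        _ = _ := by ring
    rw [integral_const_mul] at h2
    have h3 : 0 ≤ C ^ 2 * Lg T ^ 2 / T := by positivity
    calc _ ≤ 4 * C ^ 2 * (D * Lg T ^ 2 / T) := h2.trans (mul_le_mul_of_nonneg_left hb (by positivity))
      _ ≤ 4 * C ^ 2 * (D * Lg T ^ 2 / T) + C ^ 2 * Lg T ^ 2 / T := by linarith
      _ = _ := by ring
  · have h2 : ∫ t in Ioc 0 T, kerB r Y t ≤ ∫ t in Ioc 0 T, r ^ 2 * (C * Lg T) ^ 2 := by
      refine setIntegral_mono_on (kerB_int r Y hr).integrableOn (integrable_const _) measurableSet_Ioc fun t ht => ?_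
      have h3 : ‖ah r t‖ ^ 2 ≤ r ^ 2 := pow_le_pow_left₀ (norm_nonneg _) (ah_le r t hr) 2
      have h5 : Lg t ≤ Lg T := Lg_mono (by rw [abs_of_pos ht.1, abs_of_pos (by linarith)]; exact ht.2)
      have h4 : ‖Bf Y t‖ ^ 2 ≤ (C * Lg T) ^ 2 := pow_le_pow_left₀ (norm_nonneg _) ((hB Y t hY).trans (mul_le_mul_of_nonneg_left h5 hC.le)) 2
      unfold kerB; gcongr
    have e : ∫ t in Ioc 0 T, r ^ 2 * (C * Lg T) ^ 2 = C ^ 2 * (r ^ 2 * T * Lg T ^ 2) := by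
      rw [setIntegral_const]; simp [abs_of_nonneg (by linarith : (0:ℝ) ≤ T), measureReal_def, ENNReal.toReal_ofReal (by linarith : (0:ℝ) ≤ T)]; ring
    rw [e] at h2
    refine h2.trans ?_
    have : 0 ≤ 4 * C ^ 2 * D * (r ^ 2 * T * Lg T ^ 2) := by positivity
    nlinarith

lemma Nh_split (r Y T : ℝ) (hr : 0 ≤ r) (hT : 0 ≤ T) : Nh r Y = (∫ t in Ioc 0 T, kerB r Y t) + ∫ t in Ioi T, kerB r Y t := by
  have : Ioi (0:ℝ) = Ioc 0 T ∪ Ioi T := (Ioc_union_Ioi_eq_Ioi hT).symm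
  rw [Nh, this]
  exact setIntegral_union (Ioc_disjoint_Ioi le_rfl) measurableSet_Ioi (kerB_int r Y hr).integrableOn (kerB_int r Y hr).integrableOn

lemma Nh_bd (hRH : RiemannHypothesis) : ∃ C : ℝ, 0 < C ∧ ∀ Y r h : ℝ, 0 ≤ Y → 0 < h → h ≤ 1/2 → 0 ≤ r → r ≤ h →
    Nh r Y ≤ C * h * Lg (1/h) ^ 2 := by
  obtain ⟨C, hC, hE⟩ := ends_bd hRH
  refine ⟨2 * C, by positivity, fun Y r h hY h0 h1 hr hrh => ?_⟩
  have hT : 1 ≤ 1 / h := by rw [le_div_iff₀ h0]; linarith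
  obtain ⟨a, b⟩ := hE Y r (1/h) hY hr hT
  rw [Nh_split r Y (1/h) hr (by positivity)]
  have e1 : C * Lg (1/h) ^ 2 / (1/h) = C * h * Lg (1/h) ^ 2 := by field_simp
  have e2 : C * r ^ 2 * (1/h) * Lg (1/h) ^ 2 ≤ C * h ^ 2 * (1/h) * Lg (1/h) ^ 2 := by gcongr
  have e3 : C * h ^ 2 * (1/h) * Lg (1/h) ^ 2 = C * h * Lg (1/h) ^ 2 := by field_simp
  linarith

end ModG2

section ModG3
open Complex Filter MeasureTheory Real Set
open scoped Topology
lemma Zfin_fin (T : ℝ) : {γ : ZZ | 0 < (γ:ℝ) ∧ (γ:ℝ) ≤ T}.Finite := by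
  refine (fin_window T).subset ?_
  rintro γ ⟨h1, h2⟩
  show |(γ:ℝ)| ≤ T
  rw [abs_of_pos h1]; exact h2

def Zfin (T : ℝ) : Finset ZZ := (Zfin_fin T).toFinset

lemma mem_Zfin (T : ℝ) (γ : ZZ) : γ ∈ Zfin T ↔ 0 < (γ:ℝ) ∧ (γ:ℝ) ≤ T := by
  unfold Zfin; rw [Set.Finite.mem_toFinset]; rfl

def Zt (T Y t : ℝ) : ℂ := ∑ γ ∈ Zfin T, zterm Y t γ

/-- the function whose Fourier transform is `Zt` -/
def zfun (T Y v : ℝ) : ℂ := ∑ γ ∈ Zfin T, (mz γ : ℂ) * Complex.exp ((γ:ℝ) * I * Y) * kap (-γ) v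

lemma kap_int (t : ℝ) : Integrable (kap t) ∧ ∫ v, kap t v = ((2 / (1 + t ^ 2) : ℝ) : ℂ) := by
  have h := kap_laplace t 0 (by simp) (by simp)
  simp only [zero_mul, Complex.exp_zero, mul_one] at h
  refine ⟨h.1, ?_⟩
  rw [h.2, Kt]
  have : (0 - I * (t:ℂ)) ^ 2 = -(t:ℂ)^2 := by
    rw [zero_sub, neg_sq, mul_pow, I_sq]; ring
  push_cast
  congr 1
  simp only [zero_sub, neg_sq, mul_pow, I_sq]; ring

lemma kap_FT (a t : ℝ) : FT (kap (-a)) t = ((2 / (1 + (t - a) ^ 2) : ℝ) : ℂ) := by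
  rw [← (kap_int (t - a)).2, FT]
  congr 1; ext v
  unfold kap
  rw [← Complex.exp_add]; congr 1; push_cast; ring

lemma kap_mul (a b : ℝ) : Integrable (fun v => kap (-a) v * (starRingEnd ℂ) (kap (-b) v)) ∧
   ∫ v, kap (-a) v * (starRingEnd ℂ) (kap (-b) v) = ((4 / (4 + (a - b) ^ 2) : ℝ) : ℂ) := by
  have e : (fun v => kap (-a) v * (starRingEnd ℂ) (kap (-b) v)) = fun v : ℝ => kap (-((a - b) / 2)) (2 * v) := by
    ext v
    unfold kap
    rw [← Complex.exp_conj, ← Complex.exp_add, abs_mul]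
    congr 1
    simp only [map_sub, map_mul, Complex.conj_ofReal, Complex.conj_I]
    push_cast
    rw [abs_of_pos (by norm_num : (0:ℝ) < 2)]
    push_cast
    ring
  rw [e]
  constructor
  · exact (kap_int _).1.comp_mul_left' (by norm_num)
  · rw [Measure.integral_comp_mul_left (kap (-((a - b) / 2))) 2, (kap_int _).2, Complex.real_smul, ← Complex.ofReal_mul]
    congr 1
    rw [abs_of_pos (by norm_num)]
    have : 0 < 4 + (a - b) ^ 2 := by positivity
    have h2 : 0 < 1 + (-((a - b) / 2)) ^ 2 := by positivity
    field_simp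
    ring

lemma kap_L2 (a : ℝ) : MemLp (kap a) 2 := by
  rw [memLp_two_iff_integrable_sq_norm (kap_cont a).aestronglyMeasurable]
  have h := (kap_mul (-a) (-a)).1.norm
  refine h.congr (Eventually.of_forall fun v => ?_)
  simp only [neg_neg, norm_mul, RCLike.norm_conj]; ring

lemma zfun_int (T Y : ℝ) : Integrable (zfun T Y) := by
  unfold zfun
  exact integrable_finsetSum _ fun γ _ => (kap_int _).1.const_mul _

lemma zfun_L2 (T Y : ℝ) : MemLp (zfun T Y) 2 := by
  unfold zfun
  exact memLp_finsetSum _ fun γ _ => (kap_L2 _).const_mul _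

lemma zfun_FT (T Y t : ℝ) : FT (zfun T Y) t = Zt T Y t := by
  have h : ∀ γ ∈ Zfin T, Integrable (fun v : ℝ => Complex.exp (-(I * t * v)) * ((mz γ : ℂ) * Complex.exp ((γ:ℝ) * I * Y) * kap (-γ) v)) := by
    intro γ _
    refine Integrable.bdd_mul (c := 1) ((kap_int _).1.const_mul _) (by apply Continuous.aestronglyMeasurable; fun_prop) (Eventually.of_forall fun u => ?_)
    rw [Complex.norm_exp]; simp
  unfold FT zfun Zt
  simp_rw [Finset.mul_sum]
  rw [integral_finsetSum _ h]
  refine Finset.sum_congr rfl fun γ _ => ?_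
  have := kap_FT γ t
  unfold FT at this
  rw [zterm, ← mul_assoc, ← this, ← integral_const_mul]
  congr 1; ext v; ring

def Phi (T Y : ℝ) : ℂ := ∑ γ ∈ Zfin T, ∑ γ' ∈ Zfin T, (mz γ * mz γ' : ℂ) * Complex.exp (I * (((γ:ℝ) - (γ':ℝ) : ℝ) : ℂ) * Y) * ((4 / (4 + ((γ:ℝ) - (γ':ℝ)) ^ 2) : ℝ) : ℂ)

lemma zfun_sq (T Y : ℝ) : ((∫ v, ‖zfun T Y v‖ ^ 2 : ℝ) : ℂ) = Phi T Y := by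
  rw [← integral_complex_ofReal]
  have e : ∀ v, ((‖zfun T Y v‖ ^ 2 : ℝ) : ℂ) = ∑ γ ∈ Zfin T, ∑ γ' ∈ Zfin T, (mz γ * mz γ' : ℂ) * Complex.exp (I * (((γ:ℝ) - (γ':ℝ) : ℝ) : ℂ) * Y) * (kap (-γ) v * (starRingEnd ℂ) (kap (-γ') v)) := by
    intro v
    rw [Complex.ofReal_pow, ← Complex.mul_conj', zfun, map_sum, Finset.sum_mul_sum]
    refine Finset.sum_congr rfl fun γ _ => Finset.sum_congr rfl fun γ' _ => ?_
    simp only [map_mul, map_natCast, ← Complex.exp_conj, Complex.conj_ofReal, Complex.conj_I]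
    rw [show I * (((γ:ℝ) - (γ':ℝ) : ℝ) : ℂ) * Y = (γ:ℝ) * I * Y + ((γ':ℝ):ℂ) * -I * Y by push_cast; ring, Complex.exp_add]
    ring
  simp_rw [e]
  rw [integral_finsetSum _ fun γ _ => integrable_finsetSum _ fun γ' _ => (kap_mul _ _).1.const_mul _]
  unfold Phi
  refine Finset.sum_congr rfl fun γ _ => ?_
  rw [integral_finsetSum _ fun γ' _ => (kap_mul _ _).1.const_mul _]
  refine Finset.sum_congr rfl fun γ' _ => ?_
  rw [integral_const_mul, (kap_mul _ _).2]

lemma Zt_sq (T Y : ℝ) : Integrable (fun t => ‖Zt T Y t‖ ^ 2) ∧ ((∫ t, ‖Zt T Y t‖ ^ 2 : ℝ) : ℂ) = 2 * π * Phi T Y := by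
  obtain ⟨p1, p2⟩ := plancherel_FT _ (zfun_int T Y) (zfun_L2 T Y)
  simp only [zfun_FT] at p1 p2
  refine ⟨p1, ?_⟩
  rw [← zfun_sq, p2]
  have := Real.pi_pos.ne'
  have h2 : (π:ℂ) ≠ 0 := by exact_mod_cast this
  push_cast
  field_simp

end ModG3

section ModG4
open Complex Filter MeasureTheory Real Set
open scoped Topology
lemma half_ne_one (γ : ℝ) : (1/2 + (γ:ℂ) * I : ℂ) ≠ 1 := by
  intro h
  have := congrArg Complex.re h
  norm_num at this

def zEquiv (hRH : RiemannHypothesis) (T : ℝ) : {γ : ZZ // γ ∈ Zfin T} ≃ zerosUpTo T where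
  toFun γ := ⟨1/2 + ((γ.1:ℝ):ℂ) * I, by
    have h := γ.1.2
    rw [zf_eq (half_ne_one _), mul_eq_zero, sub_eq_zero] at h
    have h2 := h.resolve_left (half_ne_one _)
    have h3 := (mem_Zfin T γ.1).1 γ.2
    refine ⟨⟨h2, ?_, ?_⟩, ?_, ?_⟩
    · norm_num
    · norm_num
    · simpa using h3.1
    · simpa using h3.2⟩
  invFun ρ := ⟨⟨(ρ:ℂ).im, by
    obtain ⟨⟨h1, h2, h3⟩, h4, h5⟩ := ρ.2
    have hne : (ρ:ℂ) ≠ 1 := by intro h; rw [h] at h3; simp at h3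
    have hz : zf (ρ:ℂ) = 0 := by rw [zf_eq hne, h1, mul_zero]
    have := rh_zero hRH ρ h2 hz
    rw [← this]; exact hz⟩, by
    obtain ⟨⟨h1, h2, h3⟩, h4, h5⟩ := ρ.2
    rw [mem_Zfin]; exact ⟨h4, h5⟩⟩
  left_inv γ := by
    apply Subtype.ext; apply Subtype.ext; simp
  right_inv ρ := by
    apply Subtype.ext
    obtain ⟨⟨h1, h2, h3⟩, h4, h5⟩ := ρ.2
    have hne : (ρ:ℂ) ≠ 1 := by intro h; rw [h] at h3; simp at h3
    have hz : zf (ρ:ℂ) = 0 := by rw [zf_eq hne, h1, mul_zero]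
    exact (rh_zero hRH ρ h2 hz).symm

lemma Fxt_eq (hRH : RiemannHypothesis) (T Y : ℝ) : Fxt (Real.exp Y) T = Phi T Y := by
  unfold Fxt Phi
  rw [← ((zEquiv hRH T).prodCongr (zEquiv hRH T)).tsum_eq, tsum_fintype, Fintype.sum_prod_type]
  rw [← Finset.sum_coe_sort (Zfin T)]
  refine Finset.sum_congr rfl fun γ _ => ?_
  rw [← Finset.sum_coe_sort (Zfin T)]
  refine Finset.sum_congr rfl fun γ' _ => ?_
  have e : ∀ γ : {γ : ZZ // γ ∈ Zfin T}, ((zEquiv hRH T γ : ℂ)) = 1/2 + ((γ.1:ℝ):ℂ) * I := fun γ => rfl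
  have e1 : ∀ γ : {γ : ZZ // γ ∈ Zfin T}, ((zEquiv hRH T γ : ℂ)).im = (γ.1:ℝ) := fun γ => by rw [e]; simp
  have e2 : ∀ γ : {γ : ZZ // γ ∈ Zfin T}, zetaMult ((zEquiv hRH T γ : ℂ)) = mz γ.1 := fun γ => by
    rw [e, zetaMult_eq _ (half_ne_one _)]; rfl
  simp only [Equiv.prodCongr_apply, Prod.map_fst, Prod.map_snd, e1, e2, Real.log_exp]

lemma Zt_tsum (T Y t : ℝ) : Zt T Y t = ∑' γ : ZZ, if (0 < (γ:ℝ) ∧ (γ:ℝ) ≤ T) then zterm Y t γ else 0 := by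
  rw [tsum_eq_sum (s := Zfin T)]
  · refine Finset.sum_congr rfl fun γ hγ => ?_
    rw [if_pos ((mem_Zfin T γ).1 hγ)]
  · intro γ hγ
    rw [if_neg (fun h => hγ ((mem_Zfin T γ).2 h))]

lemma Zs_sub_Zt (T Y t : ℝ) : Zs Y t - Zt T Y t = ∑' γ : ZZ, if ¬(0 < (γ:ℝ) ∧ (γ:ℝ) ≤ T) then zterm Y t γ else 0 := by
  have e : Zs Y t = ∑' γ, zterm Y t γ := rfl
  rw [e, Zt_tsum, ← Summable.tsum_sub (zterm_summ Y t)]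
  · congr 1; ext γ
    by_cases h : (0 < (γ:ℝ) ∧ (γ:ℝ) ≤ T)
    · rw [if_pos h, if_neg (not_not.2 h), sub_self]
    · rw [if_neg h, if_pos h, sub_zero]
  · refine summable_of_hasFiniteSupport ((Zfin_fin T).subset ?_)
    intro γ hγ
    by_contra h
    exact hγ (if_neg h)

def bw (u : ℝ) : ℝ := Lg u * aw u

lemma bw_pos (u : ℝ) : 0 < bw u := mul_pos (by linarith [Lg_half u]) (aw_pos u)

lemma bw_sq (u : ℝ) : bw u ^ 2 ≤ 1024 * wt u := by
  have h1 := Lg_rpow u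
  have h2 := Lg_half u
  unfold bw aw wt
  have h3' : ∀ q : ℝ, 0 < q → q ^ (-(5/8):ℝ) = (q ^ (1/16:ℝ)) ^ 2 * (q ^ (-(3/8):ℝ)) ^ 2 := by
    intro q hq
    rw [← Real.rpow_natCast, ← Real.rpow_natCast, ← Real.rpow_mul hq.le, ← Real.rpow_mul hq.le, ← Real.rpow_add hq]
    norm_num
  have h3 := h3' (1 + u ^ 2) (by positivity)
  rw [h3, mul_pow]
  calc Lg u ^ 2 * _ ≤ (32 * (1 + u ^ 2) ^ (1/16:ℝ)) ^ 2 * ((1 + u ^ 2) ^ (-(3/8):ℝ)) ^ 2 := by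
        gcongr
    _ = _ := by ring

lemma bw_cont : Continuous bw := by
  unfold bw aw
  refine Lg_cont.mul ?_
  refine Continuous.rpow_const (by fun_prop) fun u => Or.inl (by positivity)

lemma bw_int : Integrable (fun u => bw u ^ 2) := by
  refine Integrable.mono' (wt_int.const_mul 1024) (bw_cont.pow 2).aestronglyMeasurable (Eventually.of_forall fun u => ?_)
  rw [Real.norm_of_nonneg (sq_nonneg _)]; exact bw_sq u

lemma Lg_aw (t T : ℝ) : Lg t * (aw t + aw (t - T)) ≤ 4 * Lg T * (bw t + bw (t - T)) := by
  have h1 := Lg_half T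
  have h2 := Lg_half (t - T)
  have h3 : Lg t ≤ Lg (t - T) + Lg T := by have := Lg_add (t - T) T; rwa [sub_add_cancel] at this
  have h4 : Lg t ≤ 4 * Lg T * Lg (t - T) := by nlinarith
  have h5 : Lg t * aw (t - T) ≤ 4 * Lg T * bw (t - T) := by
    unfold bw; rw [← mul_assoc]; exact mul_le_mul_of_nonneg_right h4 (aw_pos _).le
  have h6 : Lg t * aw t ≤ 4 * Lg T * bw t := by
    have := bw_pos t
    have e : Lg t * aw t = bw t := rfl
    rw [e]; nlinarith
  linarith

/-- pointwise comparison of `1_{[0,T]} Bf` with `-Zt` -/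
lemma err_pt (hRH : RiemannHypothesis) : ∃ C : ℝ, 0 < C ∧ ∀ Y T t : ℝ, 0 ≤ T →
    ‖(Ioc 0 T).indicator (Bf Y) t + Zt T Y t‖ ≤ C * Lg T * (bw t + bw (t - T)) + (Ioc 0 T).indicator (fun _ => C * Real.exp (-Y/10) * Lg T) t := by
  obtain ⟨C, hC, hE⟩ := explicit hRH
  obtain ⟨D, hD, hZ⟩ := zsum_bd
  refine ⟨C + 4 * D, by positivity, fun Y T t hT => ?_⟩
  have hL := Lg_half T
  have hb : 0 < bw t + bw (t - T) := add_pos (bw_pos _) (bw_pos _)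
  have hkey : D * Lg t * (aw t + aw (t - T)) ≤ 4 * D * Lg T * (bw t + bw (t - T)) := by
    have := mul_le_mul_of_nonneg_left (Lg_aw t T) hD.le
    linarith
  have hCb : 0 ≤ C * Lg T * (bw t + bw (t - T)) := by positivity
  by_cases ht : t ∈ Ioc 0 T
  · rw [indicator_of_mem ht, indicator_of_mem ht]
    have h1 : Bf Y t + Zt T Y t = (Bf Y t + Zs Y t) - (Zs Y t - Zt T Y t) := by ring
    rw [h1, Zs_sub_Zt]
    have h2 := hZ Y t T (fun γ => ¬(0 < (γ:ℝ) ∧ (γ:ℝ) ≤ T)) (fun γ hγ => by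
      rw [not_and_or, not_lt, not_le] at hγ
      rcases hγ with h | h
      · left; rw [abs_of_pos ht.1, abs_of_pos (by linarith [ht.1])]; linarith
      · right; rw [abs_of_nonpos (by linarith [ht.2]), abs_of_neg (by linarith [ht.2])]; linarith)
    have h3 := hE Y t
    have h5 : Lg t ≤ Lg T := Lg_mono (by rw [abs_of_pos ht.1, abs_of_nonneg hT]; exact ht.2)
    have h6 : C * Real.exp (-Y/10) * Lg t ≤ (C + 4 * D) * Real.exp (-Y/10) * Lg T := by
      have := Lg_half t
      gcongr; linarith
    refine (norm_sub_le _ _).trans ?_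
    linarith
  · rw [indicator_of_notMem ht, indicator_of_notMem ht, zero_add, add_zero, Zt_tsum]
    have h2 := hZ Y t T (fun γ => (0 < (γ:ℝ) ∧ (γ:ℝ) ≤ T)) (fun γ hγ => by
      simp only [mem_Ioc, not_and_or, not_lt, not_le] at ht
      rcases ht with h | h
      · left; rw [abs_of_nonpos h, abs_of_neg (by linarith [hγ.1])]; linarith [hγ.1]
      · right; rw [abs_of_pos (by linarith), abs_of_pos (by linarith [hγ.2])]; linarith [hγ.2])
    linarith

lemma Zt_cont (T Y : ℝ) : Continuous (Zt T Y) := by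
  have : Zt T Y = FT (zfun T Y) := funext fun t => (zfun_FT T Y t).symm
  rw [this]; exact FT_cont _ (zfun_int T Y)

lemma err_L2 (hRH : RiemannHypothesis) : ∃ C : ℝ, 0 < C ∧ ∀ Y T : ℝ, 0 ≤ T →
    Integrable (fun t => ‖(Ioc 0 T).indicator (Bf Y) t + Zt T Y t‖ ^ 2) ∧
    ∫ t, ‖(Ioc 0 T).indicator (Bf Y) t + Zt T Y t‖ ^ 2 ≤ C * Lg T ^ 2 * (1 + T * Real.exp (-Y/5)) := by
  obtain ⟨C, hC, hE⟩ := err_pt hRH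
  set A := ∫ u, bw u ^ 2
  have hA : 0 ≤ A := integral_nonneg fun u => sq_nonneg _
  refine ⟨6 * C ^ 2 * (A + 1), by positivity, fun Y T hT => ?_⟩
  have i1 : Integrable (fun t => bw (t - T) ^ 2) := bw_int.comp_sub_right T
  have i2 : Integrable ((Ioc 0 T).indicator (fun _ => (C * Real.exp (-Y/10) * Lg T) ^ 2)) := by
    rw [integrable_indicator_iff measurableSet_Ioc]; exact integrable_const _
  set R : ℝ → ℝ := fun t => 3 * (C * Lg T) ^ 2 * (bw t ^ 2) + 3 * (C * Lg T) ^ 2 * (bw (t - T) ^ 2) + 3 * (Ioc 0 T).indicator (fun _ => (C * Real.exp (-Y/10) * Lg T) ^ 2) t with hR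
  have j1 : Integrable (fun t => 3 * (C * Lg T) ^ 2 * (bw t ^ 2) + 3 * (C * Lg T) ^ 2 * (bw (t - T) ^ 2)) := (bw_int.const_mul _).add (i1.const_mul _)
  have hRi : Integrable R := j1.add (i2.const_mul 3)
  have hpt : ∀ t, ‖(Ioc 0 T).indicator (Bf Y) t + Zt T Y t‖ ^ 2 ≤ R t := by
    intro t
    have h1 := pow_le_pow_left₀ (norm_nonneg _) (hE Y T t hT) 2
    refine h1.trans ?_
    have e : (Ioc 0 T).indicator (fun _ => (C * Real.exp (-Y/10) * Lg T) ^ 2) t = ((Ioc 0 T).indicator (fun _ => C * Real.exp (-Y/10) * Lg T) t) ^ 2 := by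
      by_cases ht : t ∈ Ioc 0 T
      · rw [indicator_of_mem ht, indicator_of_mem ht]
      · rw [indicator_of_notMem ht, indicator_of_notMem ht]; simp
    simp only [hR]
    rw [e]
    generalize (Ioc 0 T).indicator (fun _ => C * Real.exp (-Y/10) * Lg T) t = z
    nlinarith [sq_nonneg (C * Lg T * bw t - C * Lg T * bw (t - T)), sq_nonneg (C * Lg T * bw t - z), sq_nonneg (C * Lg T * bw (t - T) - z)]
  have hI : Integrable (fun t => ‖(Ioc 0 T).indicator (Bf Y) t + Zt T Y t‖ ^ 2) := by
    refine Integrable.mono' hRi ?_ (Eventually.of_forall fun t => ?_)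
    · exact ((((Bf_cont Y).aestronglyMeasurable.indicator measurableSet_Ioc).add (Zt_cont T Y).aestronglyMeasurable).norm).pow 2
    · rw [Real.norm_of_nonneg (sq_nonneg _)]; exact hpt t
  refine ⟨hI, (integral_mono hI hRi hpt).trans ?_⟩
  have e1 : ∫ t, R t = 3 * (C * Lg T) ^ 2 * A + 3 * (C * Lg T) ^ 2 * A + 3 * (T * (C * Real.exp (-Y/10) * Lg T) ^ 2) := by
    simp only [hR]
    rw [integral_add j1 (i2.const_mul 3), integral_add (bw_int.const_mul _) (i1.const_mul _), integral_const_mul, integral_const_mul, integral_const_mul,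
      integral_sub_right_eq_self (fun t => bw t ^ 2) T, integral_indicator measurableSet_Ioc]
    simp [hT, A]
  rw [e1]
  have e2 : Real.exp (-Y/10) ^ 2 = Real.exp (-Y/5) := by rw [← Real.exp_nat_mul]; congr 1; push_cast; ring
  rw [mul_pow (C * Real.exp (-Y/10)), mul_pow C (Real.exp (-Y/10)), e2]
  have p1 : 0 ≤ C ^ 2 * Lg T ^ 2 := by positivity
  have p2 : 0 ≤ C ^ 2 * Lg T ^ 2 * (T * Real.exp (-Y/5)) := by positivity
  nlinarith [mul_nonneg p2 hA]

end ModG4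

section ModG5
open Complex Filter MeasureTheory Real Set
open scoped Topology
def Jf (Y T : ℝ) : ℝ := ∫ t in Ioc 0 T, ‖Bf Y t‖ ^ 2

lemma sq_cmp (a b : ℂ) (η : ℝ) (hη : 0 < η) :
    |‖a‖ ^ 2 - ‖b‖ ^ 2| ≤ η * ‖b‖ ^ 2 + (1 + 1 / η) * ‖a + b‖ ^ 2 := by
  have h1 : |‖a‖ - ‖b‖| ≤ ‖a + b‖ := by
    have := abs_norm_sub_norm_le a (-b); rwa [norm_neg, sub_neg_eq_add] at this
  have hs := norm_nonneg (a + b)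
  have ha := norm_nonneg a
  have hb := norm_nonneg b
  generalize ‖a + b‖ = s at *
  generalize ‖a‖ = x at *
  generalize ‖b‖ = y at *
  have h2 : |x ^ 2 - y ^ 2| = |x - y| * (x + y) := by
    rw [← abs_of_nonneg (add_nonneg ha hb), ← abs_mul]; congr 1; ring
  rw [h2]
  have h3 : x ≤ y + s := by have := (abs_le.1 h1).2; linarith
  have h4 : |x - y| * (x + y) ≤ s * (s + 2 * y) := by
    apply mul_le_mul h1 (by linarith) (by positivity) hs
  refine h4.trans ?_
  have h5 : 0 ≤ (η * y - s) ^ 2 / η := by positivity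
  have h6 : (η * y - s) ^ 2 / η = η * y ^ 2 - 2 * s * y + 1 / η * s ^ 2 := by field_simp; ring
  rw [h6] at h5
  nlinarith

lemma Jf_cmp (hRH : RiemannHypothesis) : ∃ C : ℝ, 0 < C ∧ ∀ Y T η : ℝ, 0 ≤ T → 0 < η →
    |Jf Y T - 2 * π * (Phi T Y).re| ≤ η * (2 * π * (Phi T Y).re)
      + (1 + 1 / η) * (C * Lg T ^ 2 * (1 + T * Real.exp (-Y / 5))) := by
  obtain ⟨C, hC, H⟩ := err_L2 hRH
  refine ⟨C, hC, fun Y T η hT hη => ?_⟩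
  obtain ⟨hi, hb⟩ := H Y T hT
  obtain ⟨zi, zb⟩ := Zt_sq T Y
  have zb' : ∫ t, ‖Zt T Y t‖ ^ 2 = 2 * π * (Phi T Y).re := by
    have := congrArg Complex.re zb
    rw [Complex.ofReal_re] at this
    rw [this]
    have e : (2 * (π:ℂ)) = ((2 * π : ℝ) : ℂ) := by push_cast; rfl
    rw [e, Complex.re_ofReal_mul]
  have ji : Integrable (fun t => ‖(Ioc 0 T).indicator (Bf Y) t‖ ^ 2) := by
    have e : (fun t => ‖(Ioc 0 T).indicator (Bf Y) t‖ ^ 2) = (Ioc 0 T).indicator (fun t => ‖Bf Y t‖ ^ 2) := by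
      ext t; by_cases h : t ∈ Ioc 0 T <;> simp [h]
    rw [e, integrable_indicator_iff measurableSet_Ioc]
    exact (((Bf_cont Y).norm.pow 2).integrableOn_Icc).mono_set Ioc_subset_Icc_self
  have je : ∫ t, ‖(Ioc 0 T).indicator (Bf Y) t‖ ^ 2 = Jf Y T := by
    have e : (fun t => ‖(Ioc 0 T).indicator (Bf Y) t‖ ^ 2) = (Ioc 0 T).indicator (fun t => ‖Bf Y t‖ ^ 2) := by
      ext t; by_cases h : t ∈ Ioc 0 T <;> simp [h]
    rw [e, integral_indicator measurableSet_Ioc]; rfl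
  rw [← je, ← zb', ← integral_sub ji zi]
  refine (abs_integral_le_integral_abs).trans ?_
  have hmono : ∫ t, |‖(Ioc 0 T).indicator (Bf Y) t‖ ^ 2 - ‖Zt T Y t‖ ^ 2| ≤
      ∫ t, (η * ‖Zt T Y t‖ ^ 2 + (1 + 1 / η) * ‖(Ioc 0 T).indicator (Bf Y) t + Zt T Y t‖ ^ 2) := by
    refine integral_mono (ji.sub zi).abs ((zi.const_mul η).add (hi.const_mul _)) fun t => ?_
    exact sq_cmp _ _ η hη
  refine hmono.trans ?_
  rw [integral_add (zi.const_mul η) (hi.const_mul _), integral_const_mul, integral_const_mul]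
  have : 0 ≤ 1 + 1 / η := by positivity
  have := mul_le_mul_of_nonneg_left hb this
  linarith

lemma T0_tendsto (B : ℝ) (hB : 0 < B) : Tendsto (fun Y : ℝ => Real.exp (B * Y) / Y ^ 3) atTop atTop := by
  have := tendsto_exp_mul_div_rpow_atTop 3 B hB
  refine this.congr fun Y => ?_
  rw [show (3:ℝ) = ((3:ℕ):ℝ) by norm_num, Real.rpow_natCast]

lemma exp_decay (c : ℝ) (hc : 0 < c) : Tendsto (fun Y : ℝ => Y * Real.exp (-c * Y)) atTop (𝓝 0) := by
  have := tendsto_rpow_mul_exp_neg_mul_atTop_nhds_zero 1 c hc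
  refine this.congr fun Y => ?_
  rw [Real.rpow_one]

lemma log_div_tendsto : Tendsto (fun T : ℝ => Real.log T / T) atTop (𝓝 0) :=
  Real.isLittleO_log_id_atTop.tendsto_div_nhds_zero

set_option maxHeartbeats 1000000 in
/-- hypothesis in the `Y = log X` variable -/
lemma Jf_asymp (hRH : RiemannHypothesis)
    (B₁ B₂ : ℝ) (hB₁ : 0 < B₁) (hB₂ : B₂ ≤ 1)
    (hF : ∀ ε : ℝ, 0 < ε → ∃ X₀ : ℝ, ∀ X : ℝ, X₀ ≤ X → ∀ T : ℝ,
      X ^ B₁ * (Real.log X)⁻¹ ^ 3 ≤ T → T ≤ X ^ B₂ * (Real.log X) ^ 3 →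
        ‖Fxt X T - ((T / (2 * π) * Real.log T : ℝ) : ℂ)‖ ≤ ε * (T / (2 * π) * Real.log T)) :
    ∀ ε : ℝ, 0 < ε → ∀ᶠ Y : ℝ in atTop, ∀ T : ℝ,
      Real.exp (B₁ * Y) / Y ^ 3 ≤ T → T ≤ Real.exp (B₂ * Y) * Y ^ 3 →
        |Jf Y T - T * Real.log T| ≤ ε * (T * Real.log T) := by
  intro ε₀ hε₀
  obtain ⟨C, hC, H⟩ := Jf_cmp hRH
  obtain ⟨ε, hε, hε1, hεε⟩ : ∃ ε : ℝ, 0 < ε ∧ ε ≤ 1 ∧ 4 * ε ≤ ε₀ :=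
    ⟨min 1 (ε₀ / 4), by positivity, min_le_left _ _, by linarith [min_le_right 1 (ε₀ / 4)]⟩
  obtain ⟨X₀, hX⟩ := hF ε hε
  set K := (1 + 1 / ε) * C * 4 with hK
  have hKp : 0 < K := by positivity
  have hT1 : ∀ᶠ T : ℝ in atTop, Real.log T / T < ε / (2 * K) :=
    log_div_tendsto.eventually_lt_const (by positivity)
  have hT2 := hT1.and (eventually_ge_atTop (2:ℝ))
  obtain ⟨T₁, hT₁⟩ := eventually_atTop.1 hT2
  have hY2 : ∀ᶠ Y : ℝ in atTop, Y * Real.exp (-(1/5) * Y) < ε / (2 * K) / 4 :=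
    (exp_decay (1/5) (by norm_num)).eventually_lt_const (by positivity)
  filter_upwards [(T0_tendsto B₁ hB₁).eventually_ge_atTop T₁, hY2, eventually_ge_atTop (1:ℝ),
    Real.tendsto_exp_atTop.eventually_ge_atTop X₀] with Y hYT hY2 hY1 hYX T hTl hTu
  obtain ⟨hTa, hTb⟩ := hT₁ T (hYT.trans hTl)
  have hTpos : 0 < T := by linarith
  have hlog : 0 < Real.log T := Real.log_pos (by linarith)
  have h1 := hX (Real.exp Y) hYX T
    (by rw [Real.log_exp, ← Real.exp_mul, mul_comm Y, inv_pow, ← div_eq_mul_inv]; exact hTl)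
    (by rw [Real.log_exp, ← Real.exp_mul, mul_comm Y]; exact hTu)
  rw [Fxt_eq hRH] at h1
  have h2 : |(Phi T Y).re - T / (2 * π) * Real.log T| ≤ ε * (T / (2 * π) * Real.log T) := by
    refine le_trans ?_ h1
    have := Complex.abs_re_le_norm (Phi T Y - ((T / (2 * π) * Real.log T : ℝ) : ℂ))
    rwa [Complex.sub_re, Complex.ofReal_re] at this
  have h3 : |2 * π * (Phi T Y).re - T * Real.log T| ≤ ε * (T * Real.log T) := by
    have e : 2 * π * (Phi T Y).re - T * Real.log T = 2 * π * ((Phi T Y).re - T / (2 * π) * Real.log T) := by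
      field_simp
    rw [e, abs_mul, abs_of_pos (by positivity : 0 < 2 * π)]
    calc _ ≤ 2 * π * (ε * (T / (2 * π) * Real.log T)) := mul_le_mul_of_nonneg_left h2 (by positivity)
      _ = _ := by field_simp
  have h4 := H Y T ε hTpos.le hε
  -- the error term
  have hLg : Lg T ≤ 2 * Real.log T := by
    unfold Lg; rw [abs_of_pos hTpos]
    rw [show 2 * Real.log T = Real.log (T ^ 2) by rw [Real.log_pow]; norm_num]
    apply Real.log_le_log (by linarith); nlinarith
  have hLg2 : Lg T ^ 2 ≤ 4 * Real.log T ^ 2 := by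
    have := Lg_half T
    calc Lg T ^ 2 ≤ (2 * Real.log T) ^ 2 := by gcongr
      _ = _ := by ring
  have hlogT : Real.log T ≤ 4 * Y := by
    have a1 : Real.log T ≤ Real.log (Real.exp (B₂ * Y) * Y ^ 3) := Real.log_le_log hTpos hTu
    rw [Real.log_mul (by positivity) (by positivity), Real.log_exp, Real.log_pow] at a1
    have a2 := Real.log_le_self (by linarith : 0 ≤ Y)
    have a3 : B₂ * Y ≤ 1 * Y := mul_le_mul_of_nonneg_right hB₂ (by linarith)
    push_cast at a1; linarith
  have hE : (1 + 1 / ε) * (C * Lg T ^ 2 * (1 + T * Real.exp (-Y / 5))) ≤ ε * (T * Real.log T) := by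
    have b1 : Real.log T ≤ ε / (2 * K) * T := by
      rw [div_lt_iff₀ hTpos] at hTa; exact hTa.le
    have b2 : Real.log T * Real.exp (-Y / 5) ≤ ε / (2 * K) := by
      have : Real.exp (-Y / 5) = Real.exp (-(1/5) * Y) := by congr 1; ring
      rw [this]
      have := mul_le_mul_of_nonneg_right hlogT (Real.exp_pos (-(1/5) * Y)).le
      linarith
    have b3 : Real.log T * (1 + T * Real.exp (-Y / 5)) ≤ ε / K * T := by
      have : T * (Real.log T * Real.exp (-Y / 5)) ≤ T * (ε / (2 * K)) := mul_le_mul_of_nonneg_left b2 hTpos.le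
      have e : ε / K = ε / (2 * K) + ε / (2 * K) := by field_simp; ring
      rw [e]; nlinarith
    calc _ ≤ (1 + 1 / ε) * (C * (4 * Real.log T ^ 2) * (1 + T * Real.exp (-Y / 5))) := by gcongr
      _ = K * Real.log T * (Real.log T * (1 + T * Real.exp (-Y / 5))) := by rw [hK]; ring
      _ ≤ K * Real.log T * (ε / K * T) := by gcongr
      _ = _ := by field_simp
  have hTl : 0 < T * Real.log T := by positivity
  have h5 := abs_le.1 h3
  have h6 := abs_le.1 h4
  have h7 : ε * (2 * π * (Phi T Y).re) ≤ ε * (2 * (T * Real.log T)) := by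
    apply mul_le_mul_of_nonneg_left _ hε.le
    nlinarith
  have h8 : 4 * ε * (T * Real.log T) ≤ ε₀ * (T * Real.log T) := mul_le_mul_of_nonneg_right hεε hTl.le
  rw [abs_le]
  constructor <;> nlinarith

end ModG5

section ModH1
open Complex Filter MeasureTheory Real Set
open scoped Topology
lemma Jf_eq (Y T : ℝ) (hT : 0 ≤ T) : Jf Y T = ∫ t in (0:ℝ)..T, ‖Bf Y t‖ ^ 2 := by
  rw [intervalIntegral.integral_of_le hT]; rfl

lemma bsq_cont (Y : ℝ) : Continuous (fun t => ‖Bf Y t‖ ^ 2) := (Bf_cont Y).norm.pow 2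

lemma Jf_deriv (Y T : ℝ) : HasDerivAt (fun T => ∫ t in (0:ℝ)..T, ‖Bf Y t‖ ^ 2) (‖Bf Y T‖ ^ 2) T :=
  ((bsq_cont Y).integral_hasStrictDerivAt 0 T).hasDerivAt

/-- Fejér kernel and its derivative -/
def fe (r t : ℝ) : ℝ := 4 * Real.sin (r * t / 2) ^ 2 / t ^ 2
def fe' (r t : ℝ) : ℝ := 8 * Real.sin (r*t/2) * ((r*t/2) * Real.cos (r*t/2) - Real.sin (r*t/2)) / t ^ 3

lemma fe_contOn (r a b : ℝ) (ha : 0 < a) : ContinuousOn (fe r) (Icc a b) := by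
  unfold fe
  refine ContinuousOn.div (by fun_prop) (by fun_prop) fun t ht => ?_
  have : 0 < t := ha.trans_le ht.1
  positivity

lemma fe'_contOn (r a b : ℝ) (ha : 0 < a) : ContinuousOn (fe' r) (Icc a b) := by
  unfold fe'
  refine ContinuousOn.div (by fun_prop) (by fun_prop) fun t ht => ?_
  have : 0 < t := ha.trans_le ht.1
  positivity

lemma fe_nonneg (r t : ℝ) : 0 ≤ fe r t := by unfold fe; positivity

lemma fe_le (r t : ℝ) (hr : 0 ≤ r) (ht : 0 < t) : fe r t ≤ r ^ 2 := by
  have h1 := ah_formula r t hr ht.ne'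
  unfold fe; rw [← h1]
  have := ah_le r t hr
  gcongr

lemma fe_le2 (r t : ℝ) (ht : 0 < t) : fe r t ≤ 4 / t ^ 2 := by
  unfold fe
  have : Real.sin (r * t / 2) ^ 2 ≤ 1 := Real.sin_sq_le_one _
  gcongr; linarith

/-- main integration by parts -/
lemma mid_bd (Y V ε h T1 T2 : ℝ) (hh : 0 < h) (hV : 0 ≤ V) (hε : 0 ≤ ε) (hT1 : 0 < T1) (hT : T1 ≤ T2)
    (hJ : ∀ T, T1 ≤ T → T ≤ T2 → |Jf Y T - V * T| ≤ ε * V * T) :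
    |(∫ t in T1..T2, fe h t * ‖Bf Y t‖ ^ 2) - V * ∫ t in T1..T2, fe h t|
      ≤ 2 * ε * V * (h ^ 2 * T2) * (1 + h * T2) := by
  set E : ℝ → ℝ := fun T => (∫ t in (0:ℝ)..T, ‖Bf Y t‖ ^ 2) - V * T with hE
  have hEd : ∀ T, HasDerivAt E (‖Bf Y T‖ ^ 2 - V) T := fun T => by
    have := (Jf_deriv Y T).sub ((hasDerivAt_id T).const_mul V)
    rw [mul_one] at this
    exact this
  have hEb : ∀ T, T1 ≤ T → T ≤ T2 → |E T| ≤ ε * V * T2 := fun T h1 h2 => by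
    have e : E T = Jf Y T - V * T := by rw [Jf_eq Y T (by linarith)]
    rw [e]
    refine (hJ T h1 h2).trans ?_
    exact mul_le_mul_of_nonneg_left h2 (by positivity)
  have hi1 : IntervalIntegrable (fe' h) volume T1 T2 := by
    apply ContinuousOn.intervalIntegrable; rw [uIcc_of_le hT]; exact fe'_contOn h _ _ hT1
  have hi2 : IntervalIntegrable (fun t => ‖Bf Y t‖ ^ 2 - V) volume T1 T2 :=
    ((bsq_cont Y).sub continuous_const).intervalIntegrable _ _
  have hi3 : IntervalIntegrable (fun t => fe h t * ‖Bf Y t‖ ^ 2) volume T1 T2 := by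
    apply ContinuousOn.intervalIntegrable; rw [uIcc_of_le hT]
    exact (fe_contOn h _ _ hT1).mul (bsq_cont Y).continuousOn
  have hi4 : IntervalIntegrable (fun t => V * fe h t) volume T1 T2 := by
    apply ContinuousOn.intervalIntegrable; rw [uIcc_of_le hT]
    exact continuousOn_const.mul (fe_contOn h _ _ hT1)
  have hp := intervalIntegral.integral_mul_deriv_eq_deriv_mul (a := T1) (b := T2) (u := fe h) (u' := fe' h) (v := E)
    (v' := fun t => ‖Bf Y t‖ ^ 2 - V) (fun t ht => by
      rw [uIcc_of_le hT] at ht; exact fej_deriv h t (hT1.trans_le ht.1)) (fun t _ => hEd t) hi1 hi2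
  have e1 : (∫ t in T1..T2, fe h t * ‖Bf Y t‖ ^ 2) - V * ∫ t in T1..T2, fe h t
      = ∫ t in T1..T2, fe h t * (‖Bf Y t‖ ^ 2 - V) := by
    rw [← intervalIntegral.integral_const_mul, ← intervalIntegral.integral_sub hi3 hi4]
    congr 1; ext t; ring
  rw [e1, hp]
  have hT2 : 0 < T2 := by linarith
  have b1 : ∀ T, T1 ≤ T → T ≤ T2 → |fe h T * E T| ≤ h ^ 2 * (ε * V * T2) := fun T h1 h2 => by
    rw [abs_mul, abs_of_nonneg (fe_nonneg _ _)]
    exact mul_le_mul (fe_le h T hh.le (by linarith)) (hEb T h1 h2) (abs_nonneg _) (by positivity)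
  have b2 := b1 T1 le_rfl hT
  have b3 := b1 T2 hT le_rfl
  have b4 : |∫ t in T1..T2, fe' h t * E t| ≤ (2 * h ^ 3 * (ε * V * T2)) * |T2 - T1| := by
    rw [← Real.norm_eq_abs]
    refine intervalIntegral.norm_integral_le_of_norm_le_const fun t ht => ?_
    rw [uIoc_of_le hT] at ht
    rw [Real.norm_eq_abs, abs_mul]
    exact mul_le_mul (fej_deriv_le h t hh.le (hT1.trans ht.1)) (hEb t ht.1.le ht.2) (abs_nonneg _) (by positivity)
  rw [abs_of_nonneg (by linarith : 0 ≤ T2 - T1)] at b4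
  have b5 : (2 * h ^ 3 * (ε * V * T2)) * (T2 - T1) ≤ (2 * h ^ 3 * (ε * V * T2)) * T2 :=
    mul_le_mul_of_nonneg_left (by linarith) (by positivity)
  have t1 := abs_sub (fe h T2 * E T2 - fe h T1 * E T1) (∫ t in T1..T2, fe' h t * E t)
  have t2 := abs_sub (fe h T2 * E T2) (fe h T1 * E T1)
  nlinarith

lemma high_bd (Y V h T2 T3 : ℝ) (hV : 0 ≤ V) (hT2 : 0 < T2) (hT : T2 ≤ T3)
    (hJ : ∀ T, T2 ≤ T → T ≤ T3 → Jf Y T ≤ 2 * V * T) :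
    (∫ t in T2..T3, fe h t * ‖Bf Y t‖ ^ 2) ≤ 24 * V / T2 := by
  have hT3 : 0 < T3 := by linarith
  set J : ℝ → ℝ := fun T => (∫ t in (0:ℝ)..T, ‖Bf Y t‖ ^ 2) with hJdef
  have hJ0 : ∀ T, 0 ≤ T → 0 ≤ J T := fun T hT0 =>
    intervalIntegral.integral_nonneg hT0 fun t _ => by positivity
  have hJ1 : ∀ T, T2 ≤ T → T ≤ T3 → J T ≤ 2 * V * T := fun T h1 h2 => by
    have e : J T = Jf Y T := by rw [Jf_eq Y T (by linarith)]
    rw [e]; exact hJ T h1 h2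
  have pos : ∀ t ∈ Icc T2 T3, 0 < t := fun t ht => hT2.trans_le ht.1
  have c1 : ContinuousOn (fun t : ℝ => 4 / t ^ 2) (Icc T2 T3) :=
    ContinuousOn.div (by fun_prop) (by fun_prop) fun t ht => by have := pos t ht; positivity
  have c2 : ContinuousOn (fun t : ℝ => -8 / t ^ 3) (Icc T2 T3) :=
    ContinuousOn.div (by fun_prop) (by fun_prop) fun t ht => by have := pos t ht; positivity
  have c3 : ContinuousOn (fun t : ℝ => 16 * V / t ^ 2) (Icc T2 T3) :=
    ContinuousOn.div (by fun_prop) (by fun_prop) fun t ht => by have := pos t ht; positivity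
  have cJ : Continuous J := continuous_iff_continuousAt.2 fun t => (Jf_deriv Y t).continuousAt
  have ii : ∀ {f : ℝ → ℝ}, ContinuousOn f (Icc T2 T3) → IntervalIntegrable f volume T2 T3 := fun {f} hf => by
    apply ContinuousOn.intervalIntegrable; rwa [uIcc_of_le hT]
  have s1 : (∫ t in T2..T3, fe h t * ‖Bf Y t‖ ^ 2) ≤ ∫ t in T2..T3, 4 / t ^ 2 * ‖Bf Y t‖ ^ 2 := by
    refine intervalIntegral.integral_mono_on hT (ii ((fe_contOn h _ _ hT2).mul (bsq_cont Y).continuousOn))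
      (ii (c1.mul (bsq_cont Y).continuousOn)) fun t ht => ?_
    exact mul_le_mul_of_nonneg_right (fe_le2 h t (pos t ht)) (by positivity)
  have hp := intervalIntegral.integral_mul_deriv_eq_deriv_mul (a := T2) (b := T3) (u := fun t => 4 / t ^ 2)
    (u' := fun t => -8 / t ^ 3) (v := J)
    (v' := fun t => ‖Bf Y t‖ ^ 2) (fun t ht => by
      rw [uIcc_of_le hT] at ht
      have ht0 := pos t ht
      have := (hasDerivAt_const t (4:ℝ)).div (hasDerivAt_pow 2 t) (by positivity)
      refine this.congr_deriv ?_
      field_simp; ring) (fun t _ => Jf_deriv Y t) (ii c2)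
      ((bsq_cont Y).intervalIntegrable _ _)
  rw [hp] at s1
  have s2 : - (∫ t in T2..T3, -8 / t ^ 3 * J t) ≤ ∫ t in T2..T3, 16 * V / t ^ 2 := by
    rw [← intervalIntegral.integral_neg]
    refine intervalIntegral.integral_mono_on hT (ii (c2.mul cJ.continuousOn).neg) (ii c3) fun t ht => ?_
    have ht0 := pos t ht
    have := hJ1 t ht.1 ht.2
    have e : -(-8 / t ^ 3 * J t) = 8 / t ^ 3 * J t := by ring
    rw [e]
    calc 8 / t ^ 3 * J t ≤ 8 / t ^ 3 * (2 * V * t) := mul_le_mul_of_nonneg_left this (by positivity)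
      _ = _ := by field_simp; ring
  have s3 : ∫ t in T2..T3, 16 * V / t ^ 2 = 16 * V / T2 - 16 * V / T3 := by
    have := intervalIntegral.integral_eq_sub_of_hasDerivAt (a := T2) (b := T3) (f := fun t : ℝ => - (16 * V) / t)
      (f' := fun t => 16 * V / t ^ 2) (fun t ht => by
        rw [uIcc_of_le hT] at ht
        have ht0 := pos t ht
        have := (hasDerivAt_const t (-(16 * V))).div (hasDerivAt_id t) ht0.ne'
        refine this.congr_deriv ?_
        simp) (ii c3)
    rw [this]; ring
  have s4 : 4 / T3 ^ 2 * J T3 ≤ 8 * V / T3 := by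
    calc _ ≤ 4 / T3 ^ 2 * (2 * V * T3) := mul_le_mul_of_nonneg_left (hJ1 T3 hT le_rfl) (by positivity)
      _ = _ := by field_simp; ring
  have s5 : 0 ≤ 4 / T2 ^ 2 * J T2 := mul_nonneg (by positivity) (hJ0 _ hT2.le)
  have s6 : 0 ≤ 8 * V / T3 := by positivity
  have s7 : 0 ≤ 8 * V / T2 := by positivity
  have s8 : 24 * V / T2 = 16 * V / T2 + 8 * V / T2 := by ring
  have s9 : 16 * V / T3 = 8 * V / T3 + 8 * V / T3 := by ring
  linarith

end ModH1

section ModH2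
open Complex Filter MeasureTheory Real Set
open scoped Topology
lemma Ioi_split3 (f : ℝ → ℝ) (hf : IntegrableOn f (Ioi 0)) (a b : ℝ) (ha : 0 ≤ a) (hab : a ≤ b) :
    ∫ t in Ioi 0, f t = (∫ t in Ioc 0 a, f t) + (∫ t in a..b, f t) + ∫ t in Ioi b, f t := by
  rw [intervalIntegral.integral_of_le hab]
  have e1 : Ioi (0:ℝ) = Ioc 0 a ∪ Ioi a := (Ioc_union_Ioi_eq_Ioi ha).symm
  have e2 : Ioi a = Ioc a b ∪ Ioi b := (Ioc_union_Ioi_eq_Ioi hab).symm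
  have i1 : IntegrableOn f (Ioi a) := hf.mono_set (Ioi_subset_Ioi ha)
  have i2 : IntegrableOn f (Ioi b) := i1.mono_set (Ioi_subset_Ioi hab)
  have a2 : ∫ t in Ioi a, f t = (∫ t in Ioc a b, f t) + ∫ t in Ioi b, f t := by
    rw [e2, setIntegral_union (Ioc_disjoint_Ioi le_rfl) measurableSet_Ioi (i1.mono_set Ioc_subset_Ioi_self) i2]
  rw [e1, setIntegral_union (Ioc_disjoint_Ioi le_rfl) measurableSet_Ioi (hf.mono_set Ioc_subset_Ioi_self) i1, a2]
  ring

lemma inv_sq_tail (T : ℝ) (hT : 0 < T) : IntegrableOn (fun t : ℝ => 4 / t ^ 2) (Ioi T) ∧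
    ∫ t in Ioi T, 4 / t ^ 2 = 4 / T := by
  have i := integrableOn_Ioi_rpow_of_lt (by norm_num : (-2:ℝ) < -1) hT
  have v := integral_Ioi_rpow_of_lt (by norm_num : (-2:ℝ) < -1) hT
  have e : ∀ t ∈ Ioi T, 4 * t ^ (-2:ℝ) = 4 / t ^ 2 := fun t ht => by
    have : 0 < t := hT.trans ht
    rw [Real.rpow_neg this.le, show (2:ℝ) = ((2:ℕ):ℝ) by norm_num, Real.rpow_natCast]; rfl
  constructor
  · exact (IntegrableOn.congr_fun (i.const_mul 4) e measurableSet_Ioi)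
  · rw [← setIntegral_congr_fun measurableSet_Ioi e, integral_const_mul, v]
    rw [show (-2:ℝ) + 1 = -1 by norm_num, Real.rpow_neg_one]
    field_simp

lemma fe_main (h T1 T2 : ℝ) (hh : 0 ≤ h) (hT1 : 0 < T1) (hT : T1 ≤ T2) :
    |(∫ t in T1..T2, fe h t) - π * h| ≤ h ^ 2 * T1 + 4 / T2 := by
  have h1 := Ioi_split3 (fun t => ‖ah h t‖ ^ 2) (ah_sq_int h).integrableOn T1 T2 hT1.le hT
  rw [ah_sq_half h hh] at h1
  have e : ∫ t in T1..T2, ‖ah h t‖ ^ 2 = ∫ t in T1..T2, fe h t := by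
    refine intervalIntegral.integral_congr fun t ht => ?_
    rw [uIcc_of_le hT] at ht
    exact ah_formula h t hh (hT1.trans_le ht.1).ne'
  rw [e] at h1
  have a1 : 0 ≤ ∫ t in Ioc 0 T1, ‖ah h t‖ ^ 2 := integral_nonneg fun t => by positivity
  have a2 : 0 ≤ ∫ t in Ioi T2, ‖ah h t‖ ^ 2 := integral_nonneg fun t => by positivity
  have a3 : ∫ t in Ioc 0 T1, ‖ah h t‖ ^ 2 ≤ h ^ 2 * T1 := by
    have : ∫ t in Ioc 0 T1, ‖ah h t‖ ^ 2 ≤ ∫ t in Ioc 0 T1, h ^ 2 := by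
      refine integral_mono (ah_sq_int h).integrableOn (integrableOn_const (by simp)) fun t => ?_
      have := ah_le h t hh
      simp only
      gcongr
    refine this.trans_eq ?_
    rw [setIntegral_const, measureReal_def, Real.volume_Ioc, sub_zero, ENNReal.toReal_ofReal hT1.le, smul_eq_mul, mul_comm]
  have hT2 : 0 < T2 := by linarith
  have a4 : ∫ t in Ioi T2, ‖ah h t‖ ^ 2 ≤ 4 / T2 := by
    obtain ⟨i, v⟩ := inv_sq_tail T2 hT2
    rw [← v]
    refine setIntegral_mono_on (ah_sq_int h).integrableOn i measurableSet_Ioi fun t ht => ?_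
    exact ah_le2 h t hh (hT2.trans ht).ne'
  rw [abs_le]; constructor <;> linarith

lemma Nh_split4 (h Y T1 T2 T3 : ℝ) (hh : 0 ≤ h) (hT1 : 0 < T1) (hT : T1 ≤ T2) (hT' : T2 ≤ T3) :
    Nh h Y = (∫ t in Ioc 0 T1, kerB h Y t) + ((∫ t in T1..T2, fe h t * ‖Bf Y t‖ ^ 2)
      + ∫ t in T2..T3, fe h t * ‖Bf Y t‖ ^ 2) + ∫ t in Ioi T3, kerB h Y t := by
  have h1 := Ioi_split3 (kerB h Y) (kerB_int h Y hh).integrableOn T1 T3 hT1.le (hT.trans hT')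
  have e0 : Nh h Y = ∫ t in Ioi 0, kerB h Y t := rfl
  rw [e0, h1]
  have e : ∫ t in T1..T3, kerB h Y t = ∫ t in T1..T3, fe h t * ‖Bf Y t‖ ^ 2 := by
    refine intervalIntegral.integral_congr fun t ht => ?_
    rw [uIcc_of_le (hT.trans hT')] at ht
    have := ah_formula h t hh (hT1.trans_le ht.1).ne'
    simp only [kerB, fe, this]
  have ii : ∀ a b, 0 < a → a ≤ b → IntervalIntegrable (fun t => fe h t * ‖Bf Y t‖ ^ 2) volume a b := fun a b ha hab => by
    apply ContinuousOn.intervalIntegrable; rw [uIcc_of_le hab]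
    exact (fe_contOn h _ _ ha).mul (bsq_cont Y).continuousOn
  rw [e, intervalIntegral.integral_add_adjacent_intervals (ii T1 T2 hT1 hT) (ii T2 T3 (by linarith) hT')]

/-- deterministic estimate for `Nh` -/
lemma Nh_est (hRH : RiemannHypothesis) : ∃ C : ℝ, 0 < C ∧ ∀ Y V ε h A L : ℝ, 0 ≤ Y → 0 < h → 0 ≤ V → 0 ≤ ε → ε ≤ 1 →
    1 ≤ A → A ≤ L ^ 2 → 1 ≤ L → h * L ^ 2 ≤ 1 →
    (∀ T, 1 / (h * L ^ 2) ≤ T → T ≤ L ^ 2 / h → |Jf Y T - V * T| ≤ ε * V * T) →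
    |Nh h Y - π * h * V| ≤ C * h * (Lg (L ^ 2 / h) / L) ^ 2 + V * h * (4 * ε * A ^ 2 + 1 / L ^ 2 + 28 / A) := by
  obtain ⟨C, hC, H⟩ := ends_bd hRH
  refine ⟨2 * C, by positivity, fun Y V ε h A L hY hh hV hε hε1 hA hAL hL hhL hJ => ?_⟩
  have hL2 : 1 ≤ L ^ 2 := one_le_pow₀ hL
  have hLp : 0 < L ^ 2 := by linarith
  set T1 := 1 / (h * L ^ 2) with hT1
  set T2 := A / h with hT2
  set T3 := L ^ 2 / h with hT3
  have T1_1 : 1 ≤ T1 := by rw [hT1, le_div_iff₀ (by positivity)]; linarith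
  have T12 : T1 ≤ T2 := by
    rw [hT1, hT2, div_le_div_iff₀ (by positivity) hh]
    have : 1 ≤ A * L ^ 2 := by nlinarith
    nlinarith
  have T23 : T2 ≤ T3 := by rw [hT2, hT3]; gcongr
  have hT1p : 0 < T1 := by linarith
  have hT2p : 0 < T2 := by linarith
  rw [Nh_split4 h Y T1 T2 T3 hh.le hT1p T12 T23]
  have m1 := mid_bd Y V ε h T1 T2 hh hV hε hT1p T12 (fun T a b => hJ T a (b.trans T23))
  have m2 := high_bd Y V h T2 T3 hV hT2p T23 (fun T a b => by
    have := (abs_le.1 (hJ T (T12.trans a) b)).2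
    have h0 : 0 ≤ V * T := mul_nonneg hV (by linarith)
    nlinarith)
  have m2' : 0 ≤ ∫ t in T2..T3, fe h t * ‖Bf Y t‖ ^ 2 :=
    intervalIntegral.integral_nonneg T23 fun t _ => mul_nonneg (fe_nonneg _ _) (by positivity)
  have m3 := fe_main h T1 T2 hh.le hT1p T12
  have m4 := (H Y h T1 hY hh.le T1_1).2
  have m5 := (H Y h T3 hY hh.le (T1_1.trans (T12.trans T23))).1
  have m4' : 0 ≤ ∫ t in Ioc 0 T1, kerB h Y t := integral_nonneg fun t => kerB_nonneg h Y t
  have m5' : 0 ≤ ∫ t in Ioi T3, kerB h Y t := integral_nonneg fun t => kerB_nonneg h Y t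
  have q1 : 24 * V / T2 = V * h * (24 / A) := by rw [hT2]; field_simp
  have q2 : h ^ 2 * T1 + 4 / T2 = h * (1 / L ^ 2 + 4 / A) := by rw [hT1, hT2]; field_simp
  have q3 : 2 * ε * V * (h ^ 2 * T2) * (1 + h * T2) = V * h * (2 * ε * A * (1 + A)) := by rw [hT2]; field_simp
  have q4 : C * Lg T3 ^ 2 / T3 = C * h * (Lg T3 / L) ^ 2 := by rw [hT3]; field_simp
  have q5 : C * h ^ 2 * T1 * Lg T1 ^ 2 ≤ C * h * (Lg T3 / L) ^ 2 := by
    have : Lg T1 ≤ Lg T3 := Lg_mono (by rw [abs_of_pos hT1p, abs_of_pos (by linarith)]; linarith)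
    have h0 := Lg_half T1
    have e : C * h * (Lg T3 / L) ^ 2 = C * h ^ 2 * T1 * Lg T3 ^ 2 := by rw [hT1]; field_simp
    rw [e]; gcongr
  rw [q1] at m2; rw [q2] at m3; rw [q3] at m1; rw [q4] at m5
  have q6 : V * h * (2 * ε * A * (1 + A)) ≤ V * h * (4 * ε * A ^ 2) := by
    apply mul_le_mul_of_nonneg_left _ (by positivity)
    have : 0 ≤ ε * A * (A - 1) := mul_nonneg (by positivity) (by linarith)
    nlinarith
  have m3' : |V * (∫ t in T1..T2, fe h t) - π * h * V| ≤ V * (h * (1 / L ^ 2 + 4 / A)) := by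
    have e : V * (∫ t in T1..T2, fe h t) - π * h * V = V * ((∫ t in T1..T2, fe h t) - π * h) := by ring
    rw [e, abs_mul, abs_of_nonneg hV]
    exact mul_le_mul_of_nonneg_left m3 hV
  have q7 : V * h * (4 * ε * A ^ 2 + 1 / L ^ 2 + 28 / A) =
    V * h * (4 * ε * A ^ 2) + V * (h * (1 / L ^ 2 + 4 / A)) + V * h * (24 / A) := by ring
  rw [q7]
  have n1 := abs_le.1 m1
  have n3 := abs_le.1 m3'
  have q8 : 0 ≤ V * h * (24 / A) := by positivity
  have q9 : 0 ≤ C * h * (Lg T3 / L) ^ 2 := by positivity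
  rw [abs_le]
  constructor <;> linarith [n1.1, n1.2, n3.1, n3.2]

end ModH2

section ModH3
open Complex Filter MeasureTheory Real Set
open scoped Topology
/-- basic facts on `h` in terms of `Y` -/
lemma h_basic (B₁ B₂ : ℝ) (hB₁ : 0 < B₁) (hB₂ : B₂ ≤ 1) : ∀ᶠ Y : ℝ in atTop, ∀ h : ℝ,
    Real.exp (-(B₂ * Y)) / 2 ≤ h → h ≤ 2 * Real.exp (-(B₁ * Y)) →
      0 < h ∧ h ≤ 1 / 2 ∧ B₁ * Y / 2 ≤ Real.log (1 / h) ∧ Real.log (1 / h) ≤ 2 * Y ∧ h * Y ^ 2 ≤ 1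
      ∧ Lg (Y ^ 2 / h) ≤ 5 * Y ∧ Real.exp (B₁ * Y) / Y ^ 3 ≤ 1 / (h * Y ^ 2) ∧
      Y ^ 2 / h ≤ Real.exp (B₂ * Y) * Y ^ 3 := by
  have t1 : Tendsto (fun Y : ℝ => Y ^ 2 * Real.exp (-B₁ * Y)) atTop (𝓝 0) := by
    have := tendsto_rpow_mul_exp_neg_mul_atTop_nhds_zero 2 B₁ hB₁
    refine this.congr fun Y => ?_
    rw [show (2:ℝ) = ((2:ℕ):ℝ) by norm_num, Real.rpow_natCast]
  have e1 := t1.eventually_lt_const (by norm_num : (0:ℝ) < 1 / 8)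
  have e2 : ∀ᶠ Y : ℝ in atTop, 2 ≤ B₁ * Y :=
    (tendsto_id.const_mul_atTop hB₁).eventually_ge_atTop 2
  filter_upwards [e1, e2, eventually_ge_atTop (2:ℝ)] with Y e1 e2 hY h hl hu
  have hh : 0 < h := lt_of_lt_of_le (by positivity) hl
  have hlog2 : Real.log 2 ≤ 1 := by have := Real.log_two_lt_d9; linarith
  have hlog2' : 0 ≤ Real.log 2 := Real.log_nonneg (by norm_num)
  rw [neg_mul] at e1
  have hEp := Real.exp_pos (-(B₁ * Y))
  have v1 : B₁ * Y / 2 ≤ Real.log (1 / h) := by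
    rw [one_div, Real.log_inv]
    have := Real.log_le_log hh hu
    rw [Real.log_mul (by norm_num) hEp.ne', Real.log_exp] at this
    linarith
  have v2 : Real.log (1 / h) ≤ 2 * Y := by
    rw [one_div, Real.log_inv]
    have := Real.log_le_log (by positivity) hl
    rw [Real.log_div (Real.exp_pos _).ne' (by norm_num), Real.log_exp] at this
    have : B₂ * Y ≤ 1 * Y := mul_le_mul_of_nonneg_right hB₂ (by linarith)
    linarith
  have hY2 : (4:ℝ) ≤ Y ^ 2 := by nlinarith
  have v3 : h * Y ^ 2 ≤ 1 / 4 := by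
    have : h * Y ^ 2 ≤ 2 * Real.exp (-(B₁ * Y)) * Y ^ 2 := mul_le_mul_of_nonneg_right hu (by positivity)
    linarith
  refine ⟨hh, by nlinarith, v1, v2, by linarith, ?_, ?_, ?_⟩
  · have p : 2 ≤ Y ^ 2 / h := by rw [le_div_iff₀ hh]; nlinarith
    unfold Lg
    rw [abs_of_pos (by linarith)]
    have : Real.log (2 + Y ^ 2 / h) ≤ Real.log (2 * (Y ^ 2 * (1 / h))) := by
      apply Real.log_le_log (by linarith)
      have : Y ^ 2 * (1 / h) = Y ^ 2 / h := by ring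
      rw [this]; linarith
    rw [Real.log_mul (by norm_num) (by positivity), Real.log_mul (by positivity) (by positivity), Real.log_pow] at this
    have a := Real.log_le_sub_one_of_pos (by linarith : 0 < Y)
    push_cast at this
    linarith
  · rw [div_le_div_iff₀ (by positivity) (by positivity)]
    have : Real.exp (B₁ * Y) * h ≤ 2 := by
      have := mul_le_mul_of_nonneg_left hu (Real.exp_pos (B₁ * Y)).le
      have e : Real.exp (B₁ * Y) * (2 * Real.exp (-(B₁ * Y))) = 2 := by
        rw [Real.exp_neg]; field_simp
      linarith
    calc Real.exp (B₁ * Y) * (h * Y ^ 2) = (Real.exp (B₁ * Y) * h) * Y ^ 2 := by ring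
      _ ≤ 2 * Y ^ 2 := mul_le_mul_of_nonneg_right this (by positivity)
      _ ≤ 1 * Y ^ 3 := by nlinarith
  · rw [div_le_iff₀ hh]
    have : 1 / 2 ≤ Real.exp (B₂ * Y) * h := by
      have := mul_le_mul_of_nonneg_left hl (Real.exp_pos (B₂ * Y)).le
      have e : Real.exp (B₂ * Y) * (Real.exp (-(B₂ * Y)) / 2) = 1 / 2 := by
        rw [Real.exp_neg]; field_simp
      linarith
    calc Y ^ 2 ≤ 1 / 2 * Y ^ 3 := by nlinarith
      _ ≤ (Real.exp (B₂ * Y) * h) * Y ^ 3 := mul_le_mul_of_nonneg_right this (by positivity)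
      _ = _ := by ring

set_option maxHeartbeats 1000000 in
lemma Nh_asymp (hRH : RiemannHypothesis) (B₁ B₂ : ℝ) (hB₁ : 0 < B₁) (hB₂ : B₂ ≤ 1)
    (hJ : ∀ ε : ℝ, 0 < ε → ∀ᶠ Y : ℝ in atTop, ∀ T : ℝ,
      Real.exp (B₁ * Y) / Y ^ 3 ≤ T → T ≤ Real.exp (B₂ * Y) * Y ^ 3 →
        |Jf Y T - T * Real.log T| ≤ ε * (T * Real.log T)) :
    ∀ ε : ℝ, 0 < ε → ∀ᶠ Y : ℝ in atTop, ∀ h : ℝ,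
      Real.exp (-(B₂ * Y)) / 2 ≤ h → h ≤ 2 * Real.exp (-(B₁ * Y)) →
        |Nh h Y - π * (h * Real.log (1 / h))| ≤ ε * (h * Real.log (1 / h)) := by
  intro ε hε
  obtain ⟨C, hC, H⟩ := Nh_est hRH
  obtain ⟨A, hA, hAε⟩ : ∃ A : ℝ, 1 ≤ A ∧ 28 / A ≤ ε / 4 := by
    refine ⟨1 + 112 / ε, by have : 0 < 112 / ε := by positivity
                            linarith, ?_⟩
    rw [div_le_iff₀ (by positivity)]
    have : ε / 4 * (1 + 112 / ε) = ε / 4 + 28 := by field_simp; ring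
    rw [this]; linarith
  obtain ⟨ε₁, hε₁, hε₁1, hε₁A⟩ : ∃ ε₁ : ℝ, 0 < ε₁ ∧ ε₁ ≤ 1 ∧ 4 * ε₁ * A ^ 2 ≤ ε / 4 := by
    refine ⟨min 1 (ε / (16 * A ^ 2)), by positivity, min_le_left _ _, ?_⟩
    have := min_le_right 1 (ε / (16 * A ^ 2))
    calc _ ≤ 4 * (ε / (16 * A ^ 2)) * A ^ 2 := by gcongr
      _ = ε / 4 := by field_simp; norm_num
  have t1 : ∀ᶠ Y : ℝ in atTop, Real.log Y / Y < ε₁ / 3 * B₁ / 4 :=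
    log_div_tendsto.eventually_lt_const (by positivity)
  have t2 : ∀ᶠ Y : ℝ in atTop, 25 * C * 8 / (ε * B₁) ≤ Y := eventually_ge_atTop _
  have t3 : ∀ᶠ Y : ℝ in atTop, A ≤ Y := eventually_ge_atTop _
  have t4 : ∀ᶠ Y : ℝ in atTop, 4 / ε ≤ Y := eventually_ge_atTop _
  filter_upwards [h_basic B₁ B₂ hB₁ hB₂, hJ (ε₁ / 3) (by positivity), t1, t2, t3, t4] with Y hb hJ t1 t2 t3 t4 h hl hu
  obtain ⟨hh, hh2, v1, v2, v3, v4, v5, v6⟩ := hb h hl hu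
  have hY1 : 1 ≤ Y := by linarith
  have hYp : 0 < Y := by linarith
  generalize hV : Real.log (1 / h) = V at *
  have hVp : 0 < V := lt_of_lt_of_le (by positivity) v1
  have hlogh : Real.log h = -V := by rw [← hV, one_div, Real.log_inv, neg_neg]
  rw [div_lt_iff₀ hYp] at t1
  have hlY : 0 ≤ Real.log Y := Real.log_nonneg hY1
  have hJ' : ∀ T, 1 / (h * Y ^ 2) ≤ T → T ≤ Y ^ 2 / h → |Jf Y T - V * T| ≤ ε₁ * V * T := by
    intro T a b
    have hT : 0 < T := lt_of_lt_of_le (by positivity) a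
    have g1 := hJ T (v5.trans a) (b.trans v6)
    have g2 : |Real.log T - V| ≤ ε₁ / 3 * V := by
      have c1 : Real.log T ≤ 2 * Real.log Y + V := by
        have := Real.log_le_log hT b
        rw [Real.log_div (by positivity) hh.ne', Real.log_pow, hlogh] at this
        push_cast at this; linarith
      have c2 : V - 2 * Real.log Y ≤ Real.log T := by
        have := Real.log_le_log (by positivity) a
        rw [one_div, Real.log_inv, Real.log_mul hh.ne' (by positivity), Real.log_pow, hlogh] at this
        push_cast at this; linarith
      have c3 : 2 * Real.log Y ≤ ε₁ / 3 * V := by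
        have := mul_le_mul_of_nonneg_left v1 (by positivity : 0 ≤ ε₁ / 3)
        linarith
      rw [abs_le]; constructor <;> linarith
    have g3 := abs_le.1 g2
    have g4 : Real.log T ≤ 2 * V := by nlinarith
    have g5 : T * Real.log T ≤ T * (2 * V) := mul_le_mul_of_nonneg_left g4 hT.le
    have g6 : |T * Real.log T - V * T| ≤ T * (ε₁ / 3 * V) := by
      have e : T * Real.log T - V * T = T * (Real.log T - V) := by ring
      rw [e, abs_mul, abs_of_pos hT]; exact mul_le_mul_of_nonneg_left g2 hT.le
    have g7 : ε₁ / 3 * (T * Real.log T) ≤ ε₁ / 3 * (T * (2 * V)) := mul_le_mul_of_nonneg_left g5 (by positivity)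
    have g8 := abs_le.1 g1
    have g9 := abs_le.1 g6
    rw [abs_le]; constructor <;> linarith
  have hAY : A ≤ Y ^ 2 := by nlinarith
  have h1 := H Y V ε₁ h A Y hYp.le hh hVp.le hε₁.le hε₁1 hA hAY hY1 v3 hJ'
  have e : π * (h * V) = π * h * V := by ring
  rw [e]
  refine h1.trans ?_
  have k1 : C * h * (Lg (Y ^ 2 / h) / Y) ^ 2 ≤ h * (25 * C) := by
    have hl0 := Lg_half (Y ^ 2 / h)
    have : Lg (Y ^ 2 / h) / Y ≤ 5 := by rw [div_le_iff₀ hYp]; exact v4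
    calc C * h * (Lg (Y ^ 2 / h) / Y) ^ 2 ≤ C * h * 5 ^ 2 := by gcongr
      _ = _ := by ring
  have k2 : 25 * C ≤ ε / 4 * V := by
    rw [div_le_iff₀ (by positivity)] at t2
    have := mul_le_mul_of_nonneg_left v1 (by positivity : 0 ≤ ε / 4)
    linarith
  have k3 : 1 / Y ^ 2 ≤ ε / 4 := by
    rw [div_le_iff₀ hε] at t4
    rw [div_le_iff₀ (by positivity)]
    nlinarith
  have k4 : V * h * (4 * ε₁ * A ^ 2 + 1 / Y ^ 2 + 28 / A) ≤ V * h * (3 * (ε / 4)) :=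
    mul_le_mul_of_nonneg_left (by linarith) (by positivity)
  have k5 := mul_le_mul_of_nonneg_left k2 hh.le
  linarith

set_option maxHeartbeats 1000000 in
lemma SS_asymp (hRH : RiemannHypothesis) (B₁ B₂ : ℝ) (hB₁ : 0 < B₁) (hB₂ : B₂ ≤ 1)
    (hJ : ∀ ε : ℝ, 0 < ε → ∀ᶠ Y : ℝ in atTop, ∀ T : ℝ,
      Real.exp (B₁ * Y) / Y ^ 3 ≤ T → T ≤ Real.exp (B₂ * Y) * Y ^ 3 →
        |Jf Y T - T * Real.log T| ≤ ε * (T * Real.log T)) :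
    ∀ ε : ℝ, 0 < ε → ∀ᶠ Y : ℝ in atTop, ∀ h : ℝ,
      Real.exp (-(B₂ * Y)) / 2 ≤ h → h ≤ 2 * Real.exp (-(B₁ * Y)) →
        Integrable (fun u => Real.exp (-(2 * |u - Y|)) * fE h u) ∧
        |SS h Y - h * Real.log (1 / h)| ≤ ε * (h * Real.log (1 / h)) := by
  intro ε hε
  obtain ⟨C, hC, H⟩ := Nh_bd hRH
  have t1 : ∀ᶠ Y : ℝ in atTop, Y * Real.exp (-B₁ * Y) < ε / 2 / (400 * C * 4 * 2 * 2) :=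
    (exp_decay B₁ hB₁).eventually_lt_const (by positivity)
  filter_upwards [h_basic B₁ B₂ hB₁ hB₂, Nh_asymp hRH B₁ B₂ hB₁ hB₂ hJ (ε / 2) (by positivity), t1,
    eventually_ge_atTop (1:ℝ)] with Y hb hN t1 hY1 h hl hu
  obtain ⟨hh, hh2, v1, v2, -, -, -, -⟩ := hb h hl hu
  have hYp : 0 < Y := by linarith
  have hN := hN h hl hu
  have hF := FF Y h (C * h * Lg (1 / h) ^ 2) hh hh2 (fun r h0 hr => H Y r h hYp.le hh hh2 h0 hr)
  refine ⟨hF.1, ?_⟩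
  have hF2 := hF.2
  have hLg : Lg (1 / h) ≤ 2 * Real.log (1 / h) := by
    have p : 2 ≤ 1 / h := by rw [le_div_iff₀ hh]; linarith
    unfold Lg; rw [abs_of_pos (by linarith)]
    rw [show 2 * Real.log (1 / h) = Real.log ((1 / h) ^ 2) by rw [Real.log_pow]; norm_num]
    apply Real.log_le_log (by linarith); nlinarith
  have hl0 := Lg_half (1 / h)
  generalize hV : Real.log (1 / h) = V at *
  have hVp : 0 < V := lt_of_lt_of_le (by positivity) v1
  have hpi : 1 ≤ π := by linarith [Real.pi_gt_three]
  have ipi : 1 / π ≤ 1 := by rw [div_le_one Real.pi_pos]; exact hpi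
  have q1 : |1 / π * Nh h Y - h * V| ≤ ε / 2 * (h * V) := by
    have e : 1 / π * Nh h Y - h * V = 1 / π * (Nh h Y - π * (h * V)) := by
      field_simp
    rw [e, abs_mul, abs_of_pos (by positivity)]
    have := abs_nonneg (Nh h Y - π * (h * V))
    nlinarith
  have q2 : 400 * h * (1 / π * (C * h * Lg (1 / h) ^ 2)) ≤ ε / 2 * (h * V) := by
    calc 400 * h * (1 / π * (C * h * Lg (1 / h) ^ 2)) ≤ 400 * h * (1 * (C * h * (2 * V) ^ 2)) := by
          gcongr
      _ = h * V * (400 * C * 4 * (h * V)) := by ring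
      _ ≤ h * V * (ε / 2) := by
          apply mul_le_mul_of_nonneg_left _ (by positivity)
          have a : h * V ≤ 2 * Real.exp (-(B₁ * Y)) * (2 * Y) := by gcongr
          rw [neg_mul] at t1
          rw [lt_div_iff₀ (by positivity)] at t1
          have b := mul_le_mul_of_nonneg_left a (by positivity : 0 ≤ 400 * C * 4)
          linarith
      _ = _ := by ring
  have n1 := abs_le.1 q1
  have n2 := abs_le.1 hF2
  rw [abs_le]; constructor <;> linarith [n1.1, n1.2, n2.1, n2.2]

end ModH3

section ModJ1
open Complex Filter MeasureTheory Real Set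
open scoped Topology
def Pf (h Y : ℝ) : ℝ := ∫ u in Iic Y, Real.exp (2 * (u - Y)) * fE h u

lemma ker_up (E u Y η : ℝ) (hη : 0 < η) (hE : E = Real.exp (2 * η)) :
    (Iic Y).indicator (fun u => Real.exp (2 * (u - Y))) u * (E ^ 2 - 1)
      ≤ E ^ 2 * Real.exp (-(2 * |u - Y|)) - E * Real.exp (-(2 * |u - (Y + η)|)) := by
  have hE1 : 1 < E := by rw [hE]; exact Real.one_lt_exp_iff.2 (by linarith)
  have hE2 : E ^ 2 = Real.exp (4 * η) := by rw [hE, ← Real.exp_nat_mul]; congr 1; push_cast; ring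
  by_cases h1 : u ≤ Y
  · rw [indicator_of_mem (by exact h1), abs_of_nonpos (by linarith), abs_of_nonpos (by linarith)]
    have e : E * Real.exp (-(2 * -(u - (Y + η)))) = Real.exp (2 * (u - Y)) := by
      rw [hE, ← Real.exp_add]; congr 1; ring
    have e2 : -(2 * -(u - Y)) = 2 * (u - Y) := by ring
    rw [e, e2]; apply le_of_eq; ring
  · rw [indicator_of_notMem (by exact h1), zero_mul, sub_nonneg, abs_of_pos (by linarith : 0 < u - Y)]
    rw [hE2, hE, ← Real.exp_add, ← Real.exp_add]
    apply Real.exp_le_exp.2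
    have := neg_abs_le (u - (Y + η))
    have := le_abs_self (u - (Y + η))
    linarith

lemma ker_lo (E u Y η : ℝ) (hη : 0 < η) (hE : E = Real.exp (2 * η)) :
    E ^ 2 * Real.exp (-(2 * |u - (Y - η)|)) - E * Real.exp (-(2 * |u - Y|)) ≤
    E * ((Iic Y).indicator (fun u => Real.exp (2 * (u - Y))) u * (E ^ 2 - 1)) := by
  have hE1 : 1 < E := by rw [hE]; exact Real.one_lt_exp_iff.2 (by linarith)
  have hE2 : E ^ 2 = Real.exp (4 * η) := by rw [hE, ← Real.exp_nat_mul]; congr 1; push_cast; ring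
  by_cases h1 : u ≤ Y
  · rw [indicator_of_mem (by exact h1), abs_of_nonpos (by linarith : u - Y ≤ 0)]
    have e2 : -(2 * -(u - Y)) = 2 * (u - Y) := by ring
    rw [e2]
    have : E ^ 2 * Real.exp (-(2 * |u - (Y - η)|)) ≤ E ^ 2 * (E * Real.exp (2 * (u - Y))) := by
      apply mul_le_mul_of_nonneg_left _ (by positivity)
      rw [hE, ← Real.exp_add]
      apply Real.exp_le_exp.2
      have := neg_abs_le (u - (Y - η))
      linarith
    linarith
  · rw [indicator_of_notMem (by exact h1), zero_mul, mul_zero, sub_nonpos, abs_of_pos (by linarith : 0 < u - Y),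
      abs_of_pos (by linarith)]
    rw [hE2, hE, ← Real.exp_add, ← Real.exp_add]
    apply Real.exp_le_exp.2
    linarith

lemma P_bounds (h Y η E m ε : ℝ) (hη : 0 < η) (hE : E = Real.exp (2 * η)) 
    (i1 : Integrable (fun u => Real.exp (-(2 * |u - (Y - η)|)) * fE h u))
    (i2 : Integrable (fun u => Real.exp (-(2 * |u - Y|)) * fE h u))
    (i3 : Integrable (fun u => Real.exp (-(2 * |u - (Y + η)|)) * fE h u))
    (s1 : |SS h (Y - η) - m| ≤ ε * m) (s2 : |SS h Y - m| ≤ ε * m) (s3 : |SS h (Y + η) - m| ≤ ε * m) :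
    IntegrableOn (fun u => Real.exp (2 * (u - Y)) * fE h u) (Iic Y) ∧
    Pf h Y * (E + 1) * (E - 1) ≤ E * m * (E - 1) + ε * m * E * (E + 1) ∧
    m * (E - 1) - ε * m * (E + 1) ≤ Pf h Y * (E + 1) * (E - 1) := by
  have hE1 : 1 < E := by rw [hE]; exact Real.one_lt_exp_iff.2 (by linarith)
  have iP : IntegrableOn (fun u => Real.exp (2 * (u - Y)) * fE h u) (Iic Y) := by
    refine (i2.integrableOn (s := Iic Y)).congr_fun (fun u hu => ?_) measurableSet_Iic
    have : u - Y ≤ 0 := sub_nonpos.2 hu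
    simp only
    rw [abs_of_nonpos this]; congr 2; ring
  have eP : Pf h Y = ∫ u, (Iic Y).indicator (fun u => Real.exp (2 * (u - Y))) u * fE h u := by
    unfold Pf
    rw [← integral_indicator measurableSet_Iic]
    congr 1; ext u
    by_cases hu : u ∈ Iic Y <;> simp [hu]
  have iP' : Integrable (fun u => (Iic Y).indicator (fun u => Real.exp (2 * (u - Y))) u * fE h u) := by
    have := (integrable_indicator_iff measurableSet_Iic).2 iP
    refine this.congr (Eventually.of_forall fun u => ?_)
    by_cases hu : u ∈ Iic Y <;> simp [hu]
  refine ⟨iP, ?_, ?_⟩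
  · have c : (E ^ 2 - 1) * Pf h Y ≤ E ^ 2 * SS h Y - E * SS h (Y + η) := by
      rw [eP, SS, SS, ← integral_const_mul, ← integral_const_mul, ← integral_const_mul,
        ← integral_sub (i2.const_mul _) (i3.const_mul _)]
      refine integral_mono (iP'.const_mul _) ((i2.const_mul _).sub (i3.const_mul _)) fun u => ?_
      have := mul_le_mul_of_nonneg_right (ker_up E u Y η hη hE) (fE_nonneg h u)
      simp only
      linarith
    have a2 := (abs_le.1 s2).2
    have a3 := (abs_le.1 s3).1
    have b2 := mul_le_mul_of_nonneg_left a2 (by positivity : 0 ≤ E ^ 2)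
    have b3 := mul_le_mul_of_nonneg_left a3 (by positivity : 0 ≤ E)
    linarith
  · have c : E ^ 2 * SS h (Y - η) - E * SS h Y ≤ E * (E ^ 2 - 1) * Pf h Y := by
      rw [eP, SS, SS, ← integral_const_mul, ← integral_const_mul, ← integral_const_mul,
        ← integral_sub (i1.const_mul _) (i2.const_mul _)]
      refine integral_mono ((i1.const_mul _).sub (i2.const_mul _)) (iP'.const_mul _) fun u => ?_
      have := mul_le_mul_of_nonneg_right (ker_lo E u Y η hη hE) (fE_nonneg h u)
      simp only
      linarith
    have a1 := (abs_le.1 s1).1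
    have a2 := (abs_le.1 s2).2
    have b1 := mul_le_mul_of_nonneg_left a1 (by positivity : 0 ≤ E ^ 2)
    have b2 := mul_le_mul_of_nonneg_left a2 (by positivity : 0 ≤ E)
    have : E * (m * (E - 1) - ε * m * (E + 1)) ≤ E * (Pf h Y * (E + 1) * (E - 1)) := by linarith
    exact le_of_mul_le_mul_left this (by linarith)

lemma P_final (P m κ ε E : ℝ) (hm : 0 ≤ m) (hκ : 0 < κ) (hκ1 : κ ≤ 1) (hE : E = 1 + κ) (hε : ε = κ ^ 2 / 8)
    (h1 : P * (E + 1) * (E - 1) ≤ E * m * (E - 1) + ε * m * E * (E + 1))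
    (h2 : m * (E - 1) - ε * m * (E + 1) ≤ P * (E + 1) * (E - 1)) : |P - m / 2| ≤ κ / 2 * m := by
  have e1 : E - 1 = κ := by linarith
  rw [e1] at h1 h2
  have hp : 0 < (E + 1) * κ := by rw [hE]; positivity
  rw [abs_le]
  constructor
  · have : 0 ≤ (P - m / 2 + κ / 2 * m) * ((E + 1) * κ) := by
      have : P * (E + 1) * κ - m * κ + ε * m * (E + 1) ≥ 0 := by linarith
      have k : (P - m / 2 + κ / 2 * m) * ((E + 1) * κ) = (P * (E + 1) * κ - m * κ + ε * m * (E + 1)) + m * κ ^ 2 * (E / 2 - (E + 1) / 8) := by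
        rw [hε, hE]; ring
      rw [k, hE]
      have : 0 ≤ m * κ ^ 2 * ((1 + κ) / 2 - (1 + κ + 1) / 8) := mul_nonneg (by positivity) (by linarith)
      rw [hE] at *
      linarith
    nlinarith [(mul_nonneg_iff_of_pos_right hp).1 this]
  · have : 0 ≤ (m / 2 + κ / 2 * m - P) * ((E + 1) * κ) := by
      have k : (m / 2 + κ / 2 * m - P) * ((E + 1) * κ) = (E * m * κ + ε * m * E * (E + 1) - P * (E + 1) * κ) + m * κ ^ 2 * (E / 2 - E * (E + 1) / 8) := by
        rw [hε, hE]; ring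
      rw [k]
      have : 0 ≤ m * κ ^ 2 * (E / 2 - E * (E + 1) / 8) := mul_nonneg (by positivity) (by rw [hE]; nlinarith)
      linarith
    nlinarith [(mul_nonneg_iff_of_pos_right hp).1 this]

end ModJ1

section ModJ2
open Complex Filter MeasureTheory Real Set
open scoped Topology
lemma psi_small (x : ℝ) (hx : x < 2) : chebyshevPsi x = 0 := by
  unfold chebyshevPsi
  refine Finset.sum_eq_zero fun n hn => ?_
  have h1 : n ≤ ⌊x⌋₊ := Finset.mem_Iic.1 hn
  have h2 : ⌊x⌋₊ < 2 := by
    rcases le_or_gt 0 x with h | h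
    · rw [Nat.floor_lt h]; exact_mod_cast hx
    · rw [Nat.floor_of_nonpos h.le]; norm_num
  have : n < 2 := by omega
  interval_cases n <;> simp

/-- substitution `x = e^u` -/
lemma Imoment_eq (Y δ h : ℝ) (hY : 0 ≤ Y) (hh : 0 ≤ h) (hδ : 1 + δ = Real.exp h) :
    Imoment (Real.exp Y) δ = ∫ u in Ioc 0 Y, Real.exp u * Er h u ^ 2 := by
  unfold Imoment
  rw [intervalIntegral.integral_of_le (Real.one_le_exp hY)]
  have im : Real.exp '' (Ioc 0 Y) = Ioc 1 (Real.exp Y) := by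
    ext x; constructor
    · rintro ⟨u, hu, rfl⟩
      exact ⟨Real.one_lt_exp_iff.2 hu.1, Real.exp_le_exp.2 hu.2⟩
    · intro hx
      have hx0 : 0 < x := by linarith [hx.1]
      exact ⟨Real.log x, ⟨Real.log_pos hx.1, (Real.log_le_iff_le_exp hx0).2 hx.2⟩, Real.exp_log hx0⟩
  rw [← im, integral_image_eq_integral_abs_deriv_smul measurableSet_Ioc
    (fun u _ => (Real.hasDerivAt_exp u).hasDerivWithinAt) Real.exp_injective.injOn]
  refine setIntegral_congr_fun measurableSet_Ioc fun u hu => ?_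
  rw [abs_of_pos (Real.exp_pos u), smul_eq_mul]
  have e : Er h u = chebyshevPsi ((1 + δ) * Real.exp u) - chebyshevPsi (Real.exp u) - δ * Real.exp u := by
    unfold Er
    rw [max_eq_left hu.1.le, max_eq_left (by linarith [hu.1]), Real.exp_add, ← hδ]
    rw [mul_comm (1 + δ)]; ring
  rw [e]

lemma Er_neg (h u : ℝ) (hh : 0 ≤ h) (hh2 : Real.exp h < 2) (hu : u ≤ 0) : Er h u ^ 2 ≤ (Real.exp h - 1) ^ 2 := by
  have e1 : Real.exp (u + h) ≤ Real.exp h := Real.exp_le_exp.2 (by linarith)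
  have e2 : Real.exp u ≤ 1 := Real.exp_le_one_iff.2 hu
  unfold Er
  rw [psi_small _ (by linarith), psi_small _ (by linarith), max_eq_right hu, Real.exp_zero]
  have a1 : 1 ≤ Real.exp (max (u + h) 0) := Real.one_le_exp (le_max_right _ _)
  have a2 : Real.exp (max (u + h) 0) ≤ Real.exp h := Real.exp_le_exp.2 (max_le (by linarith) hh)
  nlinarith

lemma Imoment_P (Y δ h : ℝ) (hY : 0 ≤ Y) (hh : 0 ≤ h) (hδ : 1 + δ = Real.exp h) (hδ1 : δ < 1)
    (hi : IntegrableOn (fun u => Real.exp (2 * (u - Y)) * fE h u) (Iic Y)) :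
    Imoment (Real.exp Y) δ ≤ Real.exp Y ^ 2 * Pf h Y ∧
    Real.exp Y ^ 2 * Pf h Y ≤ Imoment (Real.exp Y) δ + δ ^ 2 := by
  have e0 : ∀ u, Real.exp Y ^ 2 * (Real.exp (2 * (u - Y)) * fE h u) = Real.exp u * Er h u ^ 2 := fun u => by
    unfold fE
    rw [← mul_assoc, ← mul_assoc, ← Real.exp_nat_mul, ← Real.exp_add, ← Real.exp_add]
    congr 2; push_cast; ring
  have i1 : IntegrableOn (fun u => Real.exp u * Er h u ^ 2) (Iic Y) := by
    have := hi.const_mul (Real.exp Y ^ 2)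
    refine this.congr (Eventually.of_forall fun u => ?_)
    exact e0 u
  have e1 : Real.exp Y ^ 2 * Pf h Y = ∫ u in Iic Y, Real.exp u * Er h u ^ 2 := by
    unfold Pf; rw [← integral_const_mul]; simp only [e0]
  have e2 : ∫ u in Iic Y, Real.exp u * Er h u ^ 2 = (∫ u in Iic 0, Real.exp u * Er h u ^ 2) + ∫ u in Ioc 0 Y, Real.exp u * Er h u ^ 2 := by
    rw [← Iic_union_Ioc_eq_Iic hY, setIntegral_union (Iic_disjoint_Ioc le_rfl) measurableSet_Ioc
      (i1.mono_set (Iic_subset_Iic.2 hY)) (i1.mono_set Ioc_subset_Iic_self)]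
  rw [e1, e2, ← Imoment_eq Y δ h hY hh hδ]
  have p0 : 0 ≤ ∫ u in Iic 0, Real.exp u * Er h u ^ 2 := integral_nonneg fun u => by positivity
  have p1 : ∫ u in Iic 0, Real.exp u * Er h u ^ 2 ≤ δ ^ 2 := by
    have ie : IntegrableOn (fun u => Real.exp u * δ ^ 2) (Iic 0) := (integrableOn_exp_Iic 0).mul_const _
    have : ∫ u in Iic 0, Real.exp u * Er h u ^ 2 ≤ ∫ u in Iic 0, Real.exp u * δ ^ 2 := by
      refine setIntegral_mono_on (i1.mono_set (Iic_subset_Iic.2 hY)) ie measurableSet_Iic fun u hu => ?_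
      have := Er_neg h u hh (by linarith) hu
      rw [show Real.exp h - 1 = δ by linarith] at this
      exact mul_le_mul_of_nonneg_left this (Real.exp_pos u).le
    rw [integral_mul_const, integral_exp_Iic_zero, one_mul] at this
    exact this
  constructor <;> linarith

/-- `h log(1/h)` versus `δ log (1/δ)` -/
lemma m_cmp (δ h : ℝ) (hδ : 0 < δ) (hl : 1 ≤ Real.log (1 / δ)) (hh : Real.exp h = 1 + δ) :
    0 < h ∧ h ≤ δ ∧ δ ≤ h * (1 + δ) ∧
    |h * Real.log (1 / h) - δ * Real.log (1 / δ)| ≤ δ * (δ * Real.log (1 / δ)) := by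
  have hlog : h = Real.log (1 + δ) := by rw [← hh, Real.log_exp]
  have h0 : 0 < h := by rw [hlog]; exact Real.log_pos (by linarith)
  have h1 : h ≤ δ := by have := Real.add_one_le_exp h; linarith
  have h2 : δ ≤ h * (1 + δ) := by
    have := Real.one_sub_inv_le_log_of_pos (by linarith : 0 < 1 + δ)
    rw [← hlog] at this
    have e : 1 - (1 + δ)⁻¹ = δ / (1 + δ) := by field_simp; ring
    rw [e, div_le_iff₀ (by linarith)] at this
    exact this
  refine ⟨h0, h1, h2, ?_⟩
  have e1 : Real.log (1 / δ) = - Real.log δ := by rw [one_div, Real.log_inv]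
  have e2 : Real.log (1 / h) = - Real.log h := by rw [one_div, Real.log_inv]
  have l1 : Real.log (1 / δ) ≤ Real.log (1 / h) := by
    rw [e1, e2]; have := Real.log_le_log h0 h1; linarith
  have l2 : Real.log (1 / h) ≤ Real.log (1 / δ) + δ := by
    have := Real.log_le_log hδ h2
    rw [Real.log_mul h0.ne' (by linarith), ← hlog] at this
    rw [e1, e2]; linarith
  generalize Real.log (1 / h) = V at *
  generalize Real.log (1 / δ) = W at *
  rw [abs_le]; constructor
  · have a : h * W ≤ h * V := mul_le_mul_of_nonneg_left l1 h0.le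
    have b : δ * (1 - δ) ≤ h := by
      have : h * δ ≤ δ * δ := mul_le_mul_of_nonneg_right h1 hδ.le
      nlinarith
    have c : δ * (1 - δ) * W ≤ h * W := mul_le_mul_of_nonneg_right b (by linarith)
    nlinarith
  · have a : h * V ≤ δ * V := mul_le_mul_of_nonneg_right h1 (by linarith)
    have b : δ * V ≤ δ * (W + δ) := mul_le_mul_of_nonneg_left l2 hδ.le
    have c : δ * δ * 1 ≤ δ * δ * W := mul_le_mul_of_nonneg_left hl (by positivity)
    nlinarith

end ModJ2

open Complex Filter MeasureTheory Real Set
open scoped Topology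
set_option maxHeartbeats 1000000 in
theorem main_aux (hRH : RiemannHypothesis)
    (B₁ B₂ : ℝ) (hB₁ : 0 < B₁) (hB₁₂ : B₁ ≤ B₂) (hB₂ : B₂ ≤ 1)
    (hF : ∀ ε : ℝ, 0 < ε → ∃ X₀ : ℝ, ∀ X : ℝ, X₀ ≤ X → ∀ T : ℝ,
      X ^ B₁ * (Real.log X)⁻¹ ^ 3 ≤ T → T ≤ X ^ B₂ * (Real.log X) ^ 3 →
        ‖Fxt X T - ((T / (2 * π) * Real.log T : ℝ) : ℂ)‖ ≤ ε * (T / (2 * π) * Real.log T)) :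
    ∀ ε : ℝ, 0 < ε → ∃ X₀ : ℝ, ∀ X : ℝ, X₀ ≤ X → ∀ δ : ℝ,
      X ^ (-B₂) ≤ δ → δ ≤ X ^ (-B₁) →
        |Imoment X δ - 1 / 2 * δ * X ^ 2 * Real.log (1 / δ)|
          ≤ ε * (1 / 2 * δ * X ^ 2 * Real.log (1 / δ)) := by
  intro ε hε
  obtain ⟨κ, hκ, hκ4, hκε⟩ : ∃ κ : ℝ, 0 < κ ∧ κ ≤ 1 / 4 ∧ 5 * κ ≤ ε :=
    ⟨min (1 / 4) (ε / 5), by positivity, min_le_left _ _, by linarith [min_le_right (1 / 4) (ε / 5)]⟩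
  have hJ := Jf_asymp hRH B₁ B₂ hB₁ hB₂ hF
  have hS := SS_asymp hRH B₁ B₂ hB₁ hB₂ hJ (κ ^ 2 / 8) (by positivity)
  obtain ⟨η, hη, hη2⟩ : ∃ η : ℝ, 0 < η ∧ Real.exp (2 * η) = 1 + κ :=
    ⟨Real.log (1 + κ) / 2, by have := Real.log_pos (by linarith : 1 < 1 + κ); linarith,
      by rw [mul_div_cancel₀ _ (by norm_num : (2:ℝ) ≠ 0), Real.exp_log (by linarith)]⟩
  have hη1 : Real.exp η ≤ 5 / 4 := by
    have : Real.exp η ≤ Real.exp (2 * η) := Real.exp_le_exp.2 (by linarith)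
    linarith
  obtain ⟨Y₀, hY₀⟩ := eventually_atTop.1 hS
  have hlim : Tendsto (fun Y : ℝ => Real.exp (-(B₁ * Y))) atTop (𝓝 0) :=
    Real.tendsto_exp_neg_atTop_nhds_zero.comp (tendsto_id.const_mul_atTop hB₁)
  have ev := (hlim.eventually_lt_const hκ).and ((eventually_ge_atTop (Y₀ + η)).and
    ((eventually_ge_atTop (0:ℝ)).and ((tendsto_id.const_mul_atTop hB₁).eventually_ge_atTop 1)))
  obtain ⟨Y₁, hY₁⟩ := eventually_atTop.1 ev
  refine ⟨Real.exp Y₁, fun X hX δ hδl hδu => ?_⟩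
  have hX0 : 0 < X := lt_of_lt_of_le (Real.exp_pos _) hX
  obtain ⟨Y, rfl⟩ : ∃ Y, X = Real.exp Y := ⟨Real.log X, (Real.exp_log hX0).symm⟩
  obtain ⟨w1, w2, w3, w4⟩ := hY₁ Y (Real.exp_le_exp.1 hX)
  simp only [id] at w4
  rw [← Real.exp_mul, show Y * -B₂ = -(B₂ * Y) by ring] at hδl
  rw [← Real.exp_mul, show Y * -B₁ = -(B₁ * Y) by ring] at hδu
  have hδ0 : 0 < δ := lt_of_lt_of_le (Real.exp_pos _) hδl
  have hδκ : δ ≤ κ := by linarith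
  have hlδ : 1 ≤ Real.log (1 / δ) := by
    rw [one_div, Real.log_inv]
    have := Real.log_le_log hδ0 hδu
    rw [Real.log_exp] at this; linarith
  obtain ⟨h, hh⟩ : ∃ h, Real.exp h = 1 + δ := ⟨Real.log (1 + δ), Real.exp_log (by linarith)⟩
  obtain ⟨h0, h1, h2, h3⟩ := m_cmp δ h hδ0 hlδ hh
  have hrange : ∀ Y', Y - η ≤ Y' → Y' ≤ Y + η →
      Real.exp (-(B₂ * Y')) / 2 ≤ h ∧ h ≤ 2 * Real.exp (-(B₁ * Y')) := by
    intro Y' a b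
    constructor
    · have c : Real.exp (-(B₂ * Y')) ≤ Real.exp η * Real.exp (-(B₂ * Y)) := by
        rw [← Real.exp_add]; apply Real.exp_le_exp.2
        have : B₂ * (Y - Y') ≤ B₂ * η := mul_le_mul_of_nonneg_left (by linarith) (by linarith)
        nlinarith
      have d : Real.exp η * Real.exp (-(B₂ * Y)) ≤ 5 / 4 * δ :=
        mul_le_mul hη1 hδl (Real.exp_pos _).le (by norm_num)
      have e : δ ≤ h * (5 / 4) := h2.trans (mul_le_mul_of_nonneg_left (by linarith) h0.le)
      linarith
    · have c : Real.exp (-(B₁ * Y)) ≤ Real.exp η * Real.exp (-(B₁ * Y')) := by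
        rw [← Real.exp_add]; apply Real.exp_le_exp.2
        have : B₁ * (Y' - Y) ≤ B₁ * η := mul_le_mul_of_nonneg_left (by linarith) (by linarith)
        nlinarith
      have d : Real.exp η * Real.exp (-(B₁ * Y')) ≤ 2 * Real.exp (-(B₁ * Y')) :=
        mul_le_mul_of_nonneg_right (by linarith) (Real.exp_pos _).le
      linarith
  have g : ∀ Y', Y - η ≤ Y' → Y' ≤ Y + η → _ := fun Y' a b =>
    hY₀ Y' (by linarith) h (hrange Y' a b).1 (hrange Y' a b).2
  obtain ⟨i1, s1⟩ := g (Y - η) le_rfl (by linarith)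
  obtain ⟨i2, s2⟩ := g Y (by linarith) (by linarith)
  obtain ⟨i3, s3⟩ := g (Y + η) (by linarith) le_rfl
  obtain ⟨iP, p1, p2⟩ := P_bounds h Y η (Real.exp (2 * η)) _ _ hη rfl i1 i2 i3 s1 s2 s3
  generalize hm : h * Real.log (1 / h) = m at *
  generalize hW : Real.log (1 / δ) = W at *
  have hδW : 0 < δ * W := by positivity
  have h4 := abs_le.1 h3
  have h5 : δ * (δ * W) ≤ κ * (δ * W) := mul_le_mul_of_nonneg_right hδκ hδW.le
  have k1 : κ * (δ * W) ≤ 1 / 4 * (δ * W) := mul_le_mul_of_nonneg_right hκ4 hδW.le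
  have hm0 : 0 ≤ m := by linarith [h4.1]
  have hp := abs_le.1 (P_final (Pf h Y) m κ _ _ hm0 hκ (by linarith) hη2 rfl p1 p2)
  obtain ⟨q1, q2⟩ := Imoment_P Y δ h w3 h0.le hh.symm (by linarith) iP
  have hX1 : 1 ≤ Real.exp Y ^ 2 := one_le_pow₀ (Real.one_le_exp w3)
  generalize Real.exp Y ^ 2 = Z at *
  have h6 : δ ^ 2 ≤ Z * (κ * (δ * W)) := by
    have a : δ ^ 2 ≤ δ * (δ * W) := by
      have := mul_le_mul_of_nonneg_left hlδ (mul_pos hδ0 hδ0).le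
      linarith
    have b : 0 ≤ κ * (δ * W) := by positivity
    have c : δ * (δ * W) ≤ 1 * (κ * (δ * W)) := by linarith
    exact a.trans (c.trans (mul_le_mul_of_nonneg_right hX1 b))
  have h7 : κ / 2 * m ≤ κ * (δ * W) := by
    have k1 : κ * (δ * W) ≤ 1 / 4 * (δ * W) := mul_le_mul_of_nonneg_right hκ4 hδW.le
    have : m ≤ 2 * (δ * W) := by linarith [h4.2]
    have := mul_le_mul_of_nonneg_left this (by positivity : 0 ≤ κ / 2)
    linarith
  have h8 : |Pf h Y - δ * W / 2| ≤ 3 / 2 * (κ * (δ * W)) := by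
    rw [abs_le]; constructor <;> linarith [h4.1, h4.2, hp.1, hp.2]
  have h9 := abs_le.1 h8
  have hZ : 0 ≤ Z := by linarith
  have z1 := mul_le_mul_of_nonneg_left h9.1 hZ
  have z2 := mul_le_mul_of_nonneg_left h9.2 hZ
  have z3 : Z * (5 * κ * (δ * W)) ≤ Z * (ε * (δ * W)) :=
    mul_le_mul_of_nonneg_left (mul_le_mul_of_nonneg_right hκε hδW.le) hZ
  have z4 : 0 ≤ Z * (κ * (δ * W)) := by positivity
  rw [abs_le]; constructor <;> linarith

/-- Goldston–Montgomery: assume RH and `0 < B₁ ≤ B₂ ≤ 1`.  If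
`F(X,T) ~ (T/2π) log T` uniformly for `X^{B₁}(log X)⁻³ ≤ T ≤ X^{B₂}(log X)³`, then
`I(X,δ) ~ ½ δ X² log(1/δ)` uniformly for `X^{-B₂} ≤ δ ≤ X^{-B₁}`. -/
theorem SPC_implies_second_moment (hRH : RiemannHypothesis)
    (B₁ B₂ : ℝ) (hB₁ : 0 < B₁) (hB₁₂ : B₁ ≤ B₂) (hB₂ : B₂ ≤ 1)
    (hF : ∀ ε : ℝ, 0 < ε → ∃ X₀ : ℝ, ∀ X : ℝ, X₀ ≤ X → ∀ T : ℝ,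
      X ^ B₁ * (Real.log X)⁻¹ ^ 3 ≤ T → T ≤ X ^ B₂ * (Real.log X) ^ 3 →
        ‖Fxt X T - ((T / (2 * π) * Real.log T : ℝ) : ℂ)‖ ≤ ε * (T / (2 * π) * Real.log T)) :
    ∀ ε : ℝ, 0 < ε → ∃ X₀ : ℝ, ∀ X : ℝ, X₀ ≤ X → ∀ δ : ℝ,
      X ^ (-B₂) ≤ δ → δ ≤ X ^ (-B₁) →
        |Imoment X δ - 1 / 2 * δ * X ^ 2 * Real.log (1 / δ)|
          ≤ ε * (1 / 2 * δ * X ^ 2 * Real.log (1 / δ)) := by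
  exact main_aux hRH B₁ B₂ hB₁ hB₁₂ hB₂ hF
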